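/- arXiv:1802.03092 — 2 statements merged into one kernel-verified Lean document; each statement's English description precedes it below -/
import Mathlib

section
/- Let d ≥ 1 and let G be a finite simple graph with maximum degree at most d. If it is not the case that d = 3 and G contains a subgraph isomorphic to the complete bipartite graph K_{3,3}, then G is realizable in ℝ^d. -/
/-- A graph `G` is realizable in `ℝ^d` if there is an injective map from its vertices to
`EuclideanSpace ℝ (Fin d)` sending adjacent vertices to points at distance `1`. -/
def GraphRealizable {V : Type*} (G : SimpleGraph V) (d : ℕ) : Prop :=
  ∃ f : V → EuclideanSpace ℝ (Fin d), Function.Injective f ∧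
    ∀ u v : V, G.Adj u v → dist (f u) (f v) = 1

/-- `G` contains a subgraph isomorphic to `H`: there is an injective map of vertices sending
adjacent vertices to adjacent vertices. -/
def ContainsSubgraphIso {V W : Type*} (G : SimpleGraph V) (H : SimpleGraph W) : Prop :=
  ∃ f : W → V, Function.Injective f ∧ ∀ u v : W, H.Adj u v → G.Adj (f u) (f v)

section Partition

variable {V ι : Type*} [Fintype V] [DecidableEq ι]

/-- The neighbours of `v` lying in the class `i` of the partition `p`. -/
def nbrsIn (G : SimpleGraph V) [DecidableRel G.Adj] (p : V → Option ι) (i : Option ι) (v : V) :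
    Finset V :=
  {w | G.Adj v w ∧ p w = i}

/-- The weight of a vertex in a given class of a partition. -/
def classWeight (k : ι → ℕ) : Option ι → ℤ
  | none => 1
  | some j => -2 * k j

/-- The potential minimized by a good partition: twice the number of monochromatic edges plus
the weights of the vertices. -/
def partitionCost (G : SimpleGraph V) [DecidableRel G.Adj] (k : ι → ℕ) (p : V → Option ι) : ℤ :=
  ∑ v, ((nbrsIn G p (p v) v).card + classWeight k (p v) : ℤ)

variable {G : SimpleGraph V} [DecidableRel G.Adj] {k : ι → ℕ} {p : V → Option ι}

lemma mem_nbrsIn {i : Option ι} {v w : V} : w ∈ nbrsIn G p i v ↔ G.Adj v w ∧ p w = i := by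
  simp [nbrsIn]

section Counting

variable [Fintype ι]

lemma card_none_add_sum_card_some (v : V) :
    (nbrsIn G p none v).card + ∑ j, (nbrsIn G p (some j) v).card = G.degree v := by
  rw [← Fintype.sum_option (fun i => (nbrsIn G p i v).card),
    ← SimpleGraph.card_neighborFinset_eq_degree,
    Finset.card_eq_sum_card_fiberwise (f := p) (t := Finset.univ) (by simp)]
  refine Finset.sum_congr rfl fun i _ => ?_
  congr 1
  ext w
  simp [nbrsIn]

lemma exists_card_none_eq_zero_or_card_le {d : ℕ} (hk : ∑ j, (k j + 1) = d) {v : V}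
    (hv : G.degree v ≤ d) :
    (nbrsIn G p none v).card = 0 ∨ ∃ j, (nbrsIn G p (some j) v).card ≤ k j := by
  by_contra! hcon
  have h1 := card_none_add_sum_card_some (G := G) (p := p) v
  have h2 : ∑ j, (k j + 1) ≤ ∑ j, (nbrsIn G p (some j) v).card :=
    Finset.sum_le_sum fun j _ => hcon.2 j
  omega

lemma exists_card_le_of_three {d : ℕ} (hk : ∑ j, (k j + 1) = d) {a : V} (hdeg : G.degree a ≤ d)
    {j : ι} (hkj : k j = 1) (ha : 3 ≤ (nbrsIn G p none a).card) :
    ∃ i, i ≠ j ∧ (nbrsIn G p (some i) a).card ≤ k i := by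
  by_contra! hcon
  have h1 := card_none_add_sum_card_some (G := G) (p := p) a
  rw [← Finset.add_sum_erase _ _ (Finset.mem_univ j)] at h1 hk
  have := Finset.sum_le_sum (s := Finset.univ.erase j) (f := fun i => k i + 1)
    (g := fun i => (nbrsIn G p (some i) a).card) fun i hi => hcon i (Finset.ne_of_mem_erase hi)
  omega

end Counting

/-- A partition of minimal cost. -/
def IsMinPartition (G : SimpleGraph V) [DecidableRel G.Adj] (k : ι → ℕ) (p : V → Option ι) :
    Prop :=
  ∀ q, partitionCost G k p ≤ partitionCost G k q

lemma exists_isMinPartition [Finite ι] (G : SimpleGraph V) [DecidableRel G.Adj] (k : ι → ℕ) :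
    ∃ p, IsMinPartition G k p :=
  Finite.exists_min _

variable [DecidableEq V]

lemma card_nbrsIn_update (v w : V) (i j : Option ι) :
    ((nbrsIn G (Function.update p v j) i w).card : ℤ) + (if G.Adj w v ∧ p v = i then 1 else 0) =
      (nbrsIn G p i w).card + (if G.Adj w v ∧ j = i then 1 else 0) := by
  have key : ∀ q : V → Option ι, ((nbrsIn G q i w).card : ℤ) =
      (((Finset.univ.erase v).filter fun u => G.Adj w u ∧ q u = i).card : ℤ) +
        (if G.Adj w v ∧ q v = i then 1 else 0) := by
    intro q
    have : nbrsIn G q i w = if G.Adj w v ∧ q v = i then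
        insert v ((Finset.univ.erase v).filter fun u => G.Adj w u ∧ q u = i)
        else (Finset.univ.erase v).filter fun u => G.Adj w u ∧ q u = i := by
      split_ifs with h <;> ext u <;> by_cases hu : u = v <;> simp_all [nbrsIn]
    rw [this]
    split_ifs with h
    · rw [Finset.card_insert_of_notMem (by simp)]; push_cast; ring
    · simp
  rw [key, key p]
  have : ((Finset.univ.erase v).filter fun u => G.Adj w u ∧ Function.update p v j u = i) =
      (Finset.univ.erase v).filter fun u => G.Adj w u ∧ p u = i := by
    apply Finset.filter_congr
    intro u hu
    rw [Function.update_of_ne (Finset.ne_of_mem_erase hu)]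
  rw [this]
  simp only [Function.update_self]
  ring

lemma card_nbrsIn_update_self (v : V) (i j : Option ι) :
    (nbrsIn G (Function.update p v j) i v).card = (nbrsIn G p i v).card := by
  have := card_nbrsIn_update (G := G) (p := p) v v i j
  simpa using this

lemma partitionCost_update (v : V) (j : Option ι) :
    partitionCost G k (Function.update p v j) = partitionCost G k p +
      2 * ((nbrsIn G p j v).card - (nbrsIn G p (p v) v).card) +
        classWeight k j - classWeight k (p v) := by
  have split : ∀ q : V → Option ι, partitionCost G k q =
      ((nbrsIn G q (q v) v).card + classWeight k (q v) : ℤ) +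
        ∑ w ∈ Finset.univ.erase v, ((nbrsIn G q (q w) w).card + classWeight k (q w) : ℤ) := by
    intro q
    exact (Finset.add_sum_erase _ _ (Finset.mem_univ v)).symm
  have cnt : ∀ i : Option ι, ((nbrsIn G p i v).card : ℤ) =
      ∑ w ∈ Finset.univ.erase v, if G.Adj w v ∧ i = p w then (1 : ℤ) else 0 := by
    intro i
    rw [Finset.sum_boole]
    congr 2
    ext w
    simp only [mem_nbrsIn, Finset.mem_filter, Finset.mem_erase, Finset.mem_univ, and_true]
    constructor
    · rintro ⟨h, rfl⟩
      exact ⟨h.ne', h.symm, rfl⟩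
    · rintro ⟨-, h, rfl⟩
      exact ⟨h.symm, rfl⟩
  have rest : ∑ w ∈ Finset.univ.erase v, ((nbrsIn G (Function.update p v j)
        (Function.update p v j w) w).card + classWeight k (Function.update p v j w) : ℤ) =
      ∑ w ∈ Finset.univ.erase v, ((nbrsIn G p (p w) w).card + classWeight k (p w) : ℤ) +
        (nbrsIn G p j v).card - (nbrsIn G p (p v) v).card := by
    rw [cnt, cnt, ← Finset.sum_add_distrib, ← Finset.sum_sub_distrib]
    refine Finset.sum_congr rfl fun w hw => ?_
    rw [Function.update_of_ne (Finset.ne_of_mem_erase hw)]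
    linarith [card_nbrsIn_update (G := G) (p := p) v w (p w) j]
  rw [split, split p, rest]
  simp only [Function.update_self, card_nbrsIn_update_self]
  ring

namespace IsMinPartition

lemma le_move (hp : IsMinPartition G k p) (v : V) (j : Option ι) :
    2 * ((nbrsIn G p (p v) v).card : ℤ) + classWeight k (p v) ≤
      2 * (nbrsIn G p j v).card + classWeight k j := by
  have := hp (Function.update p v j)
  rw [partitionCost_update] at this
  linarith

variable {d : ℕ} [Fintype ι]

lemma card_none_eq_zero (hp : IsMinPartition G k p) (hk : ∑ j, (k j + 1) = d)
    (hdeg : ∀ v, G.degree v ≤ d) {v : V} (hv : p v = none) : (nbrsIn G p none v).card = 0 := by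
  have h1 := card_none_add_sum_card_some (G := G) (p := p) v
  have h2 : ∑ j, (k j + 1) ≤ ∑ j, (nbrsIn G p (some j) v).card := by
    refine Finset.sum_le_sum fun j _ => ?_
    have := hp.le_move v (some j)
    simp only [hv, classWeight] at this
    omega
  have := hdeg v
  omega

lemma card_some_eq (hp : IsMinPartition G k p) (hk : ∑ j, (k j + 1) = d)
    (hdeg : ∀ v, G.degree v ≤ d) {v : V} (hv : p v = none) (j : ι) :
    (nbrsIn G p (some j) v).card = k j + 1 := by
  have h1 := card_none_add_sum_card_some (G := G) (p := p) v
  have h3 : ∀ j ∈ Finset.univ, k j + 1 ≤ (nbrsIn G p (some j) v).card := by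
    intro j _
    have := hp.le_move v (some j)
    simp only [hv, classWeight] at this
    omega
  have h2 : ∑ j, (k j + 1) = ∑ j, (nbrsIn G p (some j) v).card := by
    have := hdeg v
    have := Finset.sum_le_sum h3
    omega
  exact ((Finset.sum_eq_sum_iff_of_le h3).1 h2 j (Finset.mem_univ j)).symm

lemma card_some_le (hp : IsMinPartition G k p) (hk : ∑ j, (k j + 1) = d)
    (hdeg : ∀ v, G.degree v ≤ d) {v : V} {j : ι} (hv : p v = some j) :
    (nbrsIn G p (some j) v).card ≤ k j := by
  by_contra! hlt
  rcases exists_card_none_eq_zero_or_card_le (p := p) hk (hdeg v) with h | ⟨i, hi⟩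
  · have := hp.le_move v none
    simp only [hv, classWeight] at this
    omega
  · have := hp.le_move v (some i)
    simp only [hv, classWeight] at this
    omega

lemma card_none_le_one (hp : IsMinPartition G k p) (hk : ∑ j, (k j + 1) = d)
    (hdeg : ∀ v, G.degree v ≤ d) {u v : V} {j : ι} (hu : p u = some j)
    (hk' : (nbrsIn G p (some j) u).card = k j) (hv : p v = none) (huv : G.Adj u v) :
    (nbrsIn G p none u).card ≤ 1 := by
  have h3 : ∀ i ∈ Finset.univ.erase j, k i + 1 ≤ (nbrsIn G p (some i) u).card := by
    intro i hi
    have hij := Finset.ne_of_mem_erase hi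
    have h0 := hp.le_move u (some i)
    simp only [hu, classWeight, hk'] at h0
    by_contra! hlt
    have h1 := hp (Function.update (Function.update p u (some i)) v (some j))
    rw [partitionCost_update, partitionCost_update, Function.update_of_ne huv.ne', hu, hv] at h1
    have h4 := card_nbrsIn_update (G := G) (p := p) u v (some j) (some i)
    have h5 := card_nbrsIn_update (G := G) (p := p) u v none (some i)
    have h6 := hp.card_some_eq hk hdeg hv j
    have h7 := hp.card_none_eq_zero hk hdeg hv
    simp only [hu, huv.symm, Option.some.injEq, hij, classWeight, reduceCtorEq, if_true, if_false,
      and_true, and_false] at h1 h4 h5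
    omega
  have h1 := card_none_add_sum_card_some (G := G) (p := p) u
  rw [← Finset.add_sum_erase _ _ (Finset.mem_univ j)] at h1 hk
  have := Finset.sum_le_sum h3
  have := hdeg u
  omega

lemma adj_of_saturated (hp : IsMinPartition G k p) (hk : ∑ j, (k j + 1) = d)
    (hdeg : ∀ v, G.degree v ≤ d) {u x v : V} {j : ι} (hu : p u = some j) (hx : p x = some j)
    (hku : (nbrsIn G p (some j) u).card = k j) (hkx : (nbrsIn G p (some j) x).card = k j)
    (hv : p v = none) (huv : G.Adj u v) (hxv : G.Adj x v) (hne : u ≠ x) : G.Adj u x := by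
  by_contra hux
  have hux' : ¬ G.Adj x u := fun h => hux h.symm
  set q := Function.update (Function.update p u none) v (some j) with hq
  have hd0 := hp.card_none_le_one hk hdeg hu hku hv huv
  have h4 := card_nbrsIn_update (G := G) (p := p) u v (some j) none
  have h5 := card_nbrsIn_update (G := G) (p := p) u v none none
  have h6 := hp.card_some_eq hk hdeg hv j
  have h7 := hp.card_none_eq_zero hk hdeg hv
  have hcost : partitionCost G k q ≤ partitionCost G k p := by
    rw [hq, partitionCost_update, partitionCost_update, Function.update_of_ne huv.ne', hu, hv]
    simp only [hu, huv.symm, classWeight, reduceCtorEq, if_true, if_false,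
      and_true, and_false] at h4 h5 ⊢
    omega
  have hqmin : IsMinPartition G k q := fun r => hcost.trans (hp r)
  have hqx : q x = some j := by
    rw [hq, Function.update_of_ne hxv.ne, Function.update_of_ne hne.symm, hx]
  have h8 := hqmin.card_some_le hk hdeg hqx
  have h9 := card_nbrsIn_update (G := G) (p := p) u x (some j) none
  have h10 := card_nbrsIn_update (G := G) (p := Function.update p u none) v x (some j) (some j)
  rw [Function.update_of_ne huv.ne', hv] at h10
  simp only [hux', hxv, reduceCtorEq, if_true, if_false, and_true, and_false, false_and] at h9 h10
  rw [← hq] at h10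
  omega

lemma false_of_three_twins (hp : IsMinPartition G k p) (hk : ∑ j, (k j + 1) = d)
    (hdeg : ∀ v, G.degree v ≤ d) {j : ι} (hkj : k j = 1) {a b : V} {T : Finset V} (hT : T.card = 3)
    (hnone : ∀ v ∈ T, p v = none) (htwin : ∀ v ∈ T, nbrsIn G p (some j) v = {a, b}) : False := by
  obtain ⟨v, w, z, hvw, hvz, hwz, rfl⟩ := Finset.card_eq_three.1 hT
  have ha : ∀ u ∈ ({v, w, z} : Finset V), G.Adj u a ∧ p a = some j := fun u hu =>
    mem_nbrsIn.1 (by rw [htwin u hu]; simp)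
  have hb : ∀ u ∈ ({v, w, z} : Finset V), G.Adj u b ∧ p b = some j := fun u hu =>
    mem_nbrsIn.1 (by rw [htwin u hu]; simp)
  have hpa := (ha v (by simp)).2
  have hpb := (hb v (by simp)).2
  have hab : a ≠ b := by
    rintro rfl
    have := hp.card_some_eq hk hdeg (hnone v (by simp)) j
    rw [htwin v (by simp), hkj] at this
    simp at this
  have ha3 : 3 ≤ (nbrsIn G p none a).card := by
    rw [← hT]
    exact Finset.card_le_card fun u hu => mem_nbrsIn.2 ⟨(ha u hu).1.symm, hnone u hu⟩
  have hb3 : 3 ≤ (nbrsIn G p none b).card := by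
    rw [← hT]
    exact Finset.card_le_card fun u hu => mem_nbrsIn.2 ⟨(hb u hu).1.symm, hnone u hu⟩
  obtain ⟨i, hij, hi⟩ := exists_card_le_of_three hk (hdeg a) hkj ha3
  set q₁ := Function.update p a (some i) with hq₁
  have hb3' : 3 ≤ (nbrsIn G q₁ none b).card := by
    have := card_nbrsIn_update (G := G) (p := p) a b none (some i)
    simp only [← hq₁, hpa, reduceCtorEq, and_false, if_false] at this
    omega
  obtain ⟨i', hij', hi'⟩ := exists_card_le_of_three hk (hdeg b) hkj hb3'
  set q₂ := Function.update q₁ b (some i') with hq₂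
  have hq₁b : q₁ b = some j := by rw [hq₁, Function.update_of_ne hab.symm, hpb]
  have hq₂p : ∀ u, u ≠ a → u ≠ b → q₂ u = p u := fun u h1 h2 => by
    rw [hq₂, Function.update_of_ne h2, hq₁, Function.update_of_ne h1]
  have hq₂a : q₂ a = some i := by
    rw [hq₂, Function.update_of_ne hab, hq₁, Function.update_self]
  have hq₂b : q₂ b = some i' := by rw [hq₂, Function.update_self]
  have hq₂none : ∀ u ∈ ({v, w, z} : Finset V), q₂ u = none := fun u hu => by
    rw [hq₂p u (ha u hu).1.ne (hb u hu).1.ne, hnone u hu]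
  have hj0 : ∀ u ∈ ({v, w, z} : Finset V), (nbrsIn G q₂ (some j) u).card = 0 := by
    intro u hu
    rw [Finset.card_eq_zero, Finset.eq_empty_iff_forall_notMem]
    intro x hx
    rw [mem_nbrsIn] at hx
    by_cases hxa : x = a
    · rw [hxa, hq₂a, Option.some_inj] at hx; exact hij hx.2
    by_cases hxb : x = b
    · rw [hxb, hq₂b, Option.some_inj] at hx; exact hij' hx.2
    rw [hq₂p x hxa hxb, ← mem_nbrsIn, htwin u hu] at hx
    simp [hxa, hxb] at hx
  have hnadj : ¬ G.Adj w v := by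
    intro h
    have h0 := hp.card_none_eq_zero hk hdeg (hnone w (by simp))
    rw [Finset.card_eq_zero] at h0
    have : v ∈ nbrsIn G p none w := mem_nbrsIn.2 ⟨h, hnone v (by simp)⟩
    simp [h0] at this
  set q₃ := Function.update q₂ v (some j) with hq₃
  have hq₃w : q₃ w = none := by
    rw [hq₃, Function.update_of_ne hvw.symm, hq₂none w (by simp)]
  have hw := card_nbrsIn_update (G := G) (p := q₂) v w (some j) (some j)
  simp only [hnadj, false_and, if_false] at hw
  rw [← hq₃] at hw
  have c₁ := partitionCost_update (G := G) (k := k) (p := p) a (some i)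
  have c₂ := partitionCost_update (G := G) (k := k) (p := q₁) b (some i')
  have c₃ := partitionCost_update (G := G) (k := k) (p := q₂) v (some j)
  have c₄ := partitionCost_update (G := G) (k := k) (p := q₃) w (some j)
  have c₅ := hp (Function.update q₃ w (some j))
  have h1 := hj0 v (by simp)
  have h2 := hj0 w (by simp)
  rw [← hq₁, hpa] at c₁
  rw [← hq₂, hq₁b] at c₂
  rw [← hq₃, hq₂none v (by simp)] at c₃
  rw [hq₃w] at c₄
  simp only [classWeight, hkj] at c₁ c₂ c₃ c₄
  omega

end IsMinPartition

end Partition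

section Representation

open Matrix Real

variable {V : Type*} {G : SimpleGraph V}

/-- An injective map of the vertices in `A` to the sphere of radius `1 / √2` in `ℝ^n` sending
adjacent vertices to orthogonal vectors, such that each set in `𝒩` lies on exactly one
hyperplane `g ⬝ᵥ x = 1`, and these hyperplanes are distinct. -/
structure IsSphericalRep (G : SimpleGraph V) (A : Set V) (𝒩 : Set (Finset V)) {n : ℕ}
    (f : V → Fin n → ℝ) : Prop where
  norm : ∀ a ∈ A, f a ⬝ᵥ f a = 1 / 2
  orth : ∀ a ∈ A, ∀ b ∈ A, G.Adj a b → f a ⬝ᵥ f b = 0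
  inj : Set.InjOn f A
  exists_dual : ∀ N ∈ 𝒩, ∃ g, ∀ a ∈ N, g ⬝ᵥ f a = 1
  dual_unique : ∀ N ∈ 𝒩, ∀ M ∈ 𝒩, ∀ g, (∀ a ∈ N, g ⬝ᵥ f a = 1) → (∀ a ∈ M, g ⬝ᵥ f a = 1) → N = M

lemma exists_matching_angles [Countable V] (A : Set V)
    (hA : ∀ a ∈ A, ∀ b ∈ A, ∀ c ∈ A, G.Adj a b → G.Adj a c → b = c) :
    ∃ φ : V → ℝ, Set.InjOn φ A ∧ (∀ a, 0 ≤ φ a ∧ φ a < π) ∧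
      ∀ a ∈ A, ∀ b ∈ A, G.Adj a b → φ a = φ b + π / 2 ∨ φ b = φ a + π / 2 := by
  classical
  obtain ⟨r, hr⟩ := exists_injective_nat V
  let θ : V → ℝ := fun a => 1 / ((r a : ℝ) + 1)
  have hθ : Function.Injective θ := by
    intro a b hab
    simp only [θ, one_div, _root_.inv_inj, add_left_inj, Nat.cast_inj] at hab
    exact hr hab
  have hθ0 : ∀ a, 0 < θ a := fun a => by positivity
  have hθ1 : ∀ a, θ a ≤ 1 := fun a => by
    simp only [θ]
    rw [div_le_one (by positivity)]
    linarith [(Nat.cast_nonneg (r a) : (0 : ℝ) ≤ r a)]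
  have hπ := pi_gt_three
  let P : V → V → Prop := fun a b => b ∈ A ∧ G.Adj a b ∧ r b < r a
  let φ : V → ℝ := fun a => if h : ∃ b, P a b then θ h.choose + π / 2 else θ a
  have hpos : ∀ a ∈ A, ∀ b, P a b → φ a = θ b + π / 2 := by
    intro a ha b hb
    have h : ∃ b, P a b := ⟨b, hb⟩
    simp only [φ, dif_pos h]
    rw [hA a ha _ h.choose_spec.1 b hb.1 h.choose_spec.2.1 hb.2.1]
  have hneg : ∀ a, (¬ ∃ b, P a b) → φ a = θ a := fun a h => by simp only [φ, dif_neg h]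
  refine ⟨φ, ?_, ?_, ?_⟩
  · intro a ha b hb hab
    by_cases h1 : ∃ c, P a c <;> by_cases h2 : ∃ c, P b c
    · obtain ⟨c, hc⟩ := h1
      obtain ⟨e, he⟩ := h2
      rw [hpos a ha c hc, hpos b hb e he, add_left_inj] at hab
      obtain rfl := hθ hab
      exact hA c hc.1 a ha b hb hc.2.1.symm he.2.1.symm
    · obtain ⟨c, hc⟩ := h1
      rw [hpos a ha c hc, hneg b h2] at hab
      linarith [hθ0 c, hθ1 b]
    · obtain ⟨c, hc⟩ := h2
      rw [hpos b hb c hc, hneg a h1] at hab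
      linarith [hθ0 c, hθ1 a]
    · rw [hneg a h1, hneg b h2] at hab
      exact hθ hab
  · intro a
    simp only [φ]
    split_ifs with h
    · exact ⟨by linarith [hθ0 h.choose], by linarith [hθ1 h.choose]⟩
    · exact ⟨(hθ0 a).le, by linarith [hθ1 a]⟩
  · have key : ∀ a ∈ A, ∀ b ∈ A, G.Adj a b → r b < r a → φ a = φ b + π / 2 := by
      intro a ha b hb hab hlt
      rw [hpos a ha b ⟨hb, hab, hlt⟩, hneg b]
      rintro ⟨c, hc, hbc, hlt'⟩
      rw [hA b hb c hc a ha hbc hab.symm] at hlt'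
      omega
    intro a ha b hb hab
    rcases lt_trichotomy (r a) (r b) with h | h | h
    · exact Or.inr (key b hb a ha hab.symm h)
    · exact absurd (hr h) hab.ne
    · exact Or.inl (key a ha b hb hab h)

/-- A line meets a circle in at most two points. -/
lemma eq_of_dual_circle {p q r g : Fin 2 → ℝ} (hp : p ⬝ᵥ p = 1 / 2) (hq : q ⬝ᵥ q = 1 / 2)
    (hr : r ⬝ᵥ r = 1 / 2) (hgp : g ⬝ᵥ p = 1) (hgq : g ⬝ᵥ q = 1) (hgr : g ⬝ᵥ r = 1) :
    p = q ∨ p = r ∨ q = r := by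
  simp only [dotProduct, Fin.sum_univ_two] at *
  have hG : g 0 * g 0 + g 1 * g 1 ≠ 0 := by
    intro h
    have h0 : g 0 = 0 := by nlinarith [mul_self_nonneg (g 0), mul_self_nonneg (g 1)]
    have h1 : g 1 = 0 := by nlinarith [mul_self_nonneg (g 0), mul_self_nonneg (g 1)]
    simp [h0, h1] at hgp
  have key : ∀ x y : Fin 2 → ℝ, g 0 * x 0 + g 1 * x 1 = 1 → g 0 * y 0 + g 1 * y 1 = 1 →
      g 0 * x 1 - g 1 * x 0 = g 0 * y 1 - g 1 * y 0 → x = y := by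
    intro x y hx hy hxy
    have e0 : (g 0 * g 0 + g 1 * g 1) * (x 0 - y 0) = 0 := by
      linear_combination g 0 * hx - g 0 * hy - g 1 * hxy
    have e1 : (g 0 * g 0 + g 1 * g 1) * (x 1 - y 1) = 0 := by
      linear_combination g 1 * hx - g 1 * hy + g 0 * hxy
    ext i
    fin_cases i
    · exact sub_eq_zero.1 ((mul_eq_zero.1 e0).resolve_left hG)
    · exact sub_eq_zero.1 ((mul_eq_zero.1 e1).resolve_left hG)
  have sq : ∀ x : Fin 2 → ℝ, x 0 * x 0 + x 1 * x 1 = 1 / 2 → g 0 * x 0 + g 1 * x 1 = 1 →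
      (g 0 * x 1 - g 1 * x 0) ^ 2 = (g 0 * g 0 + g 1 * g 1) / 2 - 1 := by
    intro x hx hgx
    linear_combination (g 0 * g 0 + g 1 * g 1) * hx - (g 0 * x 0 + g 1 * x 1 + 1) * hgx
  have h1 := sq p hp hgp
  have h2 := sq q hq hgq
  have h3 := sq r hr hgr
  rcases sq_eq_sq_iff_eq_or_eq_neg.1 (h1.trans h2.symm) with h | h
  · exact Or.inl (key p q hgp hgq h)
  rcases sq_eq_sq_iff_eq_or_eq_neg.1 (h1.trans h3.symm) with h' | h'
  · exact Or.inr (Or.inl (key p r hgp hgr h'))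
  · exact Or.inr (Or.inr (key q r hgq hgr (by linarith)))

lemma exists_sphericalRep_two [Countable V] (A : Set V) (𝒩 : Set (Finset V))
    (hA : ∀ a ∈ A, ∀ b ∈ A, ∀ c ∈ A, G.Adj a b → G.Adj a c → b = c)
    (hsub : ∀ N ∈ 𝒩, (N : Set V) ⊆ A) (hcard : ∀ N ∈ 𝒩, N.card = 2) :
    ∃ f : V → Fin 2 → ℝ, IsSphericalRep G A 𝒩 f := by
  classical
  obtain ⟨φ, hinj, hrange, hφ⟩ := exists_matching_angles A hA
  have hdet : ∀ a ∈ A, ∀ b ∈ A, a ≠ b → cos (φ a) * sin (φ b) - sin (φ a) * cos (φ b) ≠ 0 := by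
    intro a ha b hb hab h
    have h1 : sin (φ b - φ a) = 0 := by rw [sin_sub]; linarith
    rw [sin_eq_zero_iff_of_lt_of_lt (by linarith [hrange a, hrange b])
      (by linarith [hrange a, hrange b])] at h1
    exact hab (hinj ha hb (by linarith))
  have hs : (√2)⁻¹ * (√2)⁻¹ = (1 / 2 : ℝ) := by
    rw [← mul_inv, mul_self_sqrt (by norm_num)]; norm_num
  have hs0 : (√2 : ℝ)⁻¹ ≠ 0 := by positivity
  set s : ℝ := (√2)⁻¹
  let f : V → Fin 2 → ℝ := fun a => ![s * cos (φ a), s * sin (φ a)]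
  have hf0 : ∀ a, f a 0 = s * cos (φ a) := fun a => rfl
  have hf1 : ∀ a, f a 1 = s * sin (φ a) := fun a => rfl
  have hnorm : ∀ a, f a ⬝ᵥ f a = 1 / 2 := by
    intro a
    simp only [dotProduct, Fin.sum_univ_two, hf0, hf1]
    linear_combination (cos (φ a) ^ 2 + sin (φ a) ^ 2) * hs + 1 / 2 * sin_sq_add_cos_sq (φ a)
  have hfinj : Set.InjOn f A := by
    intro a ha b hb hab
    by_contra hne
    apply hdet a ha b hb hne
    have h0 := congrFun hab 0
    have h1 := congrFun hab 1
    rw [hf0, hf0] at h0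
    rw [hf1, hf1] at h1
    rw [mul_left_cancel₀ hs0 h0, mul_left_cancel₀ hs0 h1]
    ring
  refine ⟨f, fun a _ => hnorm a, ?_, hfinj, ?_, ?_⟩
  · intro a ha b hb hab
    simp only [dotProduct, Fin.sum_univ_two, hf0, hf1]
    rcases hφ a ha b hb hab with h | h <;> rw [h, cos_add_pi_div_two, sin_add_pi_div_two] <;> ring
  · intro N hN
    obtain ⟨a, b, hab, rfl⟩ := Finset.card_eq_two.1 (hcard N hN)
    have hD := hdet a (hsub _ hN (by simp)) b (hsub _ hN (by simp)) hab
    set D := cos (φ a) * sin (φ b) - sin (φ a) * cos (φ b) with hD'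
    refine ⟨![(sin (φ b) - sin (φ a)) / (s * D), (cos (φ a) - cos (φ b)) / (s * D)], ?_⟩
    intro x hx
    simp only [Finset.mem_insert, Finset.mem_singleton] at hx
    rcases hx with rfl | rfl
    all_goals
      simp only [dotProduct, Fin.sum_univ_two, hf0, hf1, cons_val_zero, cons_val_one]
      field_simp
      rw [hD']
      ring
  · intro N hN M hM g hgN hgM
    by_contra hne
    have hnot : ¬ M ⊆ N := fun h =>
      hne (Finset.eq_of_subset_of_card_le h (by rw [hcard N hN, hcard M hM])).symm
    obtain ⟨c, hcM, hcN⟩ := Finset.not_subset.1 hnot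
    obtain ⟨a, b, hab, rfl⟩ := Finset.card_eq_two.1 (hcard N hN)
    have haA := hsub _ hN (show a ∈ _ by simp)
    have hbA := hsub _ hN (show b ∈ _ by simp)
    have hcA := hsub _ hM hcM
    simp only [Finset.mem_insert, Finset.mem_singleton, not_or] at hcN
    rcases eq_of_dual_circle (hnorm a) (hnorm b) (hnorm c) (hgN a (by simp)) (hgN b (by simp))
      (hgM c hcM) with h | h | h
    · exact hab (hfinj haA hbA h)
    · exact hcN.1 (hfinj hcA haA h.symm)
    · exact hcN.2 (hfinj hcA hbA h.symm)

end Representation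

section Space

open Matrix Real

lemma quadratic_finite {a b c : ℝ} (h : a ≠ 0 ∨ b ≠ 0 ∨ c ≠ 0) :
    {t : ℝ | a * t ^ 2 + b * t + c = 0}.Finite := by
  open Polynomial in
  have hp : (C a * X ^ 2 + C b * X + C c : ℝ[X]) ≠ 0 := by
    intro h0
    have h2 := congrArg (fun p => p.coeff 2) h0
    have h1 := congrArg (fun p => p.coeff 1) h0
    have h00 := congrArg (fun p => p.coeff 0) h0
    simp [coeff_X, coeff_C] at h2 h1 h00
    simp_all
  refine (Polynomial.finite_setOfPred_isRoot hp).subset fun t ht => ?_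
  simpa [Polynomial.IsRoot] using ht

/-- The cross product vanishes exactly when the usual coordinates do. -/
lemma cross_eq_zero_iff {u v : Fin 3 → ℝ} : u ⨯₃ v = 0 ↔
    u 1 * v 2 - u 2 * v 1 = 0 ∧ u 2 * v 0 - u 0 * v 2 = 0 ∧ u 0 * v 1 - u 1 * v 0 = 0 := by
  rw [cross_apply]
  simp

lemma dot_three (u v : Fin 3 → ℝ) : u ⬝ᵥ v = u 0 * v 0 + u 1 * v 1 + u 2 * v 2 := by
  simp [dotProduct, Fin.sum_univ_three]

lemma dot_self_pos {u : Fin 3 → ℝ} (hu : u ≠ 0) : 0 < u ⬝ᵥ u := by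
  refine lt_of_le_of_ne ?_ fun h => hu (dotProduct_self_eq_zero.1 h.symm)
  rw [dot_three]
  linarith [mul_self_nonneg (u 0), mul_self_nonneg (u 1), mul_self_nonneg (u 2)]

lemma exists_dot_ne_zero {B : Set (Fin 3 → ℝ)} (hB : B.Finite) (h0 : ∀ n ∈ B, n ≠ 0) :
    ∃ y : Fin 3 → ℝ, ∀ n ∈ B, n ⬝ᵥ y ≠ 0 := by
  have hfin : (⋃ n ∈ B, {t : ℝ | n 2 * t ^ 2 + n 1 * t + n 0 = 0}).Finite := by
    refine hB.biUnion fun n hn => quadratic_finite ?_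
    by_contra! h
    apply h0 n hn
    ext i
    fin_cases i <;> simp [h]
  obtain ⟨t, ht⟩ := hfin.exists_notMem
  simp only [Set.mem_iUnion, Set.mem_ofPred_eq, not_exists] at ht
  refine ⟨![1, t, t ^ 2], fun n hn h => ht n hn ?_⟩
  rw [dot_three] at h
  simp at h
  linarith

/-- A frame of two orthogonal vectors of length `1 / √2` in the plane orthogonal to `y`. -/
lemma exists_orthogonal_frame {y : Fin 3 → ℝ} (hy : y ≠ 0) : ∃ u w : Fin 3 → ℝ,
    u ⬝ᵥ y = 0 ∧ w ⬝ᵥ y = 0 ∧ u ⬝ᵥ w = 0 ∧ u ⬝ᵥ u = 1 / 2 ∧ w ⬝ᵥ w = 1 / 2 ∧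
      ∀ n : Fin 3 → ℝ, n ⬝ᵥ u = 0 → n ⬝ᵥ w = 0 → y ⨯₃ n = 0 := by
  obtain ⟨u₀, hu₀, huy₀⟩ : ∃ u₀ : Fin 3 → ℝ, u₀ ≠ 0 ∧ u₀ ⬝ᵥ y = 0 := by
    by_cases h : y 0 = 0 ∧ y 1 = 0
    · refine ⟨![1, 0, 0], fun h => by simpa using congrFun h 0, ?_⟩
      rw [dot_three, h.1]
      simp
    · refine ⟨![-y 1, y 0, 0], fun h' => h ⟨?_, ?_⟩, ?_⟩
      · simpa using congrFun h' 1
      · simpa using congrFun h' 0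
      · rw [dot_three]
        change -y 1 * y 0 + y 0 * y 1 + 0 * y 2 = 0
        ring
  have normalize : ∀ x : Fin 3 → ℝ, x ≠ 0 → ∃ s : ℝ, s ≠ 0 ∧ (s • x) ⬝ᵥ (s • x) = 1 / 2 := by
    intro x hx
    have hpos := dot_self_pos hx
    refine ⟨(√(2 * (x ⬝ᵥ x)))⁻¹, by positivity, ?_⟩
    rw [smul_dotProduct, dotProduct_smul, smul_eq_mul, smul_eq_mul, ← mul_assoc, ← mul_inv,
      mul_self_sqrt (by positivity)]
    field_simp
  have hw₀ : y ⨯₃ u₀ ≠ 0 := by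
    intro h
    have h1 : (y ⨯₃ u₀) ⬝ᵥ (y ⨯₃ u₀) = (y ⬝ᵥ y) * (u₀ ⬝ᵥ u₀) := by
      rw [cross_dot_cross, dotProduct_comm y u₀, huy₀]; ring
    rw [h, zero_dotProduct] at h1
    exact (mul_pos (dot_self_pos hy) (dot_self_pos hu₀)).ne h1
  obtain ⟨s, hs, hsu⟩ := normalize u₀ hu₀
  obtain ⟨r, hr, hrw⟩ := normalize _ hw₀
  refine ⟨s • u₀, r • (y ⨯₃ u₀), ?_, ?_, ?_, hsu, hrw, ?_⟩
  · rw [smul_dotProduct, huy₀, smul_zero]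
  · rw [smul_dotProduct, dotProduct_comm, dot_self_cross, smul_zero]
  · rw [smul_dotProduct, dotProduct_smul, dot_cross_self]; simp
  · intro n hnu hnw
    rw [dotProduct_smul, smul_eq_zero] at hnu hnw
    have h1 := hnu.resolve_left hs
    have h2 := hnw.resolve_left hr
    have hc : (u₀ ⬝ᵥ u₀) • (y ⨯₃ n) = 0 := by
      rw [cross_apply, dot_three] at h2
      rw [dot_three] at h1 huy₀
      simp only [cons_val] at h2
      rw [cross_apply, dot_three]
      ext i
      fin_cases i <;> simp only [Fin.zero_eta, Fin.mk_one, Fin.reduceFinMk, Pi.smul_apply,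
        smul_eq_mul, cons_val, Pi.zero_apply]
      · linear_combination -u₀ 0 * h2 - u₀ 1 * (y 2 * h1 - n 2 * huy₀) +
          u₀ 2 * (y 1 * h1 - n 1 * huy₀)
      · linear_combination -u₀ 1 * h2 - u₀ 2 * (y 0 * h1 - n 0 * huy₀) +
          u₀ 0 * (y 2 * h1 - n 2 * huy₀)
      · linear_combination -u₀ 2 * h2 - u₀ 0 * (y 1 * h1 - n 1 * huy₀) +
          u₀ 1 * (y 0 * h1 - n 0 * huy₀)
    exact (smul_eq_zero.1 hc).resolve_left (dot_self_pos hu₀).ne'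

end Space

section Point

open Matrix Real

lemma smul_eq_smul_of_cross_eq_zero {u v : Fin 3 → ℝ} (h : u ⨯₃ v = 0) :
    (u ⬝ᵥ u) • v = (u ⬝ᵥ v) • u := by
  obtain ⟨h0, h1, h2⟩ := cross_eq_zero_iff.1 h
  ext i
  fin_cases i <;> simp only [Fin.zero_eta, Fin.mk_one, Fin.reduceFinMk, Pi.smul_apply,
    smul_eq_mul, dot_three]
  · linear_combination u 2 * h1 - u 1 * h2
  · linear_combination u 0 * h2 - u 2 * h0
  · linear_combination u 1 * h0 - u 0 * h1

lemma dot_eq_zero_of_cross_eq_zero {y n z : Fin 3 → ℝ} (hn : n ≠ 0) (h : y ⨯₃ n = 0)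
    (hz : z ⬝ᵥ n = 0) : z ⬝ᵥ y = 0 := by
  have h' : n ⨯₃ y = 0 := by rw [← cross_anticomm, h, neg_zero]
  have := congrArg (fun v => z ⬝ᵥ v) (smul_eq_smul_of_cross_eq_zero h')
  simp only [dotProduct_smul, hz, smul_eq_mul, mul_zero] at this
  exact (mul_eq_zero.1 this).resolve_left (dot_self_pos hn).ne'

lemma exists_mem_circle {y : Fin 3 → ℝ} (hy : y ≠ 0) {B : Set ((Fin 3 → ℝ) × ℝ)} (hB : B.Finite)
    (h : ∀ b ∈ B, y ⨯₃ b.1 = 0 → b.2 ≠ 0) :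
    ∃ x : Fin 3 → ℝ, x ⬝ᵥ x = 1 / 2 ∧ x ⬝ᵥ y = 0 ∧ ∀ b ∈ B, x ⬝ᵥ b.1 ≠ b.2 := by
  obtain ⟨u, w, huy, hwy, huw, huu, hww, hker⟩ := exists_orthogonal_frame hy
  have hfin : (⋃ b ∈ B, {t : ℝ | (-(b.1 ⬝ᵥ u) - b.2) * t ^ 2 + (2 * (b.1 ⬝ᵥ w)) * t +
      (b.1 ⬝ᵥ u - b.2) = 0}).Finite := by
    refine hB.biUnion fun b hb => quadratic_finite ?_
    by_contra! h0
    obtain ⟨h1, h2, h3⟩ := h0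
    exact h b hb (hker b.1 (by linarith) (by linarith)) (by linarith)
  obtain ⟨t, ht⟩ := hfin.exists_notMem
  simp only [Set.mem_iUnion, Set.mem_ofPred_eq, not_exists] at ht
  have hwu : w ⬝ᵥ u = 0 := by rw [dotProduct_comm, huw]
  have hpos : 0 < 1 + t ^ 2 := by positivity
  refine ⟨(1 + t ^ 2)⁻¹ • ((1 - t ^ 2) • u + (2 * t) • w), ?_, ?_, fun b hb hbt => ht b hb ?_⟩
  · simp only [smul_dotProduct, dotProduct_smul, add_dotProduct, dotProduct_add, smul_eq_mul,
      huu, hww, huw, hwu]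
    field_simp
    ring
  · simp only [smul_dotProduct, add_dotProduct, huy, hwy, smul_zero, add_zero]
  · simp only [smul_dotProduct, add_dotProduct, smul_eq_mul] at hbt
    rw [dotProduct_comm u, dotProduct_comm w] at hbt
    field_simp at hbt
    linarith

/-- Three distinct points of a sphere are not collinear. -/
lemma cross_sub_ne_zero {r : ℝ} {p q s : Fin 3 → ℝ} (hp : p ⬝ᵥ p = r) (hq : q ⬝ᵥ q = r)
    (hs : s ⬝ᵥ s = r) (hpq : p ≠ q) (hps : p ≠ s) (hqs : q ≠ s) : (p - q) ⨯₃ (p - s) ≠ 0 := by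
  intro h
  have hpar := smul_eq_smul_of_cross_eq_zero h
  have ha : 0 < (p - q) ⬝ᵥ (p - q) := dot_self_pos (sub_ne_zero.2 hpq)
  set a := p - q with hadef
  set b := p - s with hbdef
  have h1 : a ⬝ᵥ a = 2 * (p ⬝ᵥ a) := by
    simp only [hadef, sub_dotProduct, dotProduct_sub, dotProduct_comm q p]
    linarith
  have h2 : b ⬝ᵥ b = 2 * (p ⬝ᵥ b) := by
    simp only [hbdef, sub_dotProduct, dotProduct_sub, dotProduct_comm s p]
    linarith
  have e1 : (a ⬝ᵥ a) * (p ⬝ᵥ b) = (a ⬝ᵥ b) * (p ⬝ᵥ a) := by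
    simpa only [dotProduct_smul, smul_eq_mul] using congrArg (fun v => p ⬝ᵥ v) hpar
  have e2 : (a ⬝ᵥ a) * (b ⬝ᵥ b) = (a ⬝ᵥ b) * (a ⬝ᵥ b) := by
    have := congrArg (fun v => b ⬝ᵥ v) hpar
    simp only [dotProduct_smul, smul_eq_mul] at this
    rw [this, dotProduct_comm b a]
  have e3 : (a ⬝ᵥ b) * (a ⬝ᵥ b - a ⬝ᵥ a) = 0 := by
    linear_combination -e2 + (a ⬝ᵥ a) * h2 + 2 * e1 - (a ⬝ᵥ b) * h1
  rcases mul_eq_zero.1 e3 with h0 | h0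
  · rw [h0, zero_smul, smul_eq_zero] at hpar
    exact hps (sub_eq_zero.1 (hpar.resolve_left ha.ne'))
  · rw [sub_eq_zero.1 h0] at hpar
    have : b = a := smul_right_injective _ ha.ne' hpar
    exact hqs (sub_right_injective this).symm

/-- A point of the sphere of radius `1 / √2` orthogonal to `y` and generic with respect to `Z`. -/
lemma exists_generic_point {y : Fin 3 → ℝ} (hy : y ≠ 0) {Z : Set (Fin 3 → ℝ)} (hZ : Z.Finite)
    (hnorm : ∀ z ∈ Z, z ⬝ᵥ z = 1 / 2)
    (horth : ∀ z ∈ Z, ∀ z' ∈ Z, z ⬝ᵥ y = 0 → z' ⬝ᵥ y = 0 → z = z') :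
    ∃ x : Fin 3 → ℝ, x ⬝ᵥ x = 1 / 2 ∧ x ⬝ᵥ y = 0 ∧
      (∀ z ∈ Z, x ⬝ᵥ z = 0 → y ⨯₃ z = 0) ∧
      (∀ z ∈ Z, x ⨯₃ z ≠ 0) ∧
      (∀ z ∈ Z, ∀ z' ∈ Z, z ⨯₃ z' ≠ 0 → x ⬝ᵥ (z ⨯₃ z') ≠ 0) ∧
      (∀ p ∈ Z, ∀ q ∈ Z, ∀ s ∈ Z, p ≠ q → p ≠ s → q ≠ s →
        x ⬝ᵥ ((p - q) ⨯₃ (p - s)) ≠ p ⬝ᵥ ((p - q) ⨯₃ (p - s))) ∧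
      (∀ z ∈ Z, ∀ z' ∈ Z, ∀ ε : ℝ, ε ^ 2 = 2 → x ⬝ᵥ (z + z' + ε • (z ⨯₃ z')) ≠ 1 / 2) := by
  let C : Set ((Fin 3 → ℝ) × ℝ) :=
    (fun z => (z, (0 : ℝ))) '' Z ∪ (fun z => (z, (1 / 2 : ℝ))) '' Z ∪
    (fun z => (z, (-1 / 2 : ℝ))) '' Z ∪
    (fun z : (Fin 3 → ℝ) × (Fin 3 → ℝ) => (z.1 ⨯₃ z.2, (0 : ℝ))) '' (Z ×ˢ Z) ∪
    (fun z : (Fin 3 → ℝ) × (Fin 3 → ℝ) × (Fin 3 → ℝ) =>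
      ((z.1 - z.2.1) ⨯₃ (z.1 - z.2.2), z.1 ⬝ᵥ ((z.1 - z.2.1) ⨯₃ (z.1 - z.2.2)))) ''
        (Z ×ˢ (Z ×ˢ Z)) ∪
    (fun z : ℝ × (Fin 3 → ℝ) × (Fin 3 → ℝ) =>
      (z.2.1 + z.2.2 + z.1 • (z.2.1 ⨯₃ z.2.2), (1 / 2 : ℝ))) '' ({√2, -√2} ×ˢ (Z ×ˢ Z))
  have hC : C.Finite := by
    have h2 := hZ.prod hZ
    have hε : ({√2, -√2} : Set ℝ).Finite := by simp
    exact (((((hZ.image _).union (hZ.image _)).union (hZ.image _)).union (h2.image _)).union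
      ((hZ.prod h2).image _)).union ((hε.prod h2).image _)
  obtain ⟨x, hx, hxy, hB⟩ := exists_mem_circle hy
    (hC.subset (Set.sep_subset C fun b => y ⨯₃ b.1 = 0 → b.2 ≠ 0)) fun b hb => hb.2
  have avoid : ∀ n t, (n, t) ∈ C → (y ⨯₃ n = 0 → t ≠ 0) → x ⬝ᵥ n ≠ t :=
    fun n t h1 h2 => hB (n, t) ⟨h1, h2⟩
  refine ⟨x, hx, hxy, fun z hz h0 => ?_, fun z hz hcr => ?_, fun z hz z' hz' hne => ?_,
    fun p hp q hq s hs hpq hps hqs => ?_, fun z hz z' hz' ε hε => ?_⟩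
  · by_contra hne
    refine avoid z 0 ?_ (fun h => absurd h hne) h0
    simp only [C, Set.mem_union]
    exact .inl <| .inl <| .inl <| .inl <| .inl ⟨z, hz, rfl⟩
  · have h1 : x ⬝ᵥ z ≠ 1 / 2 := avoid z _ (by
      simp only [C, Set.mem_union]
      exact .inl <| .inl <| .inl <| .inl <| .inr ⟨z, hz, rfl⟩) fun _ => by norm_num
    have h2 : x ⬝ᵥ z ≠ -1 / 2 := avoid z _ (by
      simp only [C, Set.mem_union]
      exact .inl <| .inl <| .inl <| .inr ⟨z, hz, rfl⟩) fun _ => by norm_num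
    have h3 : (x ⨯₃ z) ⬝ᵥ (x ⨯₃ z) = 0 := by rw [hcr, zero_dotProduct]
    rw [cross_dot_cross, hx, hnorm z hz, dotProduct_comm z x] at h3
    have h4 : (x ⬝ᵥ z - 1 / 2) * (x ⬝ᵥ z - -1 / 2) = 0 := by linarith
    rcases mul_eq_zero.1 h4 with h | h
    · exact h1 (sub_eq_zero.1 h)
    · exact h2 (sub_eq_zero.1 h)
  · refine avoid _ 0 ?_ fun h => ?_
    · simp only [C, Set.mem_union]
      exact .inl <| .inl <| .inr ⟨(z, z'), ⟨hz, hz'⟩, rfl⟩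
    · have e := horth z hz z' hz'
        (dot_eq_zero_of_cross_eq_zero hne h (dot_self_cross z z'))
        (dot_eq_zero_of_cross_eq_zero hne h (dot_cross_self z z'))
      exact absurd (by rw [e, cross_self]) hne
  · refine avoid _ _ ?_ fun h h0 => ?_
    · simp only [C, Set.mem_union]
      exact .inl <| .inr ⟨(p, q, s), ⟨hp, hq, hs⟩, rfl⟩
    · have hn := cross_sub_ne_zero (hnorm p hp) (hnorm q hq) (hnorm s hs) hpq hps hqs
      have hq0 : q ⬝ᵥ ((p - q) ⨯₃ (p - s)) = 0 := by
        have := dot_self_cross (p - q) (p - s)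
        rw [sub_dotProduct, h0] at this
        linarith
      exact hpq (horth p hp q hq (dot_eq_zero_of_cross_eq_zero hn h h0)
        (dot_eq_zero_of_cross_eq_zero hn h hq0))
  · refine avoid _ _ ?_ fun _ => by norm_num
    simp only [C, Set.mem_union]
    refine .inr ⟨(ε, z, z'), ⟨?_, hz, hz'⟩, rfl⟩
    rw [← sq_sqrt (show (0 : ℝ) ≤ 2 by norm_num)] at hε
    exact sq_eq_sq_iff_eq_or_eq_neg.1 hε

/-- A vector neither orthogonal nor parallel to any vector of a finite set. -/
lemma exists_generic_vector {Z : Set (Fin 3 → ℝ)} (hZ : Z.Finite) (h0 : ∀ z ∈ Z, z ≠ 0) :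
    ∃ y : Fin 3 → ℝ, y ≠ 0 ∧ ∀ z ∈ Z, z ⬝ᵥ y ≠ 0 ∧ y ⨯₃ z ≠ 0 := by
  have hex : ∀ z : Fin 3 → ℝ, z ≠ 0 → ∃ n : Fin 3 → ℝ, n ≠ 0 ∧ n ⬝ᵥ z = 0 := by
    intro z hz
    obtain ⟨u, -, hu, -, -, hn, -⟩ := exists_orthogonal_frame hz
    exact ⟨u, fun h => by simp [h] at hn, hu⟩
  choose! n hn hnz using hex
  obtain ⟨y, hy⟩ := exists_dot_ne_zero (((hZ.union (hZ.image n)).union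
    (Set.finite_singleton (fun _ => (1 : ℝ)))) : (_ : Set (Fin 3 → ℝ)).Finite) (by
      rintro m ((hm | ⟨z, hz, rfl⟩) | rfl)
      · exact h0 m hm
      · exact hn z (h0 z hz)
      · exact fun h => one_ne_zero (congrFun h 0))
  refine ⟨y, ?_, fun z hz => ⟨hy z (.inl (.inl hz)), fun h => ?_⟩⟩
  · rintro rfl
    exact hy _ (.inr rfl) (dotProduct_zero _)
  · exact hy (n z) (.inl (.inr ⟨z, hz, rfl⟩))
      (dot_eq_zero_of_cross_eq_zero (h0 z hz) h (hnz z (h0 z hz)))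

end Point

section Extension

open Matrix Real

variable {V : Type*} [DecidableEq V] {G : SimpleGraph V}

lemma dot_cross_eq_zero_of_orthogonal {g a b e : Fin 3 → ℝ} (hg : g ≠ 0) (ha : g ⬝ᵥ a = 0)
    (hb : g ⬝ᵥ b = 0) (he : g ⬝ᵥ e = 0) : e ⬝ᵥ (a ⨯₃ b) = 0 := by
  refine dot_eq_zero_of_cross_eq_zero hg ?_ (by rw [dotProduct_comm, he])
  rw [cross_cross_eq_smul_sub_smul, dotProduct_comm a g, dotProduct_comm b g, ha, hb]
  simp

/-- A placement on the sphere of radius `1 / √2` of the vertices in `S ∪ Y`, in which the vertices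
in `Y` are in general position subject to adjacent ones being orthogonal. -/
structure IsGenericExtension (G : SimpleGraph V) (S Y : Finset V) (f : V → Fin 3 → ℝ) :
    Prop where
  norm : ∀ a ∈ S ∪ Y, f a ⬝ᵥ f a = 1 / 2
  orth : ∀ a ∈ Y, ∀ b ∈ Y, G.Adj a b → f a ⬝ᵥ f b = 0
  perp : ∀ a ∈ Y, ∀ b ∈ S ∪ Y, a ≠ b → f a ⬝ᵥ f b = 0 → G.Adj a b
  cross : ∀ a ∈ Y, ∀ b ∈ S ∪ Y, a ≠ b → f a ⨯₃ f b ≠ 0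
  det : ∀ c ∈ Y, ∀ a ∈ S ∪ Y, ∀ b ∈ S ∪ Y, a ≠ c → b ≠ c → f a ⨯₃ f b ≠ 0 →
    f c ⬝ᵥ (f a ⨯₃ f b) ≠ 0
  not_coplanar : ∀ U ⊆ S ∪ Y, 4 ≤ U.card → ¬ Disjoint U Y → ∀ g, ¬ ∀ a ∈ U, g ⬝ᵥ f a = 1
  frames : ∀ p ∈ Y, ∀ q ∈ Y, ∀ r ∈ Y, ∀ s ∈ Y, p ≠ r → p ≠ s → q ≠ r → q ≠ s →
    G.Adj p q → G.Adj r s → ∀ ε ε' : ℝ, ε ^ 2 = 2 → ε' ^ 2 = 2 →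
      f p + f q + ε • (f p ⨯₃ f q) ≠ f r + f s + ε' • (f r ⨯₃ f s)

namespace IsGenericExtension

variable {S Y : Finset V} {f f' : V → Fin 3 → ℝ}

lemma congr (hf : IsGenericExtension G S Y f) (h : ∀ a ∈ S ∪ Y, f' a = f a) :
    IsGenericExtension G S Y f' where
  norm a ha := by rw [h a ha]; exact hf.norm a ha
  orth a ha b hb := by
    rw [h a (Finset.mem_union_right _ ha), h b (Finset.mem_union_right _ hb)]
    exact hf.orth a ha b hb
  perp a ha b hb := by
    rw [h a (Finset.mem_union_right _ ha), h b hb]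
    exact hf.perp a ha b hb
  cross a ha b hb := by
    rw [h a (Finset.mem_union_right _ ha), h b hb]
    exact hf.cross a ha b hb
  det c hc a ha b hb := by
    rw [h c (Finset.mem_union_right _ hc), h a ha, h b hb]
    exact hf.det c hc a ha b hb
  not_coplanar U hU h4 hUY g hg := hf.not_coplanar U hU h4 hUY g fun a ha => by
    rw [← h a (hU ha)]; exact hg a ha
  frames p hp q hq r hr s hs := by
    rw [h p (Finset.mem_union_right _ hp), h q (Finset.mem_union_right _ hq),
      h r (Finset.mem_union_right _ hr), h s (Finset.mem_union_right _ hs)]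
    exact hf.frames p hp q hq r hr s hs

lemma injOn (hf : IsGenericExtension G S Y f) (hS : Set.InjOn f S) :
    Set.InjOn f (S ∪ Y : Finset V) := by
  have key : ∀ a ∈ Y, ∀ b ∈ S ∪ Y, f a = f b → a = b := by
    intro a ha b hb hab
    by_contra hne
    exact hf.cross a ha b hb hne (by rw [hab, cross_self])
  intro a ha b hb hab
  rcases Finset.mem_union.1 ha with haS | haY
  · rcases Finset.mem_union.1 hb with hbS | hbY
    · exact hS haS hbS hab
    · exact (key b hbY a ha hab.symm).symm
  · exact key a haY b hb hab

lemma insert {c : V} (hc : c ∉ S ∪ Y) (hf : IsGenericExtension G S Y f)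
    (hnorm : f c ⬝ᵥ f c = 1 / 2)
    (horth : ∀ b ∈ Y, G.Adj c b → f c ⬝ᵥ f b = 0)
    (hperp : ∀ b ∈ S ∪ Y, f c ⬝ᵥ f b = 0 → G.Adj c b)
    (hcross : ∀ b ∈ S ∪ Y, f c ⨯₃ f b ≠ 0)
    (hdet : ∀ a ∈ S ∪ Y, ∀ b ∈ S ∪ Y, f a ⨯₃ f b ≠ 0 → f c ⬝ᵥ (f a ⨯₃ f b) ≠ 0)
    (hcop : ∀ p ∈ S ∪ Y, ∀ q ∈ S ∪ Y, ∀ s ∈ S ∪ Y, p ≠ q → p ≠ s → q ≠ s →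
      f c ⬝ᵥ ((f p - f q) ⨯₃ (f p - f s)) ≠ f p ⬝ᵥ ((f p - f q) ⨯₃ (f p - f s)))
    (hframe : ∀ p ∈ S ∪ Y, ∀ q ∈ S ∪ Y, ∀ ε : ℝ, ε ^ 2 = 2 →
      f c ⬝ᵥ (f p + f q + ε • (f p ⨯₃ f q)) ≠ 1 / 2) :
    IsGenericExtension G S (insert c Y) f := by
  have hW : ∀ a, a ∈ S ∪ Insert.insert c Y ↔ a = c ∨ a ∈ S ∪ Y := fun a => by
    simp only [Finset.mem_union, Finset.mem_insert]; tauto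
  have hYW : ∀ {a}, a ∈ Y → a ∈ S ∪ Y := fun h => Finset.mem_union_right _ h
  have hYc : ∀ {a}, a ∈ Y → a ≠ c := by rintro a ha rfl; exact hc (hYW ha)
  refine ⟨?_, ?_, ?_, ?_, ?_, ?_, ?_⟩
  · intro a ha
    rcases (hW a).1 ha with rfl | ha
    exacts [hnorm, hf.norm a ha]
  · intro a ha b hb hab
    rcases Finset.mem_insert.1 ha with rfl | haY <;> rcases Finset.mem_insert.1 hb with rfl | hbY
    · exact absurd rfl hab.ne
    · exact horth b hbY hab
    · rw [dotProduct_comm]; exact horth a haY hab.symm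
    · exact hf.orth a haY b hbY hab
  · intro a ha b hb hne h
    rcases Finset.mem_insert.1 ha with rfl | haY <;> rcases (hW b).1 hb with rfl | hbW
    · exact absurd rfl hne
    · exact hperp b hbW h
    · rw [dotProduct_comm] at h; exact (hperp a (hYW haY) h).symm
    · exact hf.perp a haY b hbW hne h
  · intro a ha b hb hne h
    rcases Finset.mem_insert.1 ha with rfl | haY <;> rcases (hW b).1 hb with rfl | hbW
    · exact absurd rfl hne
    · exact hcross b hbW h
    · rw [← cross_anticomm, neg_eq_zero] at h; exact hcross a (hYW haY) h
    · exact hf.cross a haY b hbW hne h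
  · intro e he a ha b hb hae hbe hab h
    rcases Finset.mem_insert.1 he with rfl | heY
    · exact hdet a (((hW a).1 ha).resolve_left hae) b (((hW b).1 hb).resolve_left hbe) hab h
    rcases (hW a).1 ha with rfl | haW <;> rcases (hW b).1 hb with rfl | hbW
    · exact hab (cross_self _)
    · rw [triple_product_permutation] at h
      refine hdet b hbW e (hYW heY) ?_ h
      rw [← cross_anticomm, neg_ne_zero]
      exact hf.cross e heY b hbW hbe.symm
    · rw [triple_product_permutation, triple_product_permutation] at h
      exact hdet e (hYW heY) a haW (hf.cross e heY a haW hae.symm) h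
    · exact hf.det e heY a haW b hbW hae hbe hab h
  · intro U hU h4 hUY g hg
    by_cases hcU : c ∈ U
    · have h3 : 2 < (U.erase c).card := by rw [Finset.card_erase_of_mem hcU]; omega
      obtain ⟨p, hp, q, hq, s, hs, hpq, hps, hqs⟩ := Finset.two_lt_card.1 h3
      have hmem : ∀ {a}, a ∈ U.erase c → a ∈ S ∪ Y := fun h =>
        ((hW _).1 (hU (Finset.mem_of_mem_erase h))).resolve_left (Finset.ne_of_mem_erase h)
      have hg1 : ∀ {a}, a ∈ U.erase c → g ⬝ᵥ f a = 1 := fun h => hg _ (Finset.mem_of_mem_erase h)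
      refine hcop p (hmem hp) q (hmem hq) s (hmem hs) hpq hps hqs ?_
      rw [← sub_eq_zero, ← sub_dotProduct]
      have hg0 : g ≠ 0 := by rintro rfl; simpa using hg c hcU
      refine dot_cross_eq_zero_of_orthogonal hg0 ?_ ?_ ?_ <;> rw [dotProduct_sub]
      · rw [hg1 hp, hg1 hq, sub_self]
      · rw [hg1 hp, hg1 hs, sub_self]
      · rw [hg1 hp, hg c hcU, sub_self]
    · refine hf.not_coplanar U (fun a ha => ((hW a).1 (hU ha)).resolve_left ?_) h4 ?_ g hg
      · rintro rfl; exact hcU ha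
      · rwa [Finset.disjoint_insert_right, not_and, imp_iff_right hcU] at hUY
  · have key : ∀ p ∈ S ∪ Y, ∀ q ∈ S ∪ Y, ∀ r ∈ Y, G.Adj c r → ∀ ε ε' : ℝ, ε ^ 2 = 2 →
        f p + f q + ε • (f p ⨯₃ f q) ≠ f c + f r + ε' • (f c ⨯₃ f r) := by
      intro p hp q hq r hr hcr ε ε' hε h
      apply hframe p hp q hq ε hε
      rw [h, dotProduct_add, dotProduct_add, dotProduct_smul, dot_self_cross, hnorm,
        horth r hr hcr]
      simp
    have swap : ∀ (ε : ℝ) (a b : V),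
        f a + f b + ε • (f a ⨯₃ f b) = f b + f a + (-ε) • (f b ⨯₃ f a) := by
      intro ε a b
      rw [add_comm (f a), ← cross_anticomm (f a), smul_neg, neg_smul]; simp
    intro p hp q hq r hr s hs hpr hps hqr hqs hpq hrs ε ε' hε hε' h
    rcases Finset.mem_insert.1 hp with rfl | hpY
    · have hqY := (Finset.mem_insert.1 hq).resolve_left hpq.ne'
      have hrY := (Finset.mem_insert.1 hr).resolve_left hpr.symm
      have hsY := (Finset.mem_insert.1 hs).resolve_left hps.symm
      exact key r (hYW hrY) s (hYW hsY) q hqY hpq ε' ε hε' h.symm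
    rcases Finset.mem_insert.1 hq with rfl | hqY
    · have hrY := (Finset.mem_insert.1 hr).resolve_left hqr.symm
      have hsY := (Finset.mem_insert.1 hs).resolve_left hqs.symm
      rw [swap] at h
      exact key r (hYW hrY) s (hYW hsY) p hpY hpq.symm ε' (-ε) hε' h.symm
    rcases Finset.mem_insert.1 hr with rfl | hrY
    · have hsY := (Finset.mem_insert.1 hs).resolve_left hrs.ne'
      exact key p (hYW hpY) q (hYW hqY) s hsY hrs ε ε' hε h
    rcases Finset.mem_insert.1 hs with rfl | hsY
    · rw [swap ε'] at h
      exact key p (hYW hpY) q (hYW hqY) r hrY hrs.symm ε (-ε') hε h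
    exact hf.frames p hpY q hqY r hrY s hsY hpr hps hqr hqs hpq hrs ε ε' hε hε' h

/-- The points of the sphere orthogonal to the two points of `N`. -/
lemma exists_pole {F : Finset V} {f : V → Fin 3 → ℝ}
    (hf : IsGenericExtension G ∅ F f) {N : Finset V} (hN : N ⊆ F) (hcard : N.card = 2) :
    ∃ E : Fin 3 → ℝ, E ⬝ᵥ E = 1 / 2 ∧ (∀ a ∈ N, f a ⬝ᵥ E = 0) ∧
      (∀ a ∈ F, f a ⬝ᵥ E = 0 → a ∈ N) ∧
      ∀ p ∈ N, ∀ q ∈ N, p ≠ q → f p ⬝ᵥ f q = 0 →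
        ∃ ε : ℝ, ε ^ 2 = 2 ∧ E = ε • (f p ⨯₃ f q) := by
  obtain ⟨p, q, hpq, rfl⟩ := Finset.card_eq_two.1 hcard
  have hp : p ∈ F := hN (by simp)
  have hq : q ∈ F := hN (by simp)
  have hne : f p ⨯₃ f q ≠ 0 := hf.cross p hp q (by simpa using hq) hpq
  have hpos := dot_self_pos hne
  set m := f p ⨯₃ f q with hm
  have hs : √(2 * (m ⬝ᵥ m)) ^ 2 = 2 * (m ⬝ᵥ m) := sq_sqrt (by positivity)
  have hs0 : √(2 * (m ⬝ᵥ m)) ≠ 0 := by positivity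
  set s := √(2 * (m ⬝ᵥ m))
  have hEm : (s⁻¹ • m) ⬝ᵥ (s⁻¹ • m) = 1 / 2 := by
    rw [smul_dotProduct, dotProduct_smul, smul_eq_mul, smul_eq_mul]
    field_simp
    linarith
  refine ⟨s⁻¹ • m, hEm, ?_, ?_, ?_⟩
  · intro a ha
    simp only [Finset.mem_insert, Finset.mem_singleton] at ha
    rcases ha with rfl | rfl
    · rw [dotProduct_smul, hm, dot_self_cross, smul_zero]
    · rw [dotProduct_smul, hm, dot_cross_self, smul_zero]
  · intro a ha h
    by_contra hmem
    simp only [Finset.mem_insert, Finset.mem_singleton, not_or] at hmem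
    rw [dotProduct_smul, smul_eq_mul] at h
    exact hf.det a ha p (by simpa using hp) q (by simpa using hq) (Ne.symm hmem.1)
      (Ne.symm hmem.2) hne ((mul_eq_zero.1 h).resolve_left (inv_ne_zero hs0))
  · have key : f p ⬝ᵥ f q = 0 → s⁻¹ ^ 2 = 2 := by
      intro h0
      have h1 : m ⬝ᵥ m = 1 / 4 := by
        rw [hm, cross_dot_cross, h0, hf.norm p (by simpa using hp),
          hf.norm q (by simpa using hq)]
        norm_num
      rw [inv_pow, hs, h1]
      norm_num
    intro p' hp' q' hq' hne' h0
    simp only [Finset.mem_insert, Finset.mem_singleton] at hp' hq'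
    rcases hp' with rfl | rfl <;> rcases hq' with rfl | rfl
    · exact absurd rfl hne'
    · exact ⟨s⁻¹, key h0, rfl⟩
    · refine ⟨-s⁻¹, by rw [neg_sq]; exact key (by rw [dotProduct_comm, h0]), ?_⟩
      rw [hm, ← cross_anticomm, smul_neg, neg_smul]
    · exact absurd rfl hne'

end IsGenericExtension

lemma exists_isGenericExtension [DecidableRel G.Adj] (S : Finset V) (f₀ : V → Fin 3 → ℝ)
    (hnorm : ∀ a ∈ S, f₀ a ⬝ᵥ f₀ a = 1 / 2) (hinj : Set.InjOn f₀ S) (Y : Finset V)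
    (hSY : Disjoint S Y) (hno : ∀ a ∈ S, ∀ b ∈ Y, ¬ G.Adj b a)
    (hdeg : ∀ a ∈ Y, (Y.filter (G.Adj a)).card ≤ 2)
    (hdegen : ∀ T ⊆ Y, T.Nonempty → ∃ c ∈ T, (T.filter (G.Adj c)).card ≤ 1) :
    ∃ f : V → Fin 3 → ℝ, (∀ a ∈ S, f a = f₀ a) ∧ IsGenericExtension G S Y f := by
  induction Y using Finset.strongInduction with
  | H Y ih =>
  rcases Y.eq_empty_or_nonempty with rfl | hY
  · refine ⟨f₀, fun _ _ => rfl, ?_⟩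
    constructor <;> simp_all
  obtain ⟨c, hc, hc1⟩ := hdegen Y subset_rfl hY
  set Y' := Y.erase c with hY'
  have hsub : Y' ⊆ Y := Finset.erase_subset _ _
  have hins : insert c Y' = Y := Finset.insert_erase hc
  obtain ⟨f, hfS, hf⟩ := ih Y' (Finset.erase_ssubset hc) (hSY.mono_right hsub)
    (fun a ha b hb => hno a ha b (hsub hb))
    (fun a ha => (Finset.card_le_card (Finset.filter_subset_filter _ hsub)).trans
      (hdeg a (hsub ha)))
    (fun T hT => hdegen T (hT.trans hsub))
  have hcW : c ∉ S ∪ Y' := by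
    simp only [Finset.mem_union, not_or]
    exact ⟨fun h => Finset.disjoint_left.1 hSY h hc, Finset.notMem_erase c Y⟩
  have hfinj : Set.InjOn f (S ∪ Y' : Finset V) := hf.injOn fun a ha b hb hab => by
    rw [hfS a ha, hfS b hb] at hab
    exact hinj ha hb hab
  have hYW : ∀ {a}, a ∈ Y' → a ∈ S ∪ Y' := fun h => Finset.mem_union_right _ h
  have hne0 : ∀ a ∈ S ∪ Y', f a ≠ 0 := by
    intro a ha h
    have := hf.norm a ha
    rw [h, zero_dotProduct] at this
    norm_num at this
  let Z : Set (Fin 3 → ℝ) := f '' (S ∪ Y' : Finset V)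
  have hZ : Z.Finite := (Finset.finite_toSet _).image f
  obtain ⟨y, hy, hyadj, hyorth, hyperp⟩ : ∃ y : Fin 3 → ℝ, y ≠ 0 ∧
      (∀ b ∈ Y', G.Adj c b → f b = y) ∧
      (∀ a ∈ S ∪ Y', ∀ b ∈ S ∪ Y', f a ⬝ᵥ y = 0 → f b ⬝ᵥ y = 0 → a = b) ∧
      (∀ a ∈ S ∪ Y', y ⨯₃ f a = 0 → G.Adj c a) := by
    by_cases h : ∃ b ∈ Y', G.Adj c b
    · obtain ⟨b, hb, hcb⟩ := h
      have hadj : ∀ a ∈ S ∪ Y', f a ⬝ᵥ f b = 0 → a ∈ Y' ∧ G.Adj b a := by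
        intro a ha h0
        have hba : b ≠ a := by
          rintro rfl
          rw [hf.norm b ha] at h0
          norm_num at h0
        have hadj := hf.perp b hb a ha hba (by rw [dotProduct_comm, h0])
        exact ⟨(Finset.mem_union.1 ha).resolve_left fun h => hno a h b (hsub hb) hadj, hadj⟩
      refine ⟨f b, hne0 b (hYW hb), fun b' hb' hcb' => ?_, fun a ha a' ha' h0 h0' => ?_,
        fun a ha h0 => ?_⟩
      · rw [Finset.card_le_one.1 hc1 b' (by simp [hsub hb', hcb']) b (by simp [hsub hb, hcb])]
      · obtain ⟨haY, hba⟩ := hadj a ha h0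
        obtain ⟨haY', hba'⟩ := hadj a' ha' h0'
        by_contra hne
        have hsub3 : {c, a, a'} ⊆ Y.filter (G.Adj b) := by
          intro e he
          simp only [Finset.mem_insert, Finset.mem_singleton] at he
          rcases he with rfl | rfl | rfl
          · simp [hc, hcb.symm]
          · simp [hsub haY, hba]
          · simp [hsub haY', hba']
        have h3 : ({c, a, a'} : Finset V).card = 3 := Finset.card_eq_three.2
          ⟨c, a, a', (Finset.ne_of_mem_erase haY).symm, (Finset.ne_of_mem_erase haY').symm, hne,
            rfl⟩
        have := (Finset.card_le_card hsub3).trans (hdeg b (hsub hb))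
        omega
      · by_cases hba : b = a
        · rwa [← hba]
        · exact absurd h0 (hf.cross b hb a ha hba)
    · obtain ⟨y, hy, hyZ⟩ := exists_generic_vector hZ (by rintro _ ⟨a, ha, rfl⟩; exact hne0 a ha)
      exact ⟨y, hy, fun b hb hcb => absurd ⟨b, hb, hcb⟩ h,
        fun a ha _ _ h0 _ => absurd h0 (hyZ _ ⟨a, ha, rfl⟩).1,
        fun a ha h0 => absurd h0 (hyZ _ ⟨a, ha, rfl⟩).2⟩
  obtain ⟨x, hx, hxy, hxperp, hxcross, hxdet, hxcop, hxframe⟩ := exists_generic_point hy hZ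
    (by rintro _ ⟨a, ha, rfl⟩; exact hf.norm a ha)
    (by rintro _ ⟨a, ha, rfl⟩ _ ⟨b, hb, rfl⟩ h1 h2; rw [hyorth a ha b hb h1 h2])
  have hup : ∀ a ∈ S ∪ Y', Function.update f c x a = f a := fun a ha =>
    Function.update_of_ne (by rintro rfl; exact hcW ha) _ _
  have hZmem : ∀ a ∈ S ∪ Y', f a ∈ Z := fun a ha => ⟨a, ha, rfl⟩
  refine ⟨Function.update f c x, fun a ha => ?_, ?_⟩
  · rw [hup a (Finset.mem_union_left _ ha), hfS a ha]
  rw [← hins]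
  refine (hf.congr hup).insert hcW ?_ ?_ ?_ ?_ ?_ ?_ ?_ <;> rw [Function.update_self]
  · exact hx
  · intro b hb hcb
    rw [hup b (hYW hb), hyadj b hb hcb, hxy]
  · intro b hb h0
    rw [hup b hb] at h0
    exact hyperp b hb (hxperp _ (hZmem b hb) h0)
  · intro b hb
    rw [hup b hb]
    exact hxcross _ (hZmem b hb)
  · intro a ha b hb
    rw [hup a ha, hup b hb]
    exact hxdet _ (hZmem a ha) _ (hZmem b hb)
  · intro p hp q hq s hs hpq hps hqs
    rw [hup p hp, hup q hq, hup s hs]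
    exact hxcop _ (hZmem p hp) _ (hZmem q hq) _ (hZmem s hs) (hfinj.ne hp hq hpq)
      (hfinj.ne hp hs hps) (hfinj.ne hq hs hqs)
  · intro p hp q hq
    rw [hup p hp, hup q hq]
    exact hxframe _ (hZmem p hp) _ (hZmem q hq)

end Extension

section Triangles

open Matrix Real

variable {V : Type*} [DecidableEq V] {G : SimpleGraph V} [DecidableRel G.Adj]

/-- Every nonempty subset of `F` has a vertex with at most one neighbor in that subset; that is,
`F` induces a forest. -/
def IsDegenerate (G : SimpleGraph V) [DecidableRel G.Adj] (F : Finset V) : Prop :=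
  ∀ T ⊆ F, T.Nonempty → ∃ c ∈ T, (T.filter (G.Adj c)).card ≤ 1

lemma exists_isDegenerate_subset (X : Finset V) (hX : ∀ a ∈ X, (X.filter (G.Adj a)).card ≤ 2) :
    ∃ F ⊆ X, IsDegenerate G F ∧
      ∀ c ∈ X, c ∉ F → X.filter (G.Adj c) ⊆ F ∧ (X.filter (G.Adj c)).card = 2 := by
  classical
  obtain ⟨F, hF, hmax⟩ := Finset.exists_max_image (X.powerset.filter (IsDegenerate G))
    Finset.card ⟨∅, by
      simp only [Finset.mem_filter, Finset.empty_mem_powerset, true_and]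
      intro T hT hne
      exact absurd hne (by simp [Finset.subset_empty.1 hT])⟩
  rw [Finset.mem_filter, Finset.mem_powerset] at hF
  refine ⟨F, hF.1, hF.2, fun c hc hcF => ?_⟩
  have hnot : ¬ IsDegenerate G (insert c F) := by
    intro h
    have := hmax (insert c F) (by
      rw [Finset.mem_filter, Finset.mem_powerset]
      exact ⟨Finset.insert_subset hc hF.1, h⟩)
    rw [Finset.card_insert_of_notMem hcF] at this
    omega
  simp only [IsDegenerate, not_forall, not_exists, not_and, not_le] at hnot
  obtain ⟨T, hT, hTne, hT2⟩ := hnot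
  have hcT : c ∈ T := by
    by_contra h
    obtain ⟨a, ha, ha1⟩ := hF.2 T ((Finset.subset_insert_iff_of_notMem h).1 hT) hTne
    have := hT2 a ha
    omega
  have h2 := hT2 c hcT
  have hTX : T.filter (G.Adj c) ⊆ X.filter (G.Adj c) :=
    Finset.filter_subset_filter _ (hT.trans (Finset.insert_subset hc hF.1))
  have heq := Finset.eq_of_subset_of_card_le hTX ((hX c hc).trans h2)
  refine ⟨?_, le_antisymm (hX c hc) (heq ▸ h2)⟩
  rw [← heq]
  intro a ha
  rw [Finset.mem_filter] at ha
  exact (Finset.mem_insert.1 (hT ha.1)).resolve_left ha.2.ne'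

lemma false_of_three_adj {X : Finset V} (hX : ∀ a ∈ X, (X.filter (G.Adj a)).card ≤ 2)
    {a x y z : V} (ha : a ∈ X) (hx : x ∈ X) (hy : y ∈ X) (hz : z ∈ X) (hax : G.Adj x a)
    (hay : G.Adj y a) (haz : G.Adj z a) (hxy : x ≠ y) (hxz : x ≠ z) (hyz : y ≠ z) : False := by
  have h3 : ({x, y, z} : Finset V).card = 3 := Finset.card_eq_three.2 ⟨x, y, z, hxy, hxz, hyz, rfl⟩
  have hsub : {x, y, z} ⊆ X.filter (G.Adj a) := by
    intro e he
    simp only [Finset.mem_insert, Finset.mem_singleton] at he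
    rcases he with rfl | rfl | rfl <;> simp [*, G.adj_comm a]
  have := (Finset.card_le_card hsub).trans (hX a ha)
  omega

/-- A point on the plane through an orthogonal frame, determined by the frame. -/
lemma eq_of_dual_frame {p q c g : Fin 3 → ℝ} {ε : ℝ} (hp : p ⬝ᵥ p = 1 / 2) (hq : q ⬝ᵥ q = 1 / 2)
    (hpq : p ⬝ᵥ q = 0) (hε : ε ^ 2 = 2) (hc : c = ε • (p ⨯₃ q)) (hgp : g ⬝ᵥ p = 1)
    (hgq : g ⬝ᵥ q = 1) (hgc : g ⬝ᵥ c = 1) : g = (2 : ℝ) • (p + q + ε • (p ⨯₃ q)) := by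
  have hqp : q ⬝ᵥ p = 0 := by rw [dotProduct_comm, hpq]
  have hcp : c ⬝ᵥ p = 0 := by rw [hc, smul_dotProduct, dotProduct_comm, dot_self_cross, smul_zero]
  have hcq : c ⬝ᵥ q = 0 := by rw [hc, smul_dotProduct, dotProduct_comm, dot_cross_self, smul_zero]
  have hpc : p ⬝ᵥ c = 0 := by rw [dotProduct_comm, hcp]
  have hqc : q ⬝ᵥ c = 0 := by rw [dotProduct_comm, hcq]
  have hmm : (p ⨯₃ q) ⬝ᵥ (p ⨯₃ q) = 1 / 4 := by
    rw [cross_dot_cross, hp, hq, hpq, hqp]; norm_num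
  have hcc : c ⬝ᵥ c = 1 / 2 := by
    rw [hc, smul_dotProduct, dotProduct_smul, hmm, smul_eq_mul, smul_eq_mul]
    linear_combination hε / 4
  rw [← hc, ← sub_eq_zero]
  by_contra hne
  have h := dot_cross_eq_zero_of_orthogonal (a := p) (b := q) (e := c) hne ?_ ?_ ?_
  · rw [hc, smul_dotProduct, hmm] at h
    rw [(smul_eq_zero.1 h).resolve_right (by norm_num)] at hε
    norm_num at hε
  all_goals
    simp only [sub_dotProduct, smul_dotProduct, add_dotProduct, hgp, hgq, hgc, hp, hq, hpq, hqp,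
      hcp, hcq, hpc, hqc, hcc, smul_eq_mul]
    norm_num

lemma exists_sphere_placement [Fintype V] (X : Finset V)
    (hX : ∀ a ∈ X, (X.filter (G.Adj a)).card ≤ 2) :
    ∃ f : V → Fin 3 → ℝ, (∀ a ∈ X, f a ⬝ᵥ f a = 1 / 2) ∧
      (∀ a ∈ X, ∀ b ∈ X, G.Adj a b → f a ⬝ᵥ f b = 0) ∧ Set.InjOn f X ∧
      ∀ T ⊆ X, ∀ T' ⊆ X, T.card = 3 → T'.card = 3 → G.IsClique T → G.IsClique T' →
        ∀ g, (∀ a ∈ T, g ⬝ᵥ f a = 1) → (∀ a ∈ T', g ⬝ᵥ f a = 1) → T = T' := by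
  classical
  obtain ⟨F, hFX, hF, hK⟩ := exists_isDegenerate_subset X hX
  obtain ⟨f, -, hf⟩ := exists_isGenericExtension (G := G) ∅ (fun _ => 0) (by simp) (by simp) F
    (by simp) (by simp) (fun a ha => (Finset.card_le_card
      (Finset.filter_subset_filter _ hFX)).trans (hX a (hFX ha))) hF
  have hfinj : Set.InjOn f F := by simpa using hf.injOn (by simp)
  have hfnorm : ∀ a ∈ F, f a ⬝ᵥ f a = 1 / 2 := fun a ha => hf.norm a (by simpa using ha)
  have hperp : ∀ a ∈ F, ∀ b ∈ F, f a ⬝ᵥ f b = 0 → G.Adj a b := by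
    intro a ha b hb h
    refine hf.perp a ha b (by simpa using hb) ?_ h
    rintro rfl
    rw [hfnorm a ha] at h
    norm_num at h
  choose! E hEnorm hEorth hEmem hEframe using
    fun (N : Finset V) (hN : N ⊆ F ∧ N.card = 2) => hf.exists_pole hN.1 hN.2
  let N : V → Finset V := fun c => X.filter (G.Adj c)
  have hmemN : ∀ {c a}, a ∈ N c ↔ a ∈ X ∧ G.Adj c a := fun {c a} => Finset.mem_filter
  have hNF : ∀ c ∈ X, c ∉ F → N c ⊆ F ∧ (N c).card = 2 := hK
  obtain ⟨r, hr⟩ := exists_injective_nat V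
  let P : V → Prop := fun c => (∃ z ∈ F, f z = E (N c)) ∨
    ∃ b ∈ X, b ∉ F ∧ N b = N c ∧ r b < r c
  let σ : V → ℝ := fun c => if P c then -1 else 1
  have hσ2 : ∀ c, σ c * σ c = 1 := fun c => by simp only [σ]; split_ifs <;> norm_num
  have hσ0 : ∀ c, σ c ≠ 0 := fun c h => by simpa [h] using hσ2 c
  have hpole : ∀ c ∈ X, c ∉ F → ∀ z ∈ F, f z = E (N c) ∨ f z = -E (N c) →
      ∀ a ∈ N c, G.Adj z a := by
    intro c hc hcF z hz h a ha
    refine hperp z hz a ((hNF c hc hcF).1 ha) ?_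
    have := hEorth (N c) (hNF c hc hcF) a ha
    rw [dotProduct_comm] at this
    rcases h with h | h <;> rw [h] <;> simp [this]
  have hnon : ∀ c ∈ X, c ∉ F → ∃ a, a ∈ N c ∧ a ∈ X ∧ G.Adj c a := by
    intro c hc hcF
    obtain ⟨a, ha⟩ := Finset.card_pos.1 (show 0 < (N c).card by rw [(hNF c hc hcF).2]; norm_num)
    exact ⟨a, ha, hmemN.1 ha⟩
  /- A vertex outside `F` with negative sign has a twin, and no vertex has two twins. -/
  have htwin : ∀ c ∈ X, c ∉ F → P c → ∃ b ∈ X, (∀ a ∈ N c, G.Adj b a) ∧ b ≠ c ∧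
      (b ∈ F ∧ f b = E (N c) ∨ b ∉ F ∧ r b < r c) := by
    rintro c hc hcF (⟨z, hz, hfz⟩ | ⟨b, hb, hbF, hbN, hlt⟩)
    · exact ⟨z, hFX hz, hpole c hc hcF z hz (.inl hfz), by rintro rfl; exact hcF hz, .inl ⟨hz, hfz⟩⟩
    · refine ⟨b, hb, fun a ha => ?_, by rintro rfl; omega, .inr ⟨hbF, hlt⟩⟩
      rw [← hbN] at ha
      exact (hmemN.1 ha).2
  let f' : V → Fin 3 → ℝ := fun a => if a ∈ F then f a else σ a • E (N a)
  have hf'F : ∀ a ∈ F, f' a = f a := fun a ha => if_pos ha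
  have hf'K : ∀ a, a ∉ F → f' a = σ a • E (N a) := fun a ha => if_neg ha
  have hnorm' : ∀ a ∈ X, f' a ⬝ᵥ f' a = 1 / 2 := by
    intro a ha
    by_cases haF : a ∈ F
    · rw [hf'F a haF, hfnorm a haF]
    · rw [hf'K a haF, smul_dotProduct, dotProduct_smul, smul_eq_mul, smul_eq_mul, ← mul_assoc,
        hσ2, hEnorm _ (hNF a ha haF), one_mul]
  have horthK : ∀ a ∈ X, a ∉ F → ∀ b ∈ X, G.Adj a b → f' b ⬝ᵥ f' a = 0 := by
    intro a ha haF b hb hab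
    have hbN : b ∈ N a := hmemN.2 ⟨hb, hab⟩
    rw [hf'K a haF, hf'F b ((hNF a ha haF).1 hbN), dotProduct_smul,
      hEorth _ (hNF a ha haF) b hbN, smul_zero]
  have horth' : ∀ a ∈ X, ∀ b ∈ X, G.Adj a b → f' a ⬝ᵥ f' b = 0 := by
    intro a ha b hb hab
    by_cases haF : a ∈ F
    · by_cases hbF : b ∈ F
      · rw [hf'F a haF, hf'F b hbF, hf.orth a haF b hbF hab]
      · exact horthK b hb hbF a ha hab.symm
    · rw [dotProduct_comm]
      exact horthK a ha haF b hb hab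
  have hKF : ∀ c ∈ X, c ∉ F → ∀ z ∈ F, f' c ≠ f' z := by
    intro c hc hcF z hz h
    rw [hf'K c hcF, hf'F z hz] at h
    by_cases hP : P c
    · simp only [σ, if_pos hP, neg_smul, one_smul] at h
      obtain ⟨b, hb, hbN, hbc, hb'⟩ := htwin c hc hcF hP
      obtain ⟨a, haN, haX, hca⟩ := hnon c hc hcF
      refine false_of_three_adj hX haX hc hb (hFX hz) hca (hbN a haN)
        (hpole c hc hcF z hz (.inr h.symm) a haN) hbc.symm (by rintro rfl; exact hcF hz) ?_
      rintro rfl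
      rcases hb' with ⟨-, hb'⟩ | ⟨hbF, -⟩
      · have h1 := hEnorm _ (hNF c hc hcF)
        rw [hb'] at h
        have h2 : E (N c) = 0 := by
          ext i
          have := congrFun h i
          simp only [Pi.neg_apply, Pi.zero_apply] at this ⊢
          linarith
        rw [h2, zero_dotProduct] at h1
        norm_num at h1
      · exact hbF hz
    · simp only [σ, if_neg hP, one_smul] at h
      exact hP (.inl ⟨z, hz, h.symm⟩)
  have hKK : ∀ c ∈ X, c ∉ F → ∀ e ∈ X, e ∉ F → r e < r c → f' c ≠ f' e := by
    intro c hc hcF e he heF hlt h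
    have hec : e ≠ c := by rintro rfl; omega
    by_cases hN : N e = N c
    · have hPc : P c := .inr ⟨e, he, heF, hN, hlt⟩
      have hPe : P e := by
        by_contra hPe
        rw [hf'K c hcF, hf'K e heF, hN] at h
        simp only [σ, if_pos hPc, if_neg hPe, neg_smul, one_smul] at h
        have h1 := hEnorm _ (hNF c hc hcF)
        have h2 : E (N c) = 0 := by
          ext i
          have := congrFun h i
          simp only [Pi.neg_apply, Pi.zero_apply] at this ⊢
          linarith
        rw [h2, zero_dotProduct] at h1
        norm_num at h1
      obtain ⟨b, hb, hbN, hbe, hb'⟩ := htwin e he heF hPe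
      obtain ⟨a, haN, haX, hea⟩ := hnon e he heF
      refine false_of_three_adj hX haX hc he hb (hmemN.1 (hN ▸ haN)).2 hea (hbN a haN) hec.symm
        ?_ hbe.symm
      rintro rfl
      rcases hb' with ⟨hcF', -⟩ | ⟨-, hlt'⟩
      · exact hcF hcF'
      · omega
    · obtain ⟨a, hae, hac⟩ := Finset.not_subset.1 fun hsub => hN
        (Finset.eq_of_subset_of_card_le hsub (by rw [(hNF c hc hcF).2, (hNF e he heF).2]))
      have haF := (hNF e he heF).1 hae
      apply hac
      refine hEmem _ (hNF c hc hcF) a haF ?_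
      have h1 : f a ⬝ᵥ f' c = 0 := by
        rw [h, hf'K e heF, dotProduct_smul, hEorth _ (hNF e he heF) a hae, smul_zero]
      rw [hf'K c hcF, dotProduct_smul, smul_eq_mul] at h1
      exact (mul_eq_zero.1 h1).resolve_left (hσ0 c)
  have hinj' : Set.InjOn f' X := by
    intro a ha b hb hab
    by_cases haF : a ∈ F <;> by_cases hbF : b ∈ F
    · rw [hf'F a haF, hf'F b hbF] at hab
      exact hfinj haF hbF hab
    · exact absurd hab.symm (hKF b hb hbF a haF)
    · exact absurd hab (hKF a ha haF b hbF)
    · rcases lt_trichotomy (r a) (r b) with h | h | h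
      · exact absurd hab.symm (hKK b hb hbF a ha haF h)
      · exact hr h
      · exact absurd hab (hKK a ha haF b hb hbF h)
  /- The plane through a triangle in terms of its two vertices in `F`. -/
  have htriangle : ∀ T ⊆ X, T.card = 3 → G.IsClique T → ∀ g, (∀ a ∈ T, g ⬝ᵥ f' a = 1) →
      ∃ p ∈ F, ∃ q ∈ F, ∃ ε : ℝ, p ∈ T ∧ q ∈ T ∧ G.Adj p q ∧ ε ^ 2 = 2 ∧
        g = (2 : ℝ) • (f p + f q + ε • (f p ⨯₃ f q)) := by
    intro T hT hcard hclique g hg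
    obtain ⟨c, hcT, hcF⟩ : ∃ c ∈ T, c ∉ F := by
      by_contra! h
      obtain ⟨c, hc, hc1⟩ := hF T h (Finset.card_pos.1 (by omega))
      have : T.erase c ⊆ T.filter (G.Adj c) := fun a ha => by
        rw [Finset.mem_filter]
        exact ⟨Finset.mem_of_mem_erase ha, hclique hc (Finset.mem_of_mem_erase ha)
          (Finset.ne_of_mem_erase ha).symm⟩
      have := Finset.card_le_card this
      rw [Finset.card_erase_of_mem hc] at this
      omega
    have hcX := hT hcT
    obtain ⟨p, q, hpq, hpqT⟩ := Finset.card_eq_two.1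
      (show (T.erase c).card = 2 by rw [Finset.card_erase_of_mem hcT]; omega)
    have hmem : ∀ a ∈ T.erase c, a ∈ T ∧ a ∈ N c := fun a ha =>
      have haT := Finset.mem_of_mem_erase ha
      ⟨haT, hmemN.2 ⟨hT haT, hclique hcT haT (Finset.ne_of_mem_erase ha).symm⟩⟩
    obtain ⟨hpT, hpN⟩ := hmem p (by simp [hpqT])
    obtain ⟨hqT, hqN⟩ := hmem q (by simp [hpqT])
    have hpF := (hNF c hcX hcF).1 hpN
    have hqF := (hNF c hcX hcF).1 hqN
    have hadj : G.Adj p q := hclique hpT hqT hpq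
    have hpq0 := hf.orth p hpF q hqF hadj
    obtain ⟨ε, hε, hE⟩ := hEframe _ (hNF c hcX hcF) p hpN q hqN hpq hpq0
    refine ⟨p, hpF, q, hqF, σ c * ε, hpT, hqT, hadj, ?_, ?_⟩
    · rw [mul_pow, sq (σ c), hσ2, hε, one_mul]
    · refine eq_of_dual_frame (c := f' c) (hfnorm p hpF) (hfnorm q hqF) hpq0 ?_ ?_
        (by rw [← hf'F p hpF]; exact hg p hpT) (by rw [← hf'F q hqF]; exact hg q hqT) (hg c hcT)
      · rw [mul_pow, sq (σ c), hσ2, hε, one_mul]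
      · rw [hf'K c hcF, hE, smul_smul]
  refine ⟨f', hnorm', horth', hinj', fun T hT T' hT' h3 h3' hcl hcl' g hg hg' => ?_⟩
  by_contra hne
  have hdisj : ∀ a ∈ T, a ∉ T' := by
    intro a ha ha'
    have key : ∀ T ⊆ X, T.card = 3 → G.IsClique (T : Set V) → a ∈ T →
        T.erase a = X.filter (G.Adj a) := by
      intro T hT h3 hcl ha
      refine Finset.eq_of_subset_of_card_le (fun b hb => ?_) ?_
      · rw [Finset.mem_filter]
        exact ⟨hT (Finset.mem_of_mem_erase hb), hcl ha (Finset.mem_of_mem_erase hb)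
          (Finset.ne_of_mem_erase hb).symm⟩
      · rw [Finset.card_erase_of_mem ha, h3]
        exact hX a (hT ha)
    apply hne
    rw [← Finset.insert_erase ha, ← Finset.insert_erase ha', key T hT h3 hcl ha,
      key T' hT' h3' hcl' ha']
  have hne' : ∀ {a b}, a ∈ T → b ∈ T' → a ≠ b := by
    rintro a b ha hb rfl
    exact hdisj a ha hb
  obtain ⟨p, hpF, q, hqF, ε, hp, hq, hpq, hε, h1⟩ := htriangle T hT h3 hcl g hg
  obtain ⟨u, huF, w, hwF, δ, hu, hw, huw, hδ, h2⟩ := htriangle T' hT' h3' hcl' g hg'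
  refine hf.frames p hpF q hqF u huF w hwF (hne' hp hu) (hne' hp hw) (hne' hq hu) (hne' hq hw)
    hpq huw ε δ hε hδ ?_
  exact smul_right_injective _ (two_ne_zero (α := ℝ)) (h1.symm.trans h2)

end Triangles

section SphericalRepThree

open Matrix Real

variable {V : Type*} [DecidableEq V] {G : SimpleGraph V} [DecidableRel G.Adj]

/-- The `2`-core of `A`. -/
lemma exists_core (A : Finset V) : ∃ X ⊆ A, (∀ a ∈ X, 2 ≤ (X.filter (G.Adj a)).card) ∧
    IsDegenerate G (A \ X) := by
  obtain ⟨X, hX, hmax⟩ := Finset.exists_max_image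
    (A.powerset.filter fun X => ∀ a ∈ X, 2 ≤ (X.filter (G.Adj a)).card) Finset.card ⟨∅, by simp⟩
  rw [Finset.mem_filter, Finset.mem_powerset] at hX
  refine ⟨X, hX.1, hX.2, fun T hT hne => ?_⟩
  by_contra! h
  have hsub : T ⊆ A := hT.trans Finset.sdiff_subset
  have := hmax (X ∪ T) (by
    rw [Finset.mem_filter, Finset.mem_powerset]
    refine ⟨Finset.union_subset hX.1 hsub, fun a ha => ?_⟩
    rcases Finset.mem_union.1 ha with ha | ha
    · exact (hX.2 a ha).trans (Finset.card_le_card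
        (Finset.filter_subset_filter _ Finset.subset_union_left))
    · exact (Nat.succ_le_of_lt (h a ha)).trans (Finset.card_le_card
        (Finset.filter_subset_filter _ Finset.subset_union_right)))
  rw [Finset.card_union_of_disjoint
    (Finset.disjoint_left.2 fun a ha haT => (Finset.mem_sdiff.1 (hT haT)).2 ha)] at this
  have := Finset.card_pos.2 hne
  omega

lemma exists_dual_of_det_ne_zero {a b c : Fin 3 → ℝ} (h : c ⬝ᵥ (a ⨯₃ b) ≠ 0) :
    ∃ g : Fin 3 → ℝ, g ⬝ᵥ a = 1 ∧ g ⬝ᵥ b = 1 ∧ g ⬝ᵥ c = 1 := by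
  have hab : a ⬝ᵥ (b ⨯₃ c) = c ⬝ᵥ (a ⨯₃ b) := by rw [triple_product_permutation c]
  have hbc : b ⬝ᵥ (c ⨯₃ a) = c ⬝ᵥ (a ⨯₃ b) := by rw [← triple_product_permutation a, hab]
  refine ⟨(c ⬝ᵥ (a ⨯₃ b))⁻¹ • (b ⨯₃ c + c ⨯₃ a + a ⨯₃ b), ?_, ?_, ?_⟩ <;>
    rw [smul_dotProduct, dotProduct_comm (_ + _), dotProduct_add, dotProduct_add, smul_eq_mul]
  · rw [dot_self_cross, dot_cross_self, hab, add_zero, add_zero, inv_mul_cancel₀ h]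
  · rw [dot_self_cross, dot_cross_self, hbc, zero_add, add_zero, inv_mul_cancel₀ h]
  · rw [dot_self_cross, dot_cross_self, zero_add, zero_add, inv_mul_cancel₀ h]

lemma exists_sphericalRep_three [Fintype V] (A : Finset V) (𝒩 : Set (Finset V))
    (hdeg : ∀ a ∈ A, (A.filter (G.Adj a)).card ≤ 2)
    (hsub : ∀ N ∈ 𝒩, N ⊆ A) (hcard : ∀ N ∈ 𝒩, N.card = 3)
    (hadj : ∀ N ∈ 𝒩, ∀ a ∈ N, ∀ b ∈ N, a ≠ b → (A.filter (G.Adj a)).card = 2 →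
      (A.filter (G.Adj b)).card = 2 → G.Adj a b) :
    ∃ f : V → Fin 3 → ℝ, IsSphericalRep G (A : Set V) 𝒩 f := by
  obtain ⟨X, hXA, hX2, hY⟩ := exists_core (G := G) A
  have hXfilter : ∀ a ∈ X, X.filter (G.Adj a) = A.filter (G.Adj a) := fun a ha =>
    Finset.eq_of_subset_of_card_le (Finset.filter_subset_filter _ hXA)
      ((hdeg a (hXA ha)).trans (hX2 a ha))
  have hX : ∀ a ∈ X, (A.filter (G.Adj a)).card = 2 := fun a ha =>
    le_antisymm (hdeg a (hXA ha)) (hXfilter a ha ▸ hX2 a ha)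
  obtain ⟨f₀, hnorm₀, horth₀, hinj₀, htri₀⟩ := exists_sphere_placement (G := G) X fun a ha => by
    rw [hXfilter a ha]; exact hdeg a (hXA ha)
  have hno : ∀ a ∈ X, ∀ b ∈ A \ X, ¬ G.Adj b a := by
    intro a ha b hb hba
    rw [Finset.mem_sdiff] at hb
    have : b ∈ X.filter (G.Adj a) := by
      rw [hXfilter a ha, Finset.mem_filter]
      exact ⟨hb.1, hba.symm⟩
    exact hb.2 (Finset.mem_filter.1 this).1
  obtain ⟨f, hfX, hf⟩ := exists_isGenericExtension X f₀ hnorm₀ hinj₀ (A \ X)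
    Finset.disjoint_sdiff hno (fun a ha => (Finset.card_le_card
      (Finset.filter_subset_filter _ Finset.sdiff_subset)).trans
        (hdeg a (Finset.mem_sdiff.1 ha).1)) hY
  have hXY : X ∪ A \ X = A := Finset.union_sdiff_of_subset hXA
  have hinj := hf.injOn fun a ha b hb hab => by
    rw [hfX a ha, hfX b hb] at hab
    exact hinj₀ ha hb hab
  have hclique : ∀ N ∈ 𝒩, N ⊆ X → G.IsClique (N : Set V) := fun N hN hNX a ha b hb hab =>
    hadj N hN a ha b hb hab (hX a (hNX ha)) (hX b (hNX hb))
  have horth : ∀ a ∈ A, ∀ b ∈ A, G.Adj a b → f a ⬝ᵥ f b = 0 := by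
    intro a ha b hb hab
    by_cases haX : a ∈ X <;> by_cases hbX : b ∈ X
    · rw [hfX a haX, hfX b hbX, horth₀ a haX b hbX hab]
    · exact absurd hab.symm (hno a haX b (Finset.mem_sdiff.2 ⟨hb, hbX⟩))
    · exact absurd hab (hno b hbX a (Finset.mem_sdiff.2 ⟨ha, haX⟩))
    · exact hf.orth a (Finset.mem_sdiff.2 ⟨ha, haX⟩) b (Finset.mem_sdiff.2 ⟨hb, hbX⟩) hab
  have hnorm : ∀ a ∈ A, f a ⬝ᵥ f a = 1 / 2 := fun a ha => hf.norm a (by rwa [hXY])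
  rw [hXY] at hinj
  refine ⟨f, hnorm, horth, hinj, fun N hN => ?_, fun N hN M hM g hgN hgM => ?_⟩
  · by_cases hNX : N ⊆ X
    · refine ⟨(2 : ℝ) • ∑ b ∈ N, f b, fun a ha => ?_⟩
      rw [smul_dotProduct, sum_dotProduct, Finset.sum_eq_single_of_mem a ha, hnorm a (hsub N hN ha)]
      · norm_num
      · intro b hb hba
        exact horth b (hsub N hN hb) a (hsub N hN ha) (hclique N hN hNX hb ha hba)
    · obtain ⟨c, hcN, hcX⟩ := Finset.not_subset.1 hNX
      have hcY : c ∈ A \ X := Finset.mem_sdiff.2 ⟨hsub N hN hcN, hcX⟩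
      obtain ⟨a, b, hab, habN⟩ := Finset.card_eq_two.1
        (show (N.erase c).card = 2 by rw [Finset.card_erase_of_mem hcN, hcard N hN])
      have hmem : ∀ e, e ∈ N ↔ e = c ∨ e = a ∨ e = b := by
        intro e
        rw [← Finset.insert_erase hcN, habN]
        simp
      have hac : a ≠ c := Finset.ne_of_mem_erase (s := N) (by simp [habN])
      have hbc : b ≠ c := Finset.ne_of_mem_erase (s := N) (by simp [habN])
      have ha : a ∈ A := hsub N hN ((hmem a).2 (by simp))
      have hb : b ∈ A := hsub N hN ((hmem b).2 (by simp))
      have hcr : f a ⨯₃ f b ≠ 0 := by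
        by_cases haX : a ∈ X
        · by_cases hbX : b ∈ X
          · intro h
            have h0 := horth a ha b hb (hadj N hN a ((hmem a).2 (by simp)) b
              ((hmem b).2 (by simp)) hab (hX a haX) (hX b hbX))
            have h1 : (f a ⨯₃ f b) ⬝ᵥ (f a ⨯₃ f b) = 1 / 4 := by
              rw [cross_dot_cross, h0, hnorm a ha, hnorm b hb]
              norm_num
            rw [h, zero_dotProduct] at h1
            norm_num at h1
          · rw [← cross_anticomm, neg_ne_zero]
            exact hf.cross b (Finset.mem_sdiff.2 ⟨hb, hbX⟩) a (by rwa [hXY]) hab.symm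
        · exact hf.cross a (Finset.mem_sdiff.2 ⟨ha, haX⟩) b (by rwa [hXY]) hab
      obtain ⟨g, hga, hgb, hgc⟩ := exists_dual_of_det_ne_zero
        (hf.det c hcY a (by rwa [hXY]) b (by rwa [hXY]) hac hbc hcr)
      refine ⟨g, fun e he => ?_⟩
      rcases (hmem e).1 he with rfl | rfl | rfl
      exacts [hgc, hga, hgb]
  · by_contra hne
    by_cases hUX : N ∪ M ⊆ X
    · have hNX := Finset.union_subset_left hUX
      have hMX := Finset.union_subset_right hUX
      exact hne (htri₀ N hNX M hMX (hcard N hN) (hcard M hM) (hclique N hN hNX)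
        (hclique M hM hMX) g (fun a ha => by rw [← hfX a (hNX ha), hgN a ha])
        (fun a ha => by rw [← hfX a (hMX ha), hgM a ha]))
    · obtain ⟨c, hcU, hcX⟩ := Finset.not_subset.1 hUX
      have hUA : N ∪ M ⊆ A := Finset.union_subset (hsub N hN) (hsub M hM)
      refine hf.not_coplanar (N ∪ M) (by rwa [hXY]) ?_ ?_ g fun a ha => ?_
      · by_contra! hlt
        have hN3 : N = N ∪ M := Finset.eq_of_subset_of_card_le Finset.subset_union_left
          (by rw [hcard N hN]; omega)
        have hM3 : M = N ∪ M := Finset.eq_of_subset_of_card_le Finset.subset_union_right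
          (by rw [hcard M hM]; omega)
        exact hne (hN3.trans hM3.symm)
      · exact Finset.not_disjoint_iff.2 ⟨c, hcU, Finset.mem_sdiff.2 ⟨hUA hcU, hcX⟩⟩
      · rcases Finset.mem_union.1 ha with ha | ha
        exacts [hgN a ha, hgM a ha]

end SphericalRepThree

section Assembly

open Matrix Real

variable {V : Type*} {G : SimpleGraph V}

lemma graphRealizable_of_coordinates {D : Type*} [Fintype D] {d : ℕ} (hD : Fintype.card D = d)
    (F : V → D → ℝ) (hinj : Function.Injective F)
    (hF : ∀ u v, G.Adj u v → (F u - F v) ⬝ᵥ (F u - F v) = 1) : GraphRealizable G d := by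
  let e : D ≃ Fin d := Fintype.equivFinOfCardEq hD
  refine ⟨fun v => WithLp.toLp 2 fun i => F v (e.symm i), fun u v huv => hinj ?_, fun u v huv => ?_⟩
  · ext s
    simpa using congrFun (congrArg WithLp.ofLp huv) (e s)
  · rw [EuclideanSpace.dist_eq, sqrt_eq_one, ← hF u v huv, dotProduct,
      ← Equiv.sum_comp e.symm]
    refine Finset.sum_congr rfl fun i _ => ?_
    rw [Real.dist_eq, sq_abs, sq, Pi.sub_apply]

lemma graphRealizable_one_of_matching [Countable V] (hG : ∀ a b c, G.Adj a b → G.Adj a c → b = c) :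
    GraphRealizable G 1 := by
  classical
  obtain ⟨r, hr⟩ := exists_injective_nat V
  let x : V → ℤ := fun v => if h : ∃ w, G.Adj v w ∧ r w < r v then 3 * r h.choose + 1 else 3 * r v
  have hx1 : ∀ v w, G.Adj v w → r w < r v → x v = 3 * r w + 1 := by
    intro v w hvw hlt
    have h : ∃ w, G.Adj v w ∧ r w < r v := ⟨w, hvw, hlt⟩
    simp only [x, dif_pos h]
    rw [hG v _ w h.choose_spec.1 hvw]
  have hx0 : ∀ v, (¬ ∃ w, G.Adj v w ∧ r w < r v) → x v = 3 * r v := fun v h => dif_neg h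
  have hx : ∀ v w, G.Adj v w → r w < r v → x v = x w + 1 := by
    intro v w hvw hlt
    rw [hx1 v w hvw hlt, hx0 w]
    rintro ⟨u, hwu, hlt'⟩
    rw [hG w u v hwu hvw.symm] at hlt'
    omega
  have hxinj : Function.Injective x := by
    intro u v huv
    by_cases hu : ∃ w, G.Adj u w ∧ r w < r u <;> by_cases hv : ∃ w, G.Adj v w ∧ r w < r v
    · obtain ⟨a, hua, hla⟩ := hu
      obtain ⟨b, hvb, hlb⟩ := hv
      rw [hx1 u a hua hla, hx1 v b hvb hlb] at huv
      obtain rfl : a = b := hr (by omega)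
      exact hG a u v hua.symm hvb.symm
    · obtain ⟨a, hua, hla⟩ := hu
      rw [hx1 u a hua hla, hx0 v hv] at huv
      omega
    · obtain ⟨b, hvb, hlb⟩ := hv
      rw [hx0 u hu, hx1 v b hvb hlb] at huv
      omega
    · rw [hx0 u hu, hx0 v hv] at huv
      exact hr (by omega)
  refine graphRealizable_of_coordinates (D := Unit) (by simp) (fun v _ => (x v : ℝ))
    (fun u v huv => hxinj (Int.cast_injective (congrFun huv ()))) fun u v huv => ?_
  simp only [dotProduct, Finset.univ_unique, Finset.sum_singleton, Pi.sub_apply]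
  rcases lt_trichotomy (r u) (r v) with h | h | h
  · rw [hx v u huv.symm h]; push_cast; ring
  · exact absurd (hr h) huv.ne
  · rw [hx u v huv h]; push_cast; ring

variable {ι : Type*} [Fintype V] [DecidableEq ι] [Fintype ι] [DecidableRel G.Adj]

/-- Spherical representations of the classes of a partition, placed in orthogonal subspaces,
extend to the independent class `none`. -/
lemma exists_coordinates_of_sphericalRep {p : V → Option ι} {n : ι → ℕ}
    {f : ∀ j, V → Fin (n j) → ℝ}
    (hf : ∀ j, IsSphericalRep G {v | p v = some j}
      {N | ∃ v, p v = none ∧ nbrsIn G p (some j) v = N} (f j))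
    (hindep : ∀ u v, p u = none → p v = none → ¬ G.Adj u v)
    (hne : ∀ v, p v = none → ∃ j, (nbrsIn G p (some j) v).Nonempty)
    (htwin : ∀ u v w, p u = none → p v = none → p w = none → u ≠ v → u ≠ w → v ≠ w →
      (∀ j, nbrsIn G p (some j) v = nbrsIn G p (some j) u) →
      ¬ ∀ j, nbrsIn G p (some j) w = nbrsIn G p (some j) u) :
    ∃ F : V → (Σ j, Fin (n j)) → ℝ, Function.Injective F ∧
      ∀ u v, G.Adj u v → (F u - F v) ⬝ᵥ (F u - F v) = 1 := by
  classical
  obtain ⟨rk, hrk⟩ := exists_injective_nat V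
  have hdual : ∀ v, p v = none → ∀ j, ∃ g, ∀ a ∈ nbrsIn G p (some j) v, g ⬝ᵥ f j a = 1 :=
    fun v hv j => (hf j).exists_dual _ ⟨v, hv, rfl⟩
  choose! g hg using hdual
  let Q : V → ℝ := fun v => ∑ j, g v j ⬝ᵥ g v j
  have hQ : ∀ v, p v = none → 0 < Q v := by
    intro v hv
    obtain ⟨j, a, ha⟩ := hne v hv
    have hnonneg : ∀ i, 0 ≤ g v i ⬝ᵥ g v i := fun i =>
      Finset.sum_nonneg fun t _ => mul_self_nonneg _
    refine Finset.sum_pos' (fun i _ => hnonneg i) ⟨j, Finset.mem_univ j, ?_⟩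
    refine lt_of_le_of_ne (hnonneg j) fun h0 => ?_
    have := hg v hv j a ha
    rw [dotProduct_self_eq_zero.1 h0.symm, zero_dotProduct] at this
    norm_num at this
  let P : V → Prop := fun v => ∃ w, p w = none ∧ rk w < rk v ∧
    ∀ j, nbrsIn G p (some j) w = nbrsIn G p (some j) v
  let σ : V → ℝ := fun v => if P v then -1 else 1
  have hσ : ∀ v, σ v ^ 2 = 1 := fun v => by simp only [σ]; split_ifs <;> norm_num
  let r : V → ℝ := fun v => (1 + σ v * √(1 + Q v / 2)) / Q v
  have hr : ∀ v, p v = none → r v ^ 2 * Q v = 2 * r v + 1 / 2 := by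
    intro v hv
    have h0 := hQ v hv
    have hs : √(1 + Q v / 2) ^ 2 = 1 + Q v / 2 := sq_sqrt (by positivity)
    simp only [r]
    generalize √(1 + Q v / 2) = S at hs ⊢
    field_simp
    linear_combination 2 * S ^ 2 * hσ v + 2 * hs
  let F : V → (Σ j, Fin (n j)) → ℝ := fun v s =>
    if p v = none then r v * g v s.1 s.2 else if p v = some s.1 then f s.1 v s.2 else 0
  have hFnone : ∀ v, p v = none → ∀ j t, F v ⟨j, t⟩ = r v * g v j t := fun v hv j t => by
    simp [F, hv]
  have hFsome : ∀ v j, p v = some j → ∀ t, F v ⟨j, t⟩ = f j v t := fun v j hv t => by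
    simp [F, hv]
  have hFother : ∀ v i j, p v = some i → i ≠ j → ∀ t, F v ⟨j, t⟩ = 0 := fun v i j hv hij t => by
    simp [F, hv, hij]
  have hdotF : ∀ v i, p v = some i → ∀ x : (Σ j, Fin (n j)) → ℝ,
      F v ⬝ᵥ x = f i v ⬝ᵥ fun t => x ⟨i, t⟩ := by
    intro v i hv x
    rw [dotProduct, Fintype.sum_sigma, Finset.sum_eq_single i]
    · simp only [hFsome v i hv, dotProduct]
    · intro j _ hj
      simp [hFother v i j hv hj.symm]
    · simp
  have hsome : ∀ u v i, p u = some i → p v = some i → F u ⬝ᵥ F v = f i u ⬝ᵥ f i v := by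
    intro u v i hu hv
    rw [hdotF u i hu]
    simp only [hFsome v i hv]
  have hother : ∀ u v i j, p u = some i → p v = some j → i ≠ j → F u ⬝ᵥ F v = 0 := by
    intro u v i j hu hv hij
    rw [hdotF u i hu]
    simp only [hFother v j i hv hij.symm]
    exact dotProduct_zero _
  have hnorm : ∀ v i, p v = some i → F v ⬝ᵥ F v = 1 / 2 := fun v i hv => by
    rw [hsome v v i hv hv, (hf i).norm v hv]
  have hnormI : ∀ v, p v = none → F v ⬝ᵥ F v = 2 * r v + 1 / 2 := by
    intro v hv
    rw [← hr v hv, dotProduct, Fintype.sum_sigma, Finset.mul_sum]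
    refine Finset.sum_congr rfl fun j _ => ?_
    rw [dotProduct, Finset.mul_sum]
    refine Finset.sum_congr rfl fun t _ => ?_
    rw [hFnone v hv]
    ring
  have hcross : ∀ u v i, p u = some i → p v = none → G.Adj v u → F u ⬝ᵥ F v = r v := by
    intro u v i hu hv huv
    rw [hdotF u i hu]
    have : (fun t => F v ⟨i, t⟩) = r v • g v i := by
      ext t
      rw [hFnone v hv, Pi.smul_apply, smul_eq_mul]
    rw [this, dotProduct_smul, dotProduct_comm, hg v hv i u (mem_nbrsIn.2 ⟨huv, hu⟩), smul_eq_mul,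
      mul_one]
  have hexpand : ∀ u v, (F u - F v) ⬝ᵥ (F u - F v) =
      F u ⬝ᵥ F u - 2 * (F u ⬝ᵥ F v) + F v ⬝ᵥ F v := by
    intro u v
    rw [sub_dotProduct, dotProduct_sub, dotProduct_sub, dotProduct_comm (F v) (F u)]
    ring
  have hr0 : ∀ v, p v = none → r v ≠ 0 := by
    intro v hv h0
    have := hr v hv
    rw [h0] at this
    norm_num at this
  have hmixed : ∀ u v i, p u = some i → p v = none → F u ≠ F v := by
    intro u v i hu hv huv
    have h1 := hnormI v hv
    rw [← huv, hnorm u i hu] at h1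
    exact hr0 v hv (by linarith)
  have hI : ∀ u v, p u = none → p v = none → rk v < rk u → F u ≠ F v := by
    intro u v hu hv hlt huv
    have hruv : r u = r v := by
      have h1 := hnormI u hu
      rw [huv, hnormI v hv] at h1
      linarith
    have hguv : g u = g v := by
      ext j t
      have h1 := congrFun huv ⟨j, t⟩
      rw [hFnone u hu, hFnone v hv, hruv] at h1
      exact mul_left_cancel₀ (hr0 v hv) h1
    have hN : ∀ j, nbrsIn G p (some j) v = nbrsIn G p (some j) u := fun j =>
      (hf j).dual_unique _ ⟨v, hv, rfl⟩ _ ⟨u, hu, rfl⟩ (g v j) (hg v hv j)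
        (by rw [← hguv]; exact hg u hu j)
    have hQuv : Q u = Q v := by simp only [Q, hguv]
    have hσuv : σ u = σ v := by
      have h0 := hQ v hv
      have hs : 0 < √(1 + Q v / 2) := by positivity
      simp only [r, hQuv] at hruv
      rw [div_left_inj' h0.ne', add_right_inj] at hruv
      exact mul_right_cancel₀ hs.ne' hruv
    have hPu : P u := ⟨v, hv, hlt, hN⟩
    by_cases hPv : P v
    · obtain ⟨w, hw, hlt', hNw⟩ := hPv
      exact htwin u v w hu hv hw (by rintro rfl; omega) (by rintro rfl; omega)
        (by rintro rfl; omega) hN fun j => (hNw j).trans (hN j)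
    · simp only [σ, if_pos hPu, if_neg hPv] at hσuv
      norm_num at hσuv
  refine ⟨F, fun u v huv => ?_, fun u v huv => ?_⟩
  · rcases hu : p u with _ | i <;> rcases hv : p v with _ | j
    · rcases lt_trichotomy (rk u) (rk v) with h | h | h
      · exact absurd huv.symm (hI v u hv hu h)
      · exact hrk h
      · exact absurd huv (hI u v hu hv h)
    · exact absurd huv.symm (hmixed v u j hv hu)
    · exact absurd huv (hmixed u v i hu hv)
    · by_cases hij : i = j
      · subst hij
        refine (hf i).inj hu hv ?_
        ext t
        rw [← hFsome u i hu, ← hFsome v i hv, huv]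
      · have h1 := hother u v i j hu hv hij
        rw [huv, hnorm v j hv] at h1
        norm_num at h1
  · rw [hexpand]
    rcases hu : p u with _ | i <;> rcases hv : p v with _ | j
    · exact absurd huv (hindep u v hu hv)
    · rw [dotProduct_comm (F u) (F v), hcross v u j hv hu huv, hnormI u hu, hnorm v j hv]
      ring
    · rw [hcross u v i hu hv huv.symm, hnormI v hv, hnorm u i hu]
      ring
    · rw [hnorm u i hu, hnorm v j hv]
      by_cases hij : i = j
      · subst hij
        rw [hsome u v i hu hv, (hf i).orth u hu v hv huv]
        norm_num
      · rw [hother u v i j hu hv hij]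
        norm_num

end Assembly

section Main

variable {V : Type*} {G : SimpleGraph V}

lemma exists_class_sizes {d : ℕ} (hd : 2 ≤ d) : ∃ (m : ℕ) (k : Fin m → ℕ),
    (∀ j, k j = 1 ∨ k j = 2) ∧ ∑ j, (k j + 1) = d ∧ (d = 3 ∨ ∃ j, k j = 1) := by
  rcases Nat.even_or_odd' d with ⟨c, rfl | rfl⟩
  · refine ⟨c, fun _ => 1, by simp, by simp [mul_comm], .inr ⟨⟨0, by omega⟩, rfl⟩⟩
  · obtain ⟨b, rfl⟩ : ∃ b, c = b + 1 := ⟨c - 1, by omega⟩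
    refine ⟨b + 1, Fin.cons 2 fun _ => 1, Fin.cases (by simp) (by simp), ?_, ?_⟩
    · simp only [Fin.sum_univ_succ, Fin.cons_zero, Fin.cons_succ, Finset.sum_const,
        Finset.card_univ, Fintype.card_fin, smul_eq_mul]
      ring
    · rcases Nat.eq_zero_or_pos b with rfl | hb
      · exact .inl rfl
      · exact .inr ⟨Fin.succ ⟨0, hb⟩, rfl⟩

lemma containsSubgraphIso_of_common_neighbors {s t : Fin 3 → V} (hs : Function.Injective s)
    (ht : Function.Injective t) (hst : ∀ i j, G.Adj (s i) (t j)) :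
    ContainsSubgraphIso G (completeBipartiteGraph (Fin 3) (Fin 3)) := by
  refine ⟨Sum.elim s t, hs.sumElim ht fun i j => (hst i j).ne, ?_⟩
  rintro (i | i) (j | j) hij
  · simp at hij
  · exact hst i j
  · exact (hst j i).symm
  · simp at hij

lemma injective_vec_three {a b c : V} (hab : a ≠ b) (hac : a ≠ c) (hbc : b ≠ c) :
    Function.Injective ![a, b, c] := by
  intro i j hij
  fin_cases i <;> fin_cases j <;> simp_all

variable {ι : Type*} [Fintype V] [DecidableEq ι] [DecidableRel G.Adj] {k : ι → ℕ}
  {p : V → Option ι} {d : ℕ}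

lemma filter_class_eq_nbrsIn (j : ι) (a : V) :
    (Finset.univ.filter fun v => p v = some j).filter (G.Adj a) = nbrsIn G p (some j) a := by
  ext w
  simp [mem_nbrsIn, and_comm]

variable [DecidableEq V] [Fintype ι]

namespace IsMinPartition

lemma exists_sphericalRep (hp : IsMinPartition G k p) (hk : ∑ j, (k j + 1) = d)
    (hdeg : ∀ v, G.degree v ≤ d) (j : ι) (hkj : k j = 1 ∨ k j = 2) :
    ∃ f : V → Fin (k j + 1) → ℝ, IsSphericalRep G {v | p v = some j}
      {N | ∃ v, p v = none ∧ nbrsIn G p (some j) v = N} f := by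
  have hcard : ∀ N ∈ {N | ∃ v, p v = none ∧ nbrsIn G p (some j) v = N}, N.card = k j + 1 := by
    rintro N ⟨v, hv, rfl⟩
    exact hp.card_some_eq hk hdeg hv j
  have hsub : ∀ N ∈ {N | ∃ v, p v = none ∧ nbrsIn G p (some j) v = N}, ∀ a ∈ N,
      p a = some j := by
    rintro N ⟨v, hv, rfl⟩ a ha
    exact (mem_nbrsIn.1 ha).2
  rcases hkj with h | h
  · rw [h] at hcard ⊢
    refine exists_sphericalRep_two _ _ (fun a ha b hb c hc hab hac => ?_) hsub hcard
    have h1 := hp.card_some_le hk hdeg ha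
    rw [h] at h1
    exact Finset.card_le_one.1 h1 b (mem_nbrsIn.2 ⟨hab, hb⟩) c (mem_nbrsIn.2 ⟨hac, hc⟩)
  · rw [h] at hcard ⊢
    have hA : {v | p v = some j} = ((Finset.univ.filter fun v => p v = some j : Finset V) :
      Set V) := by simp
    rw [hA]
    refine exists_sphericalRep_three _ _ (fun a ha => ?_) (fun N hN a ha => ?_) hcard ?_
    · rw [filter_class_eq_nbrsIn, ← h]
      exact hp.card_some_le hk hdeg (Finset.mem_filter.1 ha).2
    · simpa using hsub N hN a ha
    · rintro N ⟨v, hv, rfl⟩ a ha b hb hab hca hcb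
      rw [filter_class_eq_nbrsIn, ← h] at hca hcb
      obtain ⟨hva, hpa⟩ := mem_nbrsIn.1 ha
      obtain ⟨hvb, hpb⟩ := mem_nbrsIn.1 hb
      exact hp.adj_of_saturated hk hdeg hpa hpb hca hcb hv hva.symm hvb.symm hab

lemma not_three_twins (hp : IsMinPartition G k p) (hk : ∑ j, (k j + 1) = d)
    (hdeg : ∀ v, G.degree v ≤ d)
    (h : ¬(d = 3 ∧ ContainsSubgraphIso G (completeBipartiteGraph (Fin 3) (Fin 3))))
    (hk1 : d = 3 ∨ ∃ j, k j = 1) {u v w : V} (hu : p u = none) (hv : p v = none)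
    (hw : p w = none) (huv : u ≠ v) (huw : u ≠ w) (hvw : v ≠ w)
    (hNv : ∀ j, nbrsIn G p (some j) v = nbrsIn G p (some j) u)
    (hNw : ∀ j, nbrsIn G p (some j) w = nbrsIn G p (some j) u) : False := by
  rcases hk1 with hd | ⟨j, hj⟩
  · have h0 := hp.card_none_eq_zero hk hdeg hu
    have hcard : G.degree u = 3 := by
      rw [← card_none_add_sum_card_some (p := p), h0, zero_add, ← hd, ← hk]
      exact Finset.sum_congr rfl fun j _ => hp.card_some_eq hk hdeg hu j
    rw [← SimpleGraph.card_neighborFinset_eq_degree] at hcard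
    obtain ⟨a, b, c, hab, hac, hbc, hN⟩ := Finset.card_eq_three.1 hcard
    have hadj : ∀ x, G.Adj u x → G.Adj v x ∧ G.Adj w x := by
      intro x hx
      rcases hpx : p x with _ | j
      · have : x ∈ nbrsIn G p none u := mem_nbrsIn.2 ⟨hx, hpx⟩
        simp [Finset.card_eq_zero.1 h0] at this
      · have : x ∈ nbrsIn G p (some j) u := mem_nbrsIn.2 ⟨hx, hpx⟩
        exact ⟨(mem_nbrsIn.1 (hNv j ▸ this)).1, (mem_nbrsIn.1 (hNw j ▸ this)).1⟩
    have hmem : ∀ x, G.Adj u x ↔ x = a ∨ x = b ∨ x = c := fun x => by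
      rw [← SimpleGraph.mem_neighborFinset, hN]
      simp
    refine h ⟨hd, containsSubgraphIso_of_common_neighbors (injective_vec_three huv huw hvw)
      (injective_vec_three hab hac hbc) fun i j => ?_⟩
    have hj : G.Adj u (![a, b, c] j) := (hmem _).2 (by fin_cases j <;> simp)
    fin_cases i
    exacts [hj, (hadj _ hj).1, (hadj _ hj).2]
  · obtain ⟨a, b, -, hab⟩ := Finset.card_eq_two.1
      (show (nbrsIn G p (some j) u).card = 2 by rw [hp.card_some_eq hk hdeg hu, hj])
    refine hp.false_of_three_twins hk hdeg hj
      (Finset.card_eq_three.2 ⟨u, v, w, huv, huw, hvw, rfl⟩) (a := a) (b := b)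
      (fun x hx => ?_) (fun x hx => ?_)
    all_goals
      simp only [Finset.mem_insert, Finset.mem_singleton] at hx
      rcases hx with rfl | rfl | rfl
    exacts [hu, hv, hw, hab, (hNv j).trans hab, (hNw j).trans hab]

end IsMinPartition

end Main

theorem stmt_0 {V : Type*} [Fintype V] (d : ℕ) (hd : 1 ≤ d)
    (G : SimpleGraph V) [DecidableRel G.Adj] (hdeg : ∀ v : V, G.degree v ≤ d)
    (h : ¬(d = 3 ∧ ContainsSubgraphIso G (completeBipartiteGraph (Fin 3) (Fin 3)))) :
    GraphRealizable G d := by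
  classical
  rcases hd.eq_or_lt with rfl | hd2
  · refine graphRealizable_one_of_matching fun a b c hab hac => ?_
    have h1 := hdeg a
    rw [← SimpleGraph.card_neighborFinset_eq_degree] at h1
    exact Finset.card_le_one.1 h1 b (by simpa using hab) c (by simpa using hac)
  obtain ⟨m, k, hk12, hk, hk1⟩ := exists_class_sizes (show 2 ≤ d from hd2)
  obtain ⟨p, hp⟩ := exists_isMinPartition G k
  choose f hf using fun j => hp.exists_sphericalRep hk hdeg j (hk12 j)
  have hindep : ∀ u v, p u = none → p v = none → ¬G.Adj u v := by
    intro u v hu hv huv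
    have := hp.card_none_eq_zero hk hdeg hu
    rw [Finset.card_eq_zero] at this
    exact Finset.notMem_empty v (this ▸ mem_nbrsIn.2 ⟨huv, hv⟩)
  have hm : 0 < m := by
    rcases Nat.eq_zero_or_pos m with rfl | hm
    · rw [Finset.univ_eq_empty, Finset.sum_empty] at hk
      omega
    · exact hm
  have hne : ∀ v, p v = none → ∃ j, (nbrsIn G p (some j) v).Nonempty := by
    refine fun v hv => ⟨⟨0, hm⟩, Finset.card_pos.1 ?_⟩
    rw [hp.card_some_eq hk hdeg hv]
    omega
  obtain ⟨F, hinj, hF⟩ := exists_coordinates_of_sphericalRep hf hindep hne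
    fun u v w hu hv hw huv huw hvw hNv hNw =>
      hp.not_three_twins hk hdeg h hk1 hu hv hw huv huw hvw hNv hNw
  exact graphRealizable_of_coordinates (by simpa using hk) F hinj hF
end

section
/- Let d > 3 and let G be a finite simple graph with fewer than (d+2 choose 2) edges. Then G is realizable in ℝ^d. -/
namespace UnitDistance

open Finset

variable {V : Type*} (G : SimpleGraph V)

/-- The vertices in `s` can be represented by distinct unit vectors of `ℝ^d` so that adjacent
vertices get orthogonal vectors. -/
def OrthoRep (s : Finset V) (d : ℕ) : Prop :=
  ∃ f : V → EuclideanSpace ℝ (Fin d), Set.InjOn f s ∧ (∀ v ∈ s, ‖f v‖ = 1) ∧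
    ∀ u ∈ s, ∀ v ∈ s, G.Adj u v → inner ℝ (f u) (f v) = 0

variable {G}

lemma OrthoRep.of_finrank {E : Type*} [NormedAddCommGroup E] [InnerProductSpace ℝ E]
    [FiniteDimensional ℝ E] {d : ℕ} (hE : Module.finrank ℝ E = d) {s : Finset V} (f : V → E)
    (hinj : Set.InjOn f s) (hnorm : ∀ v ∈ s, ‖f v‖ = 1)
    (horth : ∀ u ∈ s, ∀ v ∈ s, G.Adj u v → inner ℝ (f u) (f v) = 0) : OrthoRep G s d := by
  subst hE
  let e := (stdOrthonormalBasis ℝ E).repr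
  refine ⟨fun v => e (f v), fun u hu v hv h => hinj hu hv (e.injective h), fun v hv => ?_,
    fun u hu v hv h => ?_⟩
  · simpa using hnorm v hv
  · simpa using horth u hu v hv h

lemma OrthoRep.mono {s t : Finset V} {d : ℕ} (hst : s ⊆ t) (ht : OrthoRep G t d) :
    OrthoRep G s d := by
  obtain ⟨f, f1, f2, f3⟩ := ht
  exact ⟨f, f1.mono (coe_subset.2 hst), fun v hv => f2 v (hst hv),
    fun u hu v hv => f3 u (hst hu) v (hst hv)⟩

section OrthoRep

variable [DecidableEq V]

lemma OrthoRep.of_card_le {s : Finset V} {d : ℕ} (h : #s ≤ d) : OrthoRep G s d := by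
  let i (v : V) (hv : v ∈ s) : Fin d := Fin.castLE h (s.equivFin ⟨v, hv⟩)
  have hi {u v : V} {hu : u ∈ s} {hv : v ∈ s} (huv : i u hu = i v hv) : u = v := by
    simpa [i] using huv
  refine ⟨fun v => if hv : v ∈ s then EuclideanSpace.single (i v hv) 1 else 0, ?_, ?_, ?_⟩
  · intro u hu v hv huv
    rw [mem_coe] at hu hv
    simp only [hu, hv, dif_pos] at huv
    by_contra hne
    have := congrArg (fun x => x (i u hu)) huv
    simp [mt hi hne] at this
  · intro v hv
    simp [hv]
  · intro u hu v hv huv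
    have hne : i u hu ≠ i v hv := mt hi huv.ne
    simp only [hu, hv, dif_pos]
    rw [EuclideanSpace.inner_single_left]
    simp [hne]

lemma OrthoRep.pair {x y : V} (h : ¬ G.Adj x y) : OrthoRep G {x, y} 1 := by
  refine .of_finrank (E := ℝ) (by simp) (fun v => if v = x then 1 else -1) ?_ ?_ ?_
  · intro u hu v hv
    simp only [coe_insert, coe_singleton, Set.mem_insert_iff, Set.mem_singleton_iff] at hu hv
    rcases hu with rfl | rfl <;> rcases hv with rfl | rfl <;> grind
  · intro v _
    split_ifs <;> simp
  · intro u hu v hv huv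
    simp only [mem_insert, mem_singleton] at hu hv
    rcases hu with rfl | rfl <;> rcases hv with rfl | rfl
    · exact absurd huv (G.irrefl)
    · exact absurd huv h
    · exact absurd huv.symm h
    · exact absurd huv (G.irrefl)

lemma OrthoRep.union {s t : Finset V} {m n : ℕ} (hs : OrthoRep G s m) (ht : OrthoRep G t n) :
    OrthoRep G (s ∪ t) (m + n) := by
  obtain ⟨f, f1, f2, f3⟩ := hs
  obtain ⟨g, g1, g2, g3⟩ := ht
  let E := WithLp 2 (EuclideanSpace ℝ (Fin m) × EuclideanSpace ℝ (Fin n))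
  have hE : Module.finrank ℝ E = m + n := by
    rw [(WithLp.linearEquiv 2 ℝ _).finrank_eq]; simp
  have key (v) (hv : v ∈ s ∪ t) (hvs : v ∉ s) : v ∈ t := by
    simpa [hvs] using hv
  refine .of_finrank hE
    (fun v => if v ∈ s then WithLp.toLp 2 (f v, 0) else WithLp.toLp 2 (0, g v)) ?_ ?_ ?_
  · intro u hu v hv huv
    have hu' := key u hu
    have hv' := key v hv
    dsimp only at huv
    split_ifs at huv with h1 h2 h2
    · exact f1 h1 h2 (congrArg WithLp.fst huv)
    · have h3 : f u = 0 := congrArg WithLp.fst huv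
      simpa [h3] using f2 u h1
    · have h3 : 0 = f v := congrArg WithLp.fst huv
      simpa [← h3] using f2 v h2
    · exact g1 (hu' h1) (hv' h2) (congrArg WithLp.snd huv)
  · intro v hv
    split_ifs with h
    · exact (WithLp.prod_norm_eq_of_L2 _).trans (by simp [f2 v h])
    · exact (WithLp.prod_norm_eq_of_L2 _).trans (by simp [g2 v (key v hv h)])
  · intro u hu v hv huv
    have hu' := key u hu
    have hv' := key v hv
    split_ifs with h1 h2 h2
    · exact (WithLp.prod_inner_apply _ _).trans (by simp [f3 u h1 v h2 huv])
    · exact (WithLp.prod_inner_apply _ _).trans (by simp)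
    · exact (WithLp.prod_inner_apply _ _).trans (by simp)
    · exact (WithLp.prod_inner_apply _ _).trans (by simp [g3 u (hu' h1) v (hv' h2) huv])

lemma OrthoRep.of_erase {s : Finset V} {d : ℕ} {v : V} (h : OrthoRep G (s.erase v) d) :
    OrthoRep G s (d + 1) := by
  refine (h.union (.of_card_le (s := {v}) (card_singleton v).le)).mono fun u hu => ?_
  simp only [mem_union, mem_erase, mem_singleton]
  tauto

lemma OrthoRep.of_erase_erase {s : Finset V} {d : ℕ} {u v : V} (huv : ¬ G.Adj u v)
    (h : OrthoRep G ((s.erase u).erase v) d) : OrthoRep G s (d + 1) := by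
  refine (h.union (.pair huv)).mono fun w hw => ?_
  simp only [mem_union, mem_erase, mem_insert, mem_singleton]
  tauto

lemma OrthoRep.union_planar {s t : Finset V} (hst : ∀ u ∈ s, ∀ v ∈ t, ¬ G.Adj u v)
    (hs : OrthoRep G s 2) (ht : OrthoRep G t 2) : OrthoRep G (s ∪ t) 2 := by
  let e : EuclideanSpace ℝ (Fin 2) ≃ₗᵢ[ℝ] ℂ := Complex.orthonormalBasisOneI.repr.symm
  obtain ⟨f, f1, f2, f3⟩ := hs
  obtain ⟨g, g1, g2, g3⟩ := ht
  obtain ⟨z, hz⟩ : ∃ z : Circle, ∀ u ∈ s, ∀ v ∈ t, (z : ℂ) * e (f u) ≠ e (g v) := by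
    have := (Set.Ioc_infinite (neg_lt_self Real.pi_pos)).to_subtype
    have : Infinite Circle := Circle.argEquiv.infinite_iff.2 this
    have hinf : (Set.range fun z : Circle => (z : ℂ)).Infinite :=
      Set.infinite_range_of_injective Circle.coe_injective
    obtain ⟨_, ⟨z, rfl⟩, hz⟩ := hinf.exists_notMem_finset
      ((s ×ˢ t).image fun p => e (g p.2) / e (f p.1))
    refine ⟨z, fun u hu v hv h => hz (mem_image.2 ⟨(u, v), by simp [hu, hv], ?_⟩)⟩
    have : e (f u) ≠ 0 := by
      rw [← norm_ne_zero_iff, e.norm_map, f2 u hu]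
      exact one_ne_zero
    exact (div_eq_iff this).2 h.symm
  let r := rotation z
  have key (v) (hv : v ∈ s ∪ t) (hvs : v ∉ s) : v ∈ t := by
    simpa [hvs] using hv
  refine .of_finrank Complex.finrank_real_complex
    (fun v => if v ∈ s then r (e (f v)) else e (g v)) ?_ ?_ ?_
  · intro u hu v hv huv
    have hu' := key u hu
    have hv' := key v hv
    dsimp only at huv
    split_ifs at huv with h1 h2 h2
    · exact f1 h1 h2 (by simpa using huv)
    · exact absurd huv (hz u h1 v (hv' h2))
    · exact absurd huv.symm (hz v h2 u (hu' h1))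
    · exact g1 (hu' h1) (hv' h2) (by simpa using huv)
  · intro v hv
    beta_reduce
    split_ifs with h
    · rw [r.norm_map, e.norm_map, f2 v h]
    · rw [e.norm_map, g2 v (key v hv h)]
  · intro u hu v hv huv
    have hu' := key u hu
    have hv' := key v hv
    beta_reduce
    split_ifs with h1 h2 h2
    · rw [r.inner_map_map, e.inner_map_map, f3 u h1 v h2 huv]
    · exact absurd huv (hst u h1 v (hv' h2))
    · exact absurd huv.symm (hst v h2 u (hu' h1))
    · rw [e.inner_map_map, g3 u (hu' h1) v (hv' h2) huv]

end OrthoRep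

section DegIn

variable (G) [DecidableRel G.Adj]

/-- The number of neighbors of `v` in `s`. -/
def degIn (s : Finset V) (v : V) : ℕ := #(s.filter (G.Adj v))

/-- Twice the number of edges of `G` inside `s`. -/
def degSum (s : Finset V) : ℕ := ∑ v ∈ s, degIn G s v

variable {G}

lemma degIn_mono {s t : Finset V} (h : s ⊆ t) (v : V) : degIn G s v ≤ degIn G t v :=
  card_le_card (filter_subset_filter _ h)

lemma degSum_mono {s t : Finset V} (h : s ⊆ t) : degSum G s ≤ degSum G t :=
  (sum_le_sum fun v _ => degIn_mono h v).trans (sum_le_sum_of_subset h)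

lemma eq_of_degIn_le_one {s : Finset V} {v a b : V} (h : degIn G s v ≤ 1) (ha : a ∈ s)
    (hb : b ∈ s) (hva : G.Adj v a) (hvb : G.Adj v b) : a = b :=
  card_le_one.1 h a (mem_filter.2 ⟨ha, hva⟩) b (mem_filter.2 ⟨hb, hvb⟩)

lemma sum_degIn_comm (s t : Finset V) : ∑ u ∈ s, degIn G t u = ∑ v ∈ t, degIn G s v := by
  refine (sum_card_bipartiteAbove_eq_sum_card_bipartiteBelow G.Adj).trans
    (sum_congr rfl fun v _ => ?_)
  simp only [bipartiteBelow, degIn, G.adj_comm v]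

variable (G) in
/-- `G` has fewer than `(d + 2 choose 2)` edges inside `s` and contains there neither `K_{d+1}`
nor `K_{d+2}` with the edges of a triangle removed. -/
def Admissible (s : Finset V) (d : ℕ) : Prop :=
  degSum G s < (d + 2) * (d + 1) ∧ (∀ t ⊆ s, G.IsClique (t : Set V) → #t ≤ d) ∧
    ∀ t ⊆ s, G.IsClique (t : Set V) → #t + 1 = d → #(s.filter fun v => ∀ u ∈ t, G.Adj u v) ≤ 2

lemma Admissible.mono {s t : Finset V} {d : ℕ} (h : Admissible G t d) (hst : s ⊆ t) :
    Admissible G s d :=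
  ⟨(degSum_mono hst).trans_lt h.1, fun r hr => h.2.1 r (hr.trans hst), fun r hr hc hcard =>
    (card_le_card (filter_subset_filter _ hst)).trans (h.2.2 r (hr.trans hst) hc hcard)⟩

lemma card_mul_le_degSum {s : Finset V} {k : ℕ} (h : ∀ v ∈ s, k ≤ degIn G s v) :
    #s * k ≤ degSum G s := by
  rw [← smul_eq_mul]
  exact card_nsmul_le_sum _ _ _ h

variable [DecidableEq V]

lemma degIn_union {s t : Finset V} (h : Disjoint s t) (v : V) :
    degIn G (s ∪ t) v = degIn G s v + degIn G t v := by
  rw [degIn, filter_union, card_union_of_disjoint (disjoint_filter_filter h), degIn, degIn]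

lemma degIn_erase {s : Finset V} {v : V} (hv : v ∈ s) (u : V) :
    degIn G (s.erase v) u + (if G.Adj u v then 1 else 0) = degIn G s u := by
  rw [degIn, degIn, filter_erase]
  split_ifs with h
  · exact card_erase_add_one (by simp [hv, h])
  · rw [erase_eq_of_notMem (by simp [h]), add_zero]

lemma degIn_erase_self (s : Finset V) (v : V) : degIn G (s.erase v) v = degIn G s v := by
  rw [degIn, degIn, filter_erase, erase_eq_of_notMem (by simp)]

lemma degIn_le_erase_add_one (s : Finset V) (u v : V) :
    degIn G s u ≤ degIn G (s.erase v) u + 1 := by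
  by_cases hv : v ∈ s
  · rw [← degIn_erase hv u]
    split_ifs <;> omega
  · rw [erase_eq_of_notMem hv]; omega

lemma degSum_erase {s : Finset V} {v : V} (hv : v ∈ s) :
    degSum G (s.erase v) + 2 * degIn G s v = degSum G s := by
  have h1 : degSum G s = degIn G s v + ∑ u ∈ s.erase v, degIn G s u :=
    (add_sum_erase _ _ hv).symm
  have h2 : ∑ u ∈ s.erase v, degIn G s u =
      degSum G (s.erase v) + ∑ u ∈ s.erase v, (if G.Adj u v then 1 else 0) := by
    rw [degSum, ← sum_add_distrib]
    exact sum_congr rfl fun u _ => (degIn_erase hv u).symm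
  have h3 : ∑ u ∈ s.erase v, (if G.Adj u v then 1 else 0) = degIn G s v := by
    rw [← degIn_erase_self, degIn, card_filter]
    exact sum_congr rfl fun u _ => by simp [G.adj_comm]
  omega

lemma even_degSum (s : Finset V) : Even (degSum G s) := by
  induction s using Finset.strongInduction with
  | H s ih =>
    rcases s.eq_empty_or_nonempty with rfl | ⟨v, hv⟩
    · simp [degSum]
    · rw [← degSum_erase hv]
      exact (ih _ (erase_ssubset hv)).add (even_two_mul _)

/-- Removing two nonadjacent vertices. -/
lemma degSum_erase_erase {s : Finset V} {u v : V} (hu : u ∈ s) (hv : v ∈ s) (huv : u ≠ v)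
    (h : ¬ G.Adj u v) :
    degSum G ((s.erase u).erase v) + 2 * (degIn G s u + degIn G s v) = degSum G s := by
  have h1 := degSum_erase (G := G) hu
  have h2 := degSum_erase (G := G) (mem_erase.2 ⟨huv.symm, hv⟩)
  have h3 := degIn_erase (G := G) hu v
  rw [if_neg (by rwa [G.adj_comm])] at h3
  omega

lemma degIn_of_clique {t : Finset V} (ht : G.IsClique t) {v : V} (hv : v ∈ t) :
    degIn G t v + 1 = #t := by
  have : t.filter (G.Adj v) = t.erase v := by
    ext u
    simp only [mem_filter, mem_erase]
    constructor
    · rintro ⟨hu, h⟩; exact ⟨h.ne', hu⟩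
    · rintro ⟨hne, hu⟩; exact ⟨hu, ht hv hu hne.symm⟩
  rw [degIn, this, card_erase_add_one hv]

lemma degSum_of_clique {t : Finset V} (ht : G.IsClique t) :
    degSum G t + #t = #t * #t := by
  have : ∑ v ∈ t, (degIn G t v + 1) = #t * #t := by
    rw [sum_congr rfl fun v hv => degIn_of_clique ht hv, sum_const, smul_eq_mul]
  simpa [sum_add_distrib, degSum] using this

lemma degSum_add_le_of_notMem {s t : Finset V} {z : V} (hts : t ⊆ s) (hz : z ∈ s)
    (hzt : z ∉ t) : degSum G t + 2 * degIn G s z ≤ degSum G s := by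
  rw [← degSum_erase hz]
  exact Nat.add_le_add_right (degSum_mono (subset_erase.2 ⟨hts, hzt⟩)) _

lemma degIn_le_card_sub_one {s : Finset V} {v : V} (hv : v ∈ s) : degIn G s v + 1 ≤ #s := by
  rw [← degIn_erase_self, ← card_erase_add_one hv]
  exact Nat.add_le_add_right (card_filter_le _ _) _

lemma exists_not_adj_of_degIn_lt {s : Finset V} {v : V} (hv : v ∈ s)
    (h : degIn G s v + 1 < #s) : ∃ u ∈ s, u ≠ v ∧ ¬ G.Adj v u := by
  by_contra! hc
  have : s.erase v ⊆ s.filter (G.Adj v) := fun u hu =>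
    mem_filter.2 ⟨(mem_erase.1 hu).2, hc u (mem_erase.1 hu).2 (mem_erase.1 hu).1⟩
  have h2 := card_le_card this
  rw [card_erase_of_mem hv] at h2
  unfold degIn at h
  omega

lemma degIn_lt_of_not_adj {s : Finset V} {u v : V} (hv : v ∈ s) (hu : u ∈ s) (huv : u ≠ v)
    (h : ¬ G.Adj v u) : degIn G s v + 1 < #s := by
  have h1 := degIn_erase (G := G) hu v
  rw [if_neg h] at h1
  have h2 := degIn_le_card_sub_one (G := G) (mem_erase.2 ⟨huv.symm, hv⟩)
  have h3 := card_erase_add_one hu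
  omega

lemma exists_not_adj_of_not_clique {s : Finset V} (h : ¬ G.IsClique s) :
    ∃ u ∈ s, ∃ v ∈ s, u ≠ v ∧ ¬ G.Adj u v := by
  by_contra! hc
  exact h fun u hu v hv huv => hc u hu v hv huv

lemma degIn_add_mul_le {s : Finset V} {k : ℕ} (h : ∀ v ∈ s, k ≤ degIn G s v) {v : V}
    (hv : v ∈ s) : degIn G s v + #s * k ≤ degSum G s + k := by
  have h1 : #(s.erase v) • k ≤ ∑ u ∈ s.erase v, degIn G s u :=
    card_nsmul_le_sum _ _ _ fun u hu => h u (mem_of_mem_erase hu)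
  have h2 := add_sum_erase s (degIn G s) hv
  rw [smul_eq_mul] at h1
  rw [← card_erase_add_one hv, add_one_mul, degSum]
  omega

lemma OrthoRep.of_degIn {s : Finset V} {d : ℕ} {v : V} (hv : degIn G s v + 2 ≤ d)
    (h : OrthoRep G (s.erase v) d) : OrthoRep G s d := by
  obtain ⟨f, f1, f2, f3⟩ := h
  let N := (s.filter (G.Adj v)).image f
  let W := (Submodule.span ℝ (N : Set (EuclideanSpace ℝ (Fin d))))ᗮ
  have hW : 2 ≤ Module.finrank ℝ W := by
    have h1 := Submodule.finrank_add_finrank_orthogonal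
      (Submodule.span ℝ (N : Set (EuclideanSpace ℝ (Fin d))))
    have h2 : Module.finrank ℝ (Submodule.span ℝ (N : Set (EuclideanSpace ℝ (Fin d)))) ≤ _ :=
      (finrank_span_finset_le_card (R := ℝ) N).trans card_image_le
    rw [finrank_euclideanSpace_fin] at h1
    unfold degIn at hv
    change 2 ≤ Module.finrank ℝ (Submodule.span ℝ (N : Set (EuclideanSpace ℝ (Fin d))))ᗮ
    omega
  let b := stdOrthonormalBasis ℝ W
  let i : Fin (Module.finrank ℝ W) := ⟨0, by omega⟩
  let j : Fin (Module.finrank ℝ W) := ⟨1, by omega⟩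
  have hij : i ≠ j := by simp [i, j]
  have bi : inner ℝ (b i) (b i) = (1 : ℝ) := by simp
  have bj : inner ℝ (b j) (b j) = (1 : ℝ) := by simp
  have bij : inner ℝ (b i) (b j) = (0 : ℝ) := b.orthonormal.2 hij
  have bji : inner ℝ (b j) (b i) = (0 : ℝ) := b.orthonormal.2 hij.symm
  let p : ℝ → W := fun θ => Real.cos θ • b i + Real.sin θ • b j
  have hp : Set.InjOn (fun θ => (p θ : EuclideanSpace ℝ (Fin d))) (Set.Icc 0 Real.pi) := by
    intro x hx y hy hxy
    have hxy' : p x = p y := Subtype.ext hxy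
    have := congrArg (fun w => inner ℝ (b i) w) hxy'
    simp only [p, inner_add_right, inner_smul_right, bi, bij] at this
    exact Real.injOn_cos hx hy (by simpa using this)
  have hinf : ((fun θ => (p θ : EuclideanSpace ℝ (Fin d))) '' Set.Icc 0 Real.pi).Infinite :=
    (Set.Icc_infinite Real.pi_pos).image hp
  obtain ⟨_, ⟨θ, -, rfl⟩, hθ⟩ := hinf.exists_notMem_finset (s.image f)
  have hnorm : ‖(p θ : EuclideanSpace ℝ (Fin d))‖ = 1 := by
    have : ‖p θ‖ * ‖p θ‖ = 1 := by
      rw [← real_inner_self_eq_norm_mul_norm]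
      simp only [p, inner_add_right, inner_add_left, inner_smul_right, inner_smul_left, bi, bj,
        bij, bji]
      have := Real.sin_sq_add_cos_sq θ
      simp only [conj_trivial]
      linarith
    change ‖p θ‖ = 1
    nlinarith [norm_nonneg (p θ)]
  have horth (u) (hu : u ∈ s) (huv : G.Adj v u) :
      inner ℝ (f u) (p θ : EuclideanSpace ℝ (Fin d)) = 0 := by
    refine (Submodule.mem_orthogonal _ _).1 (p θ).2 _ (Submodule.subset_span ?_)
    exact mem_coe.2 (mem_image_of_mem _ (mem_filter.2 ⟨hu, huv⟩))
  have hne (u) (hu : u ∈ s) : f u ≠ p θ := fun h => hθ (mem_image.2 ⟨u, hu, h⟩)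
  refine ⟨fun u => if u = v then p θ else f u, ?_, ?_, ?_⟩
  · intro x hx y hy hxy
    dsimp only at hxy
    split_ifs at hxy with h1 h2 h2
    · rw [h1, h2]
    · exact absurd hxy.symm (hne y hy)
    · exact absurd hxy (hne x hx)
    · exact f1 (by simpa [h1] using hx) (by simpa [h2] using hy) hxy
  · intro x hx
    beta_reduce
    split_ifs with h1
    · exact hnorm
    · exact f2 x (mem_erase.2 ⟨h1, hx⟩)
  · intro x hx y hy hxy
    beta_reduce
    split_ifs with h1 h2 h2
    · subst h1 h2; exact absurd hxy G.irrefl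
    · subst h1; rw [real_inner_comm]; exact horth y hy hxy
    · subst h2; exact horth x hx hxy.symm
    · exact f3 x (mem_erase.2 ⟨h1, hx⟩) y (mem_erase.2 ⟨h2, hy⟩) hxy

lemma exists_other_neighbor {s : Finset V} {v a : V} (h : degIn G s v = 2) (ha : a ∈ s)
    (hva : G.Adj v a) :
    ∃ b ∈ s, b ≠ a ∧ G.Adj v b ∧ ∀ u ∈ s, G.Adj v u → u = a ∨ u = b := by
  have ha' : a ∈ s.filter (G.Adj v) := mem_filter.2 ⟨ha, hva⟩
  have h1 : #((s.filter (G.Adj v)).erase a) = 1 := by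
    rw [card_erase_of_mem ha']; unfold degIn at h; omega
  obtain ⟨b, hb⟩ := card_eq_one.1 h1
  have key (u : V) : u ≠ a ∧ u ∈ s ∧ G.Adj v u ↔ u = b := by
    rw [← mem_filter, ← mem_erase, hb, mem_singleton]
  obtain ⟨h2, h3, h4⟩ := (key b).2 rfl
  refine ⟨b, h3, h2, h4, fun u hu huv => ?_⟩
  by_cases hua : u = a
  · exact .inl hua
  · exact .inr ((key u).1 ⟨hua, hu, huv⟩)

/-- If all degrees are at most two and there are at most two vertices of degree two, then every
component is a subgraph of a 4-cycle or has at most three vertices and no triangle. -/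
lemma OrthoRep.planar {s : Finset V} (h2 : ∀ v ∈ s, degIn G s v ≤ 2)
    (hc : #(s.filter fun v => degIn G s v = 2) ≤ 2) : OrthoRep G s 2 := by
  induction s using Finset.strongInduction with
  | H s ih =>
    have ih' (t : Finset V) (ht : t ⊂ s) : OrthoRep G t 2 := by
      refine ih t ht (fun v hv => (degIn_mono ht.1 v).trans (h2 v (ht.1 hv)))
        ((card_le_card fun v hv => ?_).trans hc)
      rw [mem_filter] at hv ⊢
      have h3 := degIn_mono (G := G) ht.1 v
      have h4 := h2 v (ht.1 hv.1)
      exact ⟨ht.1 hv.1, by omega⟩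
    have step (X : Finset V) (hX : X ⊆ s) (hne : X.Nonempty)
        (hcl : ∀ u ∈ X, ∀ v ∈ s, G.Adj u v → v ∈ X) (hrep : OrthoRep G X 2) :
        OrthoRep G s 2 := by
      rw [← union_sdiff_of_subset hX]
      refine hrep.union_planar (fun u hu v hv huv => ?_) (ih' _ (sdiff_ssubset hX hne))
      exact (mem_sdiff.1 hv).2 (hcl u hu v (mem_sdiff.1 hv).1 huv)
    by_cases hA : ∃ a ∈ s, ∃ b ∈ s, G.Adj a b ∧ degIn G s a = 2 ∧ degIn G s b = 2
    · obtain ⟨a, ha, b, hb, hab, ha2, hb2⟩ := hA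
      obtain ⟨x, hx, hxb, hax, hx'⟩ := exists_other_neighbor ha2 hb hab
      obtain ⟨y, hy, hya, hby, hy'⟩ := exists_other_neighbor hb2 ha hab.symm
      have hdeg (z : V) (hz : z ∈ s) (hza : z ≠ a) (hzb : z ≠ b) : degIn G s z ≤ 1 := by
        by_contra hcon
        have hz2 : degIn G s z = 2 := by have := h2 z hz; omega
        have : ({z, a, b} : Finset V) ⊆ s.filter fun v => degIn G s v = 2 := by
          intro w hw
          simp only [mem_insert, mem_singleton] at hw
          rcases hw with rfl | rfl | rfl <;> simp [*]
        have h3 := card_le_card this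
        rw [card_eq_three.2 ⟨z, a, b, hza, hzb, hab.ne, rfl⟩] at h3
        omega
      have hx1 := hdeg x hx hax.ne' hxb
      have hy1 := hdeg y hy hya hby.ne'
      have hxn (v : V) (hv : v ∈ s) (hxv : G.Adj x v) : v = a :=
        eq_of_degIn_le_one hx1 hv ha hxv hax.symm
      have hyn (v : V) (hv : v ∈ s) (hyv : G.Adj y v) : v = b :=
        eq_of_degIn_le_one hy1 hv hb hyv hby.symm
      refine step ({a, y} ∪ {b, x}) ?_ (by simp) ?_
        ((OrthoRep.pair fun h => hab.ne (hyn a ha h.symm)).union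
          (OrthoRep.pair fun h => hab.ne' (hxn b hb h.symm)))
      · intro w; simp only [mem_union, mem_insert, mem_singleton]
        rintro ((rfl | rfl) | (rfl | rfl)) <;> assumption
      · intro w; simp only [mem_union, mem_insert, mem_singleton]
        rintro ((rfl | rfl) | (rfl | rfl)) v hv hwv
        · have := hx' v hv hwv; tauto
        · have := hyn v hv hwv; tauto
        · have := hy' v hv hwv; tauto
        · have := hxn v hv hwv; tauto
    push Not at hA
    have hle {z : V} (hz : z ∈ s) (hz2 : degIn G s z ≠ 2) : degIn G s z ≤ 1 := by
      have := h2 z hz; omega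
    by_cases hB : ∃ a ∈ s, degIn G s a = 2
    · obtain ⟨a, ha, ha2⟩ := hB
      obtain ⟨x, hx⟩ : (s.filter (G.Adj a)).Nonempty := card_pos.1 (by unfold degIn at ha2; omega)
      obtain ⟨hx, hax⟩ := mem_filter.1 hx
      obtain ⟨y, hy, hyx, hay, hy'⟩ := exists_other_neighbor ha2 hx hax
      have hxn (v : V) (hv : v ∈ s) (hxv : G.Adj x v) : v = a :=
        eq_of_degIn_le_one (hle hx (hA a ha x hx hax ha2)) hv ha hxv hax.symm
      have hyn (v : V) (hv : v ∈ s) (hyv : G.Adj y v) : v = a :=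
        eq_of_degIn_le_one (hle hy (hA a ha y hy hay ha2)) hv ha hyv hay.symm
      refine step ({a, a} ∪ {x, y}) ?_ (by simp) ?_
        ((OrthoRep.pair G.irrefl).union (OrthoRep.pair fun h => hay.ne' (hxn y hy h)))
      · intro w; simp only [mem_union, mem_insert, mem_singleton]
        rintro ((rfl | rfl) | (rfl | rfl)) <;> assumption
      · intro w; simp only [mem_union, mem_insert, mem_singleton]
        rintro ((rfl | rfl) | (rfl | rfl)) v hv hwv
        · have := hy' v hv hwv; tauto
        · have := hy' v hv hwv; tauto
        · have := hxn v hv hwv; tauto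
        · have := hyn v hv hwv; tauto
    push Not at hB
    by_cases hC : ∃ a ∈ s, ∃ b ∈ s, G.Adj a b
    · obtain ⟨a, ha, b, hb, hab⟩ := hC
      refine step ({a, a} ∪ {b, b}) ?_ (by simp) ?_
        ((OrthoRep.pair G.irrefl).union (OrthoRep.pair G.irrefl))
      · intro w; simp only [mem_union, mem_insert, mem_singleton]
        rintro ((rfl | rfl) | (rfl | rfl)) <;> assumption
      · intro w; simp only [mem_union, mem_insert, mem_singleton, or_self]
        rintro (rfl | rfl) v hv hwv
        · exact .inr (eq_of_degIn_le_one (hle ha (hB _ ha)) hv hb hwv hab)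
        · exact .inl (eq_of_degIn_le_one (hle hb (hB _ hb)) hv ha hwv hab.symm)
    push Not at hC
    rcases s.eq_empty_or_nonempty with rfl | ⟨v, hv⟩
    · exact .of_card_le (by simp)
    · refine .of_degIn (v := v) ?_ (ih' _ (erase_ssubset hv))
      rw [degIn, filter_false_of_mem (hC v hv), card_empty]

lemma OrthoRep.planar_of_degSum_le {s : Finset V} (h : degSum G s ≤ 5) : OrthoRep G s 2 := by
  refine .planar (fun v hv => ?_) ?_
  · have := degSum_erase (G := G) hv; omega
  · have h1 : #(s.filter fun v => degIn G s v = 2) * 2 ≤ degSum G s := by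
      rw [← smul_eq_mul]
      exact (card_nsmul_le_sum _ (degIn G s) 2 fun v hv => (mem_filter.1 hv).2.ge).trans
        (sum_le_sum_of_subset (filter_subset _ _))
    omega

lemma OrthoRep.planar_of_degSum_le_card {s : Finset V} (h1 : ∀ v ∈ s, 1 ≤ degIn G s v)
    (h : degSum G s ≤ #s + 1) : OrthoRep G s 2 := by
  refine .planar (fun v hv => ?_) ?_
  · have := degIn_add_mul_le h1 hv
    omega
  · have h2 : ∑ v ∈ s, (1 + if degIn G s v = 2 then 1 else 0) ≤ degSum G s := by
      refine sum_le_sum fun v hv => ?_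
      have := h1 v hv
      split_ifs <;> omega
    rw [sum_add_distrib, ← card_filter, sum_const, smul_eq_mul] at h2
    omega

/-- A cut of minimum inner degree sum splits the graph into two planar pieces. -/
lemma OrthoRep.of_degIn_le_four {s : Finset V} (h4 : ∀ v ∈ s, degIn G s v ≤ 4)
    (hcl : G.IsClique (s.filter fun v => degIn G s v = 4 : Finset V))
    (hcard : #(s.filter fun v => degIn G s v = 4) ≤ 4) : OrthoRep G s 4 := by
  set D := s.filter fun v => degIn G s v = 4 with hD
  let cost (A : Finset V) : ℕ := degSum G A + degSum G (s \ A)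
  let IsOpt (A : Finset V) : Prop := A ⊆ s ∧ ∀ B ⊆ s, cost A ≤ cost B
  have hmove {A : Finset V} (hA : A ⊆ s) {v : V} (hv : v ∈ A) :
      cost (A.erase v) + 2 * degIn G A v = cost A + 2 * degIn G (s \ A) v := by
    have h1 := degSum_erase (G := G) hv
    have hv' : v ∈ s \ A.erase v := by simp [hA hv]
    have h2 := degSum_erase (G := G) hv'
    have h3 : (s \ A.erase v).erase v = s \ A := by
      ext w
      simp only [mem_erase, mem_sdiff]
      grind
    rw [← degIn_erase_self, h3] at h2
    simp only [cost]
    omega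
  have hsplit {A : Finset V} (hA : A ⊆ s) (v : V) :
      degIn G A v + degIn G (s \ A) v = degIn G s v := by
    rw [← degIn_union disjoint_sdiff, union_sdiff_of_subset hA]
  have hopt {A : Finset V} (hA : IsOpt A) {v : V} (hv : v ∈ A) :
      degIn G A v ≤ degIn G (s \ A) v := by
    have h1 := hmove hA.1 hv
    have h2 := hA.2 _ ((erase_subset v A).trans hA.1)
    omega
  have hsymm {A : Finset V} (hA : IsOpt A) : IsOpt (s \ A) := by
    refine ⟨sdiff_subset, fun B hB => ?_⟩
    have := hA.2 B hB
    simp only [cost, Finset.sdiff_sdiff_eq_self hA.1] at this ⊢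
    omega
  have hcut (A : Finset V) (hA : IsOpt A) (h : #(D ∩ A) ≤ 2) : OrthoRep G A 2 := by
    have key (v) (hv : v ∈ A) := And.intro (hopt hA hv) (And.intro (hsplit hA.1 v) (h4 v (hA.1 hv)))
    refine .planar (fun v hv => ?_) ((card_le_card fun v hv => ?_).trans h)
    · have := key v hv; omega
    · rw [mem_filter] at hv
      have := key v hv.1
      rw [mem_inter, hD, mem_filter]
      exact ⟨⟨hA.1 hv.1, by omega⟩, hv.1⟩
  have hbal (A : Finset V) (hA : IsOpt A) (h : 3 ≤ #(D ∩ A)) :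
      ∃ B, IsOpt B ∧ #(D ∩ B) ≤ 2 ∧ #(D ∩ (s \ B)) ≤ 2 := by
    obtain ⟨a, ha⟩ : (D ∩ A).Nonempty := card_pos.1 (by omega)
    obtain ⟨haD, haA⟩ := mem_inter.1 ha
    have h1 : degIn G (D ∩ A) a + 1 = #(D ∩ A) :=
      degIn_of_clique (hcl.subset (by exact_mod_cast inter_subset_left)) ha
    have h2 := degIn_mono (G := G) (inter_subset_right : D ∩ A ⊆ A) a
    have h3 := hopt hA haA
    have h5 := hsplit hA.1 a
    have h6 : degIn G s a = 4 := (mem_filter.1 haD).2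
    have h7 := hmove hA.1 haA
    have h8 : #(D ∩ A.erase a) + 1 = #(D ∩ A) := by
      rw [inter_erase, card_erase_add_one ha]
    have h9 : #(D ∩ A.erase a) + #(D ∩ (s \ A.erase a)) = #D := by
      have : D ∩ (s \ A.erase a) = D \ A.erase a := by
        rw [← inter_sdiff_assoc, inter_eq_left.2 (filter_subset _ _)]
      rw [this, card_inter_add_card_sdiff]
    refine ⟨A.erase a, ⟨(erase_subset _ _).trans hA.1, fun B hB => ?_⟩, by omega, by omega⟩
    have := hA.2 B hB
    omega
  obtain ⟨A, hA⟩ : ∃ A, IsOpt A := by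
    obtain ⟨A, hA, hmin⟩ := exists_min_image s.powerset cost ⟨∅, by simp⟩
    exact ⟨A, mem_powerset.1 hA, fun B hB => hmin B (mem_powerset.2 hB)⟩
  obtain ⟨B, hB, hB1, hB2⟩ : ∃ B, IsOpt B ∧ #(D ∩ B) ≤ 2 ∧ #(D ∩ (s \ B)) ≤ 2 := by
    by_cases h1 : 3 ≤ #(D ∩ A)
    · exact hbal A hA h1
    by_cases h2 : 3 ≤ #(D ∩ (s \ A))
    · exact hbal _ (hsymm hA) h2
    · exact ⟨A, hA, by omega, by omega⟩
  rw [← union_sdiff_of_subset hB.1]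
  exact (hcut B hB hB1).union (hcut _ (hsymm hB) hB2)

lemma OrthoRep.three_of_degSum_lt {s : Finset V} (h : degSum G s < 14)
    (hcl : ∀ t ⊆ s, G.IsClique (t : Set V) → #t ≤ 3) : OrthoRep G s 3 := by
  induction s using Finset.strongInduction with
  | H s ih =>
    by_cases hdeg : ∃ v ∈ s, degIn G s v + 2 ≤ 3
    · obtain ⟨v, hv, hdeg⟩ := hdeg
      exact .of_degIn hdeg (ih _ (erase_ssubset hv) ((degSum_mono (erase_subset _ _)).trans_lt h)
        fun t ht => hcl t (ht.trans (erase_subset _ _)))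
    push Not at hdeg
    by_cases hs : G.IsClique (s : Set V)
    · exact .of_card_le (hcl s subset_rfl hs)
    obtain ⟨u, hu, v, hv, huv, hadj⟩ := exists_not_adj_of_not_clique hs
    refine .of_erase_erase hadj (.planar_of_degSum_le ?_)
    have h1 := degSum_erase_erase hu hv huv hadj
    have h2 := hdeg u hu
    have h3 := hdeg v hv
    omega

lemma le_degSum_of_clique {s t : Finset V} (hts : t ⊆ s) (ht : G.IsClique (t : Set V)) {n : ℕ}
    (hn : n ≤ #t) : n * n ≤ degSum G s + n := by
  obtain ⟨r, hr, rfl⟩ := exists_subset_card_eq hn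
  rw [← degSum_of_clique (ht.subset (by exact_mod_cast hr))]
  exact Nat.add_le_add_right (degSum_mono (hr.trans hts)) _

lemma card_add_le_degIn_of_join {s t c : Finset V} (ht : G.IsClique (t : Set V))
    (hts : t ⊆ s) (hcs : c ⊆ s) (htc : ∀ u ∈ t, ∀ v ∈ c, G.Adj u v) {u : V} (hu : u ∈ t) :
    #t + #c ≤ degIn G s u + 1 := by
  have hdisj : Disjoint t c :=
    Finset.disjoint_left.2 fun v hvt hvc => G.irrefl (htc v hvt v hvc)
  have h1 := degIn_union (G := G) hdisj u
  have h2 := degIn_of_clique ht hu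
  have h3 : degIn G c u = #c := by rw [degIn, filter_true_of_mem (htc u hu)]
  have h4 := degIn_mono (G := G) (union_subset hts hcs) u
  omega

lemma le_degSum_of_join {s t : Finset V} {d : ℕ} (hts : t ⊆ s) (ht : G.IsClique (t : Set V))
    (hcard : #t + 1 = d) (h3 : 3 ≤ #(s.filter fun v => ∀ u ∈ t, G.Adj u v)) :
    d * d + 3 * d ≤ degSum G s + 4 := by
  obtain ⟨c, hc, hc3⟩ := exists_subset_card_eq h3
  have hcs : c ⊆ s := hc.trans (filter_subset _ _)
  have htc (u) (hu : u ∈ t) (v) (hv : v ∈ c) : G.Adj u v := (mem_filter.1 (hc hv)).2 u hu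
  have hdisj : Disjoint t c :=
    Finset.disjoint_left.2 fun v hvt hvc => G.irrefl (htc v hvt v hvc)
  have h1 : #t * (#t + 2) ≤ ∑ u ∈ t, degIn G s u := by
    rw [← smul_eq_mul]
    refine card_nsmul_le_sum _ _ _ fun u hu => ?_
    have := card_add_le_degIn_of_join ht hts hcs htc hu
    omega
  have h2 : #c * #t ≤ ∑ v ∈ c, degIn G s v := by
    rw [← smul_eq_mul]
    refine card_nsmul_le_sum _ _ _ fun v hv => card_le_card fun u hu => ?_
    exact mem_filter.2 ⟨hts hu, (htc u hu v hv).symm⟩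
  have h4 : ∑ u ∈ t, degIn G s u + ∑ v ∈ c, degIn G s v ≤ degSum G s := by
    rw [← sum_union hdisj]
    exact sum_le_sum_of_subset (union_subset hts hcs)
  subst hcard
  rw [hc3] at h2
  nlinarith

lemma exists_disjoint_non_edges {s : Finset V} {d : ℕ} (hs : #s = d + 2)
    (hcl : ∀ t ⊆ s, G.IsClique (t : Set V) → #t ≤ d)
    (hjoin : ∀ t ⊆ s, G.IsClique (t : Set V) → #t + 1 = d →
      #(s.filter fun v => ∀ u ∈ t, G.Adj u v) ≤ 2) :
    ∃ x ∈ s, ∃ y ∈ s, x ≠ y ∧ ¬ G.Adj x y ∧ ∃ u ∈ (s.erase x).erase y,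
      ∃ v ∈ (s.erase x).erase y, u ≠ v ∧ ¬ G.Adj u v := by
  by_contra! hcon
  have hcon' (x) (hx : x ∈ s) (y) (hy : y ∈ s) (hxy : x ≠ y) (h : ¬ G.Adj x y) (u) (hu : u ∈ s)
      (v) (hv : v ∈ s) (huv : u ≠ v) (h' : ¬ G.Adj u v) : u = x ∨ u = y ∨ v = x ∨ v = y := by
    by_contra! hne
    exact h' (hcon x hx y hy hxy h u (by simp [hne, hu]) v (by simp [hne, hv]) huv)
  have hnc (t : Finset V) (ht : t ⊆ s) (h : d < #t) :
      ∃ u ∈ t, ∃ v ∈ t, u ≠ v ∧ ¬ G.Adj u v :=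
    exists_not_adj_of_not_clique fun hc => (hcl t ht hc).not_gt h
  obtain ⟨x, hx, y, hy, hxy, hadj⟩ := hnc s subset_rfl (by omega)
  have hthird (x) (hx : x ∈ s) (y) (hy : y ∈ s) (hxy : x ≠ y) (hadj : ¬ G.Adj x y) :
      ∃ v ∈ s, v ≠ x ∧ v ≠ y ∧ ¬ G.Adj y v := by
    obtain ⟨u, hu, v, hv, huv, h⟩ := hnc (s.erase x) (erase_subset _ _)
      (by rw [card_erase_of_mem hx]; omega)
    obtain ⟨hux, hu⟩ := mem_erase.1 hu
    obtain ⟨hvx, hv⟩ := mem_erase.1 hv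
    rcases hcon' x hx y hy hxy hadj u hu v hv huv h with h1 | h1 | h1 | h1
    · exact absurd h1 hux
    · subst h1; exact ⟨v, hv, hvx, huv.symm, h⟩
    · exact absurd h1 hvx
    · subst h1; exact ⟨u, hu, hux, huv, fun h2 => h h2.symm⟩
  obtain ⟨v, hv, hvx, hvy, hyv⟩ := hthird x hx y hy hxy hadj
  obtain ⟨w, hw, hwy, hwx, hxw⟩ := hthird y hy x hx hxy.symm fun h => hadj h.symm
  have hwv : w = v := by
    rcases hcon' x hx w hw hwx.symm hxw y hy v hv hvy.symm hyv with h | h | h | h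
    · exact absurd h.symm hxy
    · exact absurd h.symm hwy
    · exact absurd h hvx
    · exact h.symm
  subst hwv
  let t := ((s.erase x).erase y).erase w
  have hts : t ⊆ s := (erase_subset _ _).trans ((erase_subset _ _).trans (erase_subset _ _))
  have hmem {p : V} (hp : p ∈ t) : p ≠ x ∧ p ≠ y ∧ p ≠ w := by
    simp only [t, mem_erase] at hp; tauto
  have htcl : G.IsClique (t : Set V) := by
    intro p hp q hq hpq
    by_contra h
    have h1 := hmem hp
    have h2 := hmem hq
    rcases hcon' x hx y hy hxy hadj p (hts hp) q (hts hq) hpq h with h | h | h | h <;> tauto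
  have htx (p) (hp : p ∈ t) : G.Adj p x ∧ G.Adj p y ∧ G.Adj p w := by
    have h1 := hmem hp
    refine ⟨?_, ?_, ?_⟩ <;> by_contra h
    · rcases hcon' y hy w hw hwy.symm hyv p (hts hp) x hx h1.1 h with h | h | h | h <;> grind
    · rcases hcon' x hx w hw hwx.symm hxw p (hts hp) y hy h1.2.1 h with h | h | h | h <;> grind
    · rcases hcon' x hx y hy hxy hadj p (hts hp) w hw h1.2.2 h with h | h | h | h <;> grind
  have hcard : #t + 1 = d := by
    have h1 := card_erase_add_one hx
    have h2 := card_erase_add_one (mem_erase.2 ⟨hxy.symm, hy⟩)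
    have h3 := card_erase_add_one (mem_erase.2 ⟨hwy, mem_erase.2 ⟨hwx, hw⟩⟩)
    simp only [t]
    omega
  have hsub : ({x, y, w} : Finset V) ⊆ s.filter fun v => ∀ u ∈ t, G.Adj u v := by
    intro p hp
    simp only [mem_insert, mem_singleton] at hp
    rw [mem_filter]
    rcases hp with rfl | rfl | rfl
    · exact ⟨hx, fun u hu => (htx u hu).1⟩
    · exact ⟨hy, fun u hu => (htx u hu).2.1⟩
    · exact ⟨hw, fun u hu => (htx u hu).2.2⟩
  have h1 := (card_le_card hsub).trans (hjoin t hts htcl hcard)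
  rw [card_eq_three.2 ⟨x, y, w, hxy, hwx.symm, hwy.symm, rfl⟩] at h1
  omega

lemma card_erase_erase {s : Finset V} {x y : V} (hx : x ∈ s) (hy : y ∈ s) (hxy : x ≠ y) :
    #((s.erase x).erase y) + 2 = #s := by
  have h1 := card_erase_add_one hx
  have h2 := card_erase_add_one (mem_erase.2 ⟨hxy.symm, hy⟩)
  omega

lemma Admissible.orthoRep_of_card_le {s : Finset V} {d : ℕ} (h : Admissible G s d) (hd : 2 ≤ d)
    (hs : #s ≤ d + 2) : OrthoRep G s d := by
  obtain ⟨k, rfl⟩ := Nat.exists_eq_add_of_le' hd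
  by_cases hcl : G.IsClique (s : Set V)
  · exact .of_card_le (h.2.1 s subset_rfl hcl)
  by_cases hs' : #s = k + 2 + 2
  · obtain ⟨x, hx, y, hy, hxy, hadj, u, hu, v, hv, huv, hadj'⟩ :=
      exists_disjoint_non_edges hs' h.2.1 h.2.2
    refine .of_erase_erase hadj (.of_erase_erase hadj' (.of_card_le ?_))
    have h1 := card_erase_erase hx hy hxy
    have h2 := card_erase_erase hu hv huv
    omega
  · obtain ⟨x, hx, y, hy, hxy, hadj⟩ := exists_not_adj_of_not_clique hcl
    refine .of_erase_erase hadj (.of_card_le ?_)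
    have h1 := card_erase_erase hx hy hxy
    omega

lemma orthoRep_of_core {d : ℕ} (hd : 2 ≤ d)
    (H : ∀ s : Finset V, Admissible G s d → (∀ v ∈ s, d ≤ degIn G s v + 1) → d + 3 ≤ #s →
      OrthoRep G s d) (s : Finset V) (hs : Admissible G s d) : OrthoRep G s d := by
  induction s using Finset.strongInduction with
  | H s ih =>
    by_cases hdeg : ∃ v ∈ s, degIn G s v + 2 ≤ d
    · obtain ⟨v, hv, hdeg⟩ := hdeg
      exact .of_degIn hdeg (ih _ (erase_ssubset hv) (hs.mono (erase_subset _ _)))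
    push Not at hdeg
    by_cases hcard : #s ≤ d + 2
    · exact hs.orthoRep_of_card_le hd hcard
    · exact H s hs (fun v hv => by have := hdeg v hv; omega) (by omega)

lemma adj_of_degIn_add_one_eq {s : Finset V} {c v : V} (hc : c ∈ s) (h : degIn G s c + 1 = #s)
    (hv : v ∈ s) (hvc : v ≠ c) : G.Adj c v := by
  by_contra hn
  have := degIn_lt_of_not_adj hc hv hvc hn
  omega

lemma Admissible.erase_universal {s : Finset V} {d : ℕ} {c : V} (h : Admissible G s (d + 1))
    (hs : d + 3 ≤ #s) (hc : c ∈ s) (hdeg : degIn G s c + 1 = #s) :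
    Admissible G (s.erase c) d := by
  have hins {t : Finset V} (ht : t ⊆ s.erase c) (hcl : G.IsClique (t : Set V)) :
      insert c t ⊆ s ∧ G.IsClique ((insert c t : Finset V) : Set V) ∧
        #(insert c t) = #t + 1 := by
    refine ⟨insert_subset hc (ht.trans (erase_subset _ _)), ?_, card_insert_of_notMem fun hct =>
      notMem_erase c s (ht hct)⟩
    rw [coe_insert]
    exact hcl.insert fun v hv _ => adj_of_degIn_add_one_eq hc hdeg
      (mem_of_mem_erase (ht hv)) (ne_of_mem_erase (ht hv))
  refine ⟨?_, fun t ht hcl => ?_, fun t ht hcl hcard => ?_⟩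
  · have h1 := degSum_erase (G := G) hc
    have h2 := h.1
    nlinarith
  · obtain ⟨h1, h2, h3⟩ := hins ht hcl
    have := h.2.1 _ h1 h2
    omega
  · obtain ⟨h1, h2, h3⟩ := hins ht hcl
    refine (card_le_card fun v hv => ?_).trans (h.2.2 _ h1 h2 (by omega))
    obtain ⟨hv, hvt⟩ := mem_filter.1 hv
    refine mem_filter.2 ⟨mem_of_mem_erase hv, fun u hu => ?_⟩
    rcases mem_insert.1 hu with rfl | hu
    · exact adj_of_degIn_add_one_eq hc hdeg (mem_of_mem_erase hv) (ne_of_mem_erase hv)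
    · exact hvt u hu

lemma degIn_erase_add_one_of_universal {s : Finset V} {c v : V} (hc : c ∈ s)
    (h : degIn G s c + 1 = #s) (hv : v ∈ s.erase c) :
    degIn G (s.erase c) v + 1 = degIn G s v := by
  have := degIn_erase (G := G) hc v
  rwa [if_pos (adj_of_degIn_add_one_eq hc h (mem_of_mem_erase hv) (ne_of_mem_erase hv)).symm]
    at this

lemma exists_no_common_neighbor {s : Finset V} {k : ℕ} (h1 : ∀ v ∈ s, degIn G s v ≤ k)
    {p : V} (hp : 0 < degIn G s p) (hps : p ∈ s) (hs : k * (k + 1) < #s) :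
    ∃ q ∈ s, p ≠ q ∧ ¬ G.Adj p q ∧ ∀ r ∈ s, ¬ (G.Adj r p ∧ G.Adj r q) := by
  let N := s.filter (G.Adj p)
  let B := N ∪ N.biUnion fun r => s.filter (G.Adj r)
  have hN : #N ≤ k := h1 p hps
  have hB : #B < #s := by
    have h2 : #(N.biUnion fun r => s.filter (G.Adj r)) ≤ #N * k :=
      card_biUnion_le_card_mul _ _ _ fun r hr => h1 r (mem_filter.1 hr).1
    have h3 : #B ≤ _ := card_union_le _ _
    nlinarith
  obtain ⟨q, hq, hqB⟩ := exists_mem_notMem_of_card_lt_card hB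
  simp only [B, N, mem_union, mem_biUnion, mem_filter, not_or, not_exists, not_and] at hqB
  refine ⟨q, hq, ?_, hqB.1 hq, fun r hr h => hqB.2 r ⟨hr, h.1.symm⟩ hq h.2⟩
  rintro rfl
  obtain ⟨r, hr⟩ := card_pos.1 hp
  obtain ⟨hr, hpr⟩ := mem_filter.1 hr
  exact hqB.2 r ⟨hr, hpr⟩ hps hpr.symm

lemma OrthoRep.three_of_card_eq_seven {s : Finset V} (hs : #s = 7) (h : degSum G s ≤ 14)
    (h2 : ∀ v ∈ s, 2 ≤ degIn G s v) : OrthoRep G s 3 := by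
  have hdeg (v) (hv : v ∈ s) : degIn G s v = 2 := by
    have h3 := degIn_add_mul_le h2 hv
    have h4 := h2 v hv
    omega
  obtain ⟨p, hp⟩ : s.Nonempty := card_pos.1 (by omega)
  have hp2 := hdeg p hp
  obtain ⟨q, hq, hpq, hadj, hcom⟩ :=
    exists_no_common_neighbor (fun v hv => (hdeg v hv).le) (by omega) hp (by omega)
  have h3 := degSum_erase_erase hp hq hpq hadj
  have h4 := card_erase_erase hp hq hpq
  have hq2 := hdeg q hq
  refine .of_erase_erase hadj (.planar_of_degSum_le_card (fun y hy => ?_) (by omega))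
  have hys : y ∈ s := mem_of_mem_erase (mem_of_mem_erase hy)
  have h5 := degIn_erase (G := G) hp y
  have h6 := degIn_erase (G := G) (mem_erase.2 ⟨hpq.symm, hq⟩) y
  have h7 := hdeg y hys
  have h8 := hcom y hys
  split_ifs at h5 h6 <;> first | omega | tauto

lemma exists_universal_or_exists_not_adj (s : Finset V) :
    (∃ c ∈ s, degIn G s c + 1 = #s) ∨ ∀ v ∈ s, ∃ u ∈ s, u ≠ v ∧ ¬ G.Adj v u := by
  rw [or_iff_not_imp_left]
  push Not
  exact fun hc v hv => exists_not_adj_of_degIn_lt hv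
    (lt_of_le_of_ne (degIn_le_card_sub_one hv) (hc v hv))

lemma OrthoRep.three_of_card_eq_six {s : Finset V} (hs : #s = 6) (h : degSum G s ≤ 16)
    (h2 : ∀ v ∈ s, 2 ≤ degIn G s v)
    (hadj : ∀ u ∈ s, ∀ v ∈ s, u ≠ v → ¬ G.Adj u v → degIn G s u + degIn G s v ≤ 5)
    (hcl : ∀ t ⊆ s, G.IsClique (t : Set V) → #t ≤ 3) : OrthoRep G s 3 := by
  rcases exists_universal_or_exists_not_adj (G := G) s with ⟨c, hc, hdeg⟩ | hnon
  · have h3 := degSum_erase (G := G) hc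
    have h4 := card_erase_add_one hc
    refine .of_erase (v := c) (.planar_of_degSum_le_card (fun v hv => ?_) (by omega))
    have h5 := degIn_erase_add_one_of_universal hc hdeg hv
    have h6 := h2 v (mem_of_mem_erase hv)
    omega
  have h3 (v) (hv : v ∈ s) : degIn G s v ≤ 3 := by
    obtain ⟨u, hu, huv, h⟩ := hnon v hv
    have h4 := hadj v hv u hu huv.symm h
    have h5 := h2 u hu
    omega
  have hD : G.IsClique (s.filter fun v => degIn G s v = 3 : Finset V) := by
    intro u hu v hv huv
    simp only [coe_filter, Set.mem_ofPred_eq] at hu hv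
    by_contra h
    have := hadj u hu.1 v hv.1 huv h
    omega
  have hsum : degSum G s ≤ 15 := by
    have h4 : degSum G s ≤ ∑ v ∈ s, (2 + if degIn G s v = 3 then 1 else 0) := by
      refine sum_le_sum fun v hv => ?_
      have := h3 v hv
      split_ifs <;> omega
    rw [sum_add_distrib, ← card_filter, sum_const, smul_eq_mul] at h4
    have := hcl _ (filter_subset _ _) hD
    omega
  by_cases hp : ∃ p ∈ s, degIn G s p = 3
  · obtain ⟨p, hp, hp3⟩ := hp
    obtain ⟨q, hq, hqp, h4⟩ := hnon p hp
    have h5 := degSum_erase_erase hp hq hqp.symm h4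
    have h6 := h2 q hq
    exact .of_erase_erase h4 (.planar_of_degSum_le (by omega))
  · push Not at hp
    obtain ⟨p, hps⟩ : s.Nonempty := card_pos.1 (by omega)
    obtain ⟨q, hq, hqp, h4⟩ := hnon p hps
    have h5 := degSum_erase_erase hps hq hqp.symm h4
    have h6 := h2 q hq
    have h7 := h2 p hps
    have h8 : degSum G s ≤ #s • 2 := sum_le_card_nsmul _ _ _ fun v hv => by
      have h9 := h3 v hv
      have h10 := hp v hv
      omega
    rw [smul_eq_mul] at h8
    exact .of_erase_erase h4 (.planar_of_degSum_le (by omega))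

/-- An admissible graph has an orthogonal representation in dimension four. -/
lemma Admissible.orthoRep_four {s : Finset V} (h : Admissible G s 4) : OrthoRep G s 4 := by
  refine orthoRep_of_core (by omega) (fun s h hmin hs => ?_) s h
  have hsum := h.1
  by_cases hpair : ∃ x ∈ s, ∃ y ∈ s, x ≠ y ∧ ¬ G.Adj x y ∧ 8 ≤ degIn G s x + degIn G s y
  · obtain ⟨x, hx, y, hy, hxy, hadj, h8⟩ := hpair
    have h1 := degSum_erase_erase hx hy hxy hadj
    have h2 := card_erase_erase hx hy hxy
    refine .of_erase_erase hadj (.three_of_degSum_lt (by omega) fun t ht hcl => ?_)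
    by_contra! h4
    have hsub : (s.erase x).erase y ⊆ s := (erase_subset _ _).trans (erase_subset _ _)
    have h5 := h.2.1 t (ht.trans hsub) hcl
    obtain ⟨z, hz, hzt⟩ := exists_mem_notMem_of_card_lt_card
      (show #t < #((s.erase x).erase y) by omega)
    have h6 := degSum_add_le_of_notMem (G := G) ht hz hzt
    have h7 := degSum_of_clique hcl
    have h9 := degIn_le_erase_add_one (G := G) s z x
    have h10 := degIn_le_erase_add_one (G := G) (s.erase x) z y
    have h11 := hmin z (hsub hz)
    have h12 : #t = 4 := by omega
    rw [h12] at h7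
    omega
  push Not at hpair
  rcases exists_universal_or_exists_not_adj (G := G) s with ⟨c, hc, hdeg⟩ | hnon
  · have hK := h.erase_universal (d := 3) (by omega) hc hdeg
    have h1 := degSum_erase (G := G) hc
    have h2 := card_erase_add_one hc
    obtain ⟨m, hm⟩ := even_degSum (G := G) s
    have hu (v) (hv : v ∈ s.erase c) := degIn_erase_add_one_of_universal hc hdeg hv
    have h2' (v) (hv : v ∈ s.erase c) : 2 ≤ degIn G (s.erase c) v := by
      have h3 := hu v hv
      have h4 := hmin v (mem_of_mem_erase hv)
      omega
    have h3 := card_mul_le_degSum h2'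
    refine .of_erase (v := c) ?_
    by_cases h7 : #(s.erase c) = 7
    · exact .three_of_card_eq_seven h7 (by omega) h2'
    · refine .three_of_card_eq_six (by omega) (by omega) h2' (fun u hu' v hv huv h => ?_) hK.2.1
      have h4 := hu u hu'
      have h5 := hu v hv
      have h6 := hpair u (mem_of_mem_erase hu') v (mem_of_mem_erase hv) huv h
      omega
  · have h4 (v) (hv : v ∈ s) : degIn G s v ≤ 4 := by
      obtain ⟨u, hu, huv, hadj⟩ := hnon v hv
      have h1 := hpair v hv u hu huv.symm hadj
      have h2 := hmin u hu
      omega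
    have hD : G.IsClique (s.filter fun v => degIn G s v = 4 : Finset V) := by
      intro u hu v hv huv
      simp only [coe_filter, Set.mem_ofPred_eq] at hu hv
      by_contra h
      have := hpair u hu.1 v hv.1 huv h
      omega
    exact .of_degIn_le_four h4 hD (h.2.1 _ (filter_subset _ _) hD)

lemma admissible_of_degSum_lt {s : Finset V} {d : ℕ} (hsum : degSum G s + 4 < d * d + 3 * d)
    (hcl : ∀ t ⊆ s, G.IsClique (t : Set V) → #t ≠ d + 1) : Admissible G s d := by
  refine ⟨by linarith, fun t ht htcl => ?_, fun t ht htcl hcard => ?_⟩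
  · by_contra! htd
    obtain ⟨r, hr, hrd⟩ := exists_subset_card_eq (show d + 1 ≤ #t from htd)
    exact hcl r (hr.trans ht) (htcl.subset (by exact_mod_cast hr)) hrd
  · by_contra! h3
    have := le_degSum_of_join ht htcl hcard h3
    omega

lemma admissible_erase_erase {s : Finset V} {d : ℕ} {x y : V}
    (hmin : ∀ v ∈ s, d ≤ degIn G s v) (hs : d + 4 ≤ #s) (hx : x ∈ s) (hy : y ∈ s) (hxy : x ≠ y)
    (hsum : degSum G ((s.erase x).erase y) + 4 < d * d + 3 * d) :
    Admissible G ((s.erase x).erase y) d := by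
  refine admissible_of_degSum_lt hsum fun t ht hcl htd => ?_
  have h2 := card_erase_erase hx hy hxy
  obtain ⟨z, hz, hzt⟩ := exists_mem_notMem_of_card_lt_card
    (show #t < #((s.erase x).erase y) by omega)
  have h6 := degSum_add_le_of_notMem (G := G) ht hz hzt
  have h7 := degSum_of_clique hcl
  have h9 := degIn_le_erase_add_one (G := G) s z x
  have h10 := degIn_le_erase_add_one (G := G) (s.erase x) z y
  have h11 := hmin z (mem_of_mem_erase (mem_of_mem_erase hz))
  rw [htd] at h7
  nlinarith

lemma exists_not_adj_admissible_of_regular {s : Finset V} (h4 : ∀ v ∈ s, degIn G s v = 4)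
    (hs : 8 ≤ #s) (hsum : degSum G s < 42) :
    ∃ x ∈ s, ∃ y ∈ s, x ≠ y ∧ ¬ G.Adj x y ∧ Admissible G ((s.erase x).erase y) 4 := by
  have hcard : #s * 4 ≤ degSum G s := card_mul_le_degSum fun v hv => (h4 v hv).ge
  have hcomp {Q : Finset V} (hQ : Q ⊆ s) (hcl : G.IsClique (Q : Set V)) (h5 : #Q = 5) {v u : V}
      (hv : v ∈ Q) (hu : u ∈ s) (hvu : G.Adj v u) : u ∈ Q := by
    by_contra huQ
    have h1 := degIn_of_clique hcl hv
    have h2 := degIn_mono (G := G) (insert_subset hu hQ) v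
    have h3 := degIn_erase (G := G) (mem_insert_self u Q) v
    rw [erase_insert huQ, if_pos hvu] at h3
    have h6 := h4 v (hQ hv)
    omega
  have hjoin {t s' : Finset V} (hs' : s' ⊆ s) (ht : t ⊆ s') (hcl : G.IsClique (t : Set V))
      (h3 : #t + 1 = 4) : #(s'.filter fun v => ∀ u ∈ t, G.Adj u v) ≤ 2 := by
    by_contra! hc
    obtain ⟨u, hu⟩ : t.Nonempty := card_pos.1 (by omega)
    have h1 := card_add_le_degIn_of_join hcl ht
      (filter_subset (fun v => ∀ u ∈ t, G.Adj u v) s')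
      (fun u hu v hv => (mem_filter.1 hv).2 u hu) hu
    have h2 := degIn_mono (G := G) hs' u
    have h3 := h4 u (hs' (ht hu))
    omega
  obtain ⟨x, hx, y, hy, hxy, hadj, hno⟩ : ∃ x ∈ s, ∃ y ∈ s, x ≠ y ∧ ¬ G.Adj x y ∧
      ∀ t ⊆ (s.erase x).erase y, G.IsClique (t : Set V) → #t ≠ 5 := by
    by_cases hQ : ∃ Q ⊆ s, G.IsClique (Q : Set V) ∧ #Q = 5
    · obtain ⟨Q, hQ, hcl, h5⟩ := hQ
      obtain ⟨x, hx⟩ : Q.Nonempty := card_pos.1 (by omega)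
      obtain ⟨y, hy, hyQ⟩ := exists_mem_notMem_of_card_lt_card (show #Q < #s by omega)
      refine ⟨x, hQ hx, y, hy, fun h => hyQ (h ▸ hx), fun h => hyQ (hcomp hQ hcl h5 hx hy h),
        fun t ht htcl ht5 => ?_⟩
      have hts : t ⊆ s := ht.trans ((erase_subset _ _).trans (erase_subset _ _))
      have hdisj : Disjoint Q t := by
        rw [Finset.disjoint_left]
        intro v hvQ hvt
        have hxt : x ∉ t := fun h => by simpa using ht h
        exact hxt (hcomp hts htcl ht5 hvt (hQ hx)
          (hcl hvQ hx fun h => hxt (h ▸ hvt)))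
      have hyn : y ∉ Q ∪ t := by
        rw [mem_union, not_or]
        exact ⟨hyQ, fun h => by simpa using ht h⟩
      have h1 := card_le_card (insert_subset hy (union_subset hQ hts))
      rw [card_insert_of_notMem hyn, card_union_of_disjoint hdisj] at h1
      omega
    · push Not at hQ
      obtain ⟨x, hx⟩ : s.Nonempty := card_pos.1 (by omega)
      have h1 := h4 x hx
      obtain ⟨y, hy, hyx, hadj⟩ := exists_not_adj_of_degIn_lt hx
        (show degIn G s x + 1 < #s by omega)
      exact ⟨x, hx, y, hy, hyx.symm, hadj, fun t ht =>
        hQ t (ht.trans ((erase_subset _ _).trans (erase_subset _ _)))⟩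
  have hsub : (s.erase x).erase y ⊆ s := (erase_subset _ _).trans (erase_subset _ _)
  refine ⟨x, hx, y, hy, hxy, hadj, ?_, fun t ht hcl => ?_, fun t ht hcl => hjoin hsub ht hcl⟩
  · have h1 := degSum_erase_erase hx hy hxy hadj
    have h2 := h4 x hx
    have h3 := h4 y hy
    omega
  · by_contra! h
    obtain ⟨r, hr, hr5⟩ := exists_subset_card_eq (show 5 ≤ #t from h)
    exact hno r (hr.trans ht) (hcl.subset (by exact_mod_cast hr)) hr5

/-- An admissible graph has an orthogonal representation on the unit sphere. -/
lemma Admissible.orthoRep {d : ℕ} (hd : 4 ≤ d) {s : Finset V} (h : Admissible G s d) :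
    OrthoRep G s d := by
  induction d, hd using Nat.le_induction generalizing s with
  | base => exact h.orthoRep_four
  | succ d hd ih =>
    refine orthoRep_of_core (by omega) (fun s h hmin hs => ?_) s h
    rcases exists_universal_or_exists_not_adj (G := G) s with ⟨c, hc, hdeg⟩ | hnon
    · exact .of_erase (ih (h.erase_universal (by omega) hc hdeg))
    have hmin' (v) (hv : v ∈ s) : d ≤ degIn G s v := by have := hmin v hv; omega
    have hsum := h.1
    by_cases hpair : ∃ x ∈ s, ∃ y ∈ s, x ≠ y ∧ ¬ G.Adj x y ∧
        degSum G ((s.erase x).erase y) + 4 < d * d + 3 * d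
    · obtain ⟨x, hx, y, hy, hxy, hadj, hlt⟩ := hpair
      exact .of_erase_erase hadj
        (ih (admissible_erase_erase hmin' (by omega) hx hy hxy hlt))
    push Not at hpair
    have key (v) (hv : v ∈ s) : d = 4 ∧ degIn G s v = 4 := by
      obtain ⟨u, hu, huv, hadj⟩ := hnon v hv
      have h1 := hpair v hv u hu huv.symm hadj
      have h2 := degSum_erase_erase hv hu huv.symm hadj
      have h3 := hmin' u hu
      have h4 := hmin' v hv
      have hd4 : d = 4 := by nlinarith
      subst hd4
      omega
    obtain ⟨v, hv⟩ : s.Nonempty := card_pos.1 (by omega)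
    obtain rfl := (key v hv).1
    obtain ⟨x, hx, y, hy, hxy, hadj, h'⟩ :=
      exists_not_adj_admissible_of_regular (fun v hv => (key v hv).2) (by omega) (by omega)
    exact .of_erase_erase hadj (ih h')

lemma degSum_add_two_mul_le {s t : Finset V} (ht : t ⊆ s) :
    degSum G t + 2 * ∑ v ∈ t, degIn G (s \ t) v ≤ degSum G s := by
  have hsplit (v : V) : degIn G s v = degIn G t v + degIn G (s \ t) v := by
    rw [← degIn_union disjoint_sdiff, union_sdiff_of_subset ht]
  have h1 : degSum G s = ∑ v ∈ s \ t, degIn G s v + ∑ v ∈ t, degIn G s v :=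
    (sum_sdiff ht).symm
  simp only [hsplit, sum_add_distrib] at h1
  rw [sum_degIn_comm (s \ t) t] at h1
  unfold degSum at h1 ⊢
  omega

lemma exists_neighbors_subset_of_clique {s t : Finset V} {d : ℕ} (hts : t ⊆ s)
    (ht : G.IsClique (t : Set V)) (hcard : #t = d + 1) (hsum : degSum G s < (d + 2) * (d + 1)) :
    ∃ v ∈ t, ∀ u ∈ s, G.Adj v u → u ∈ t := by
  by_contra! hcon
  have h1 : #t • 1 ≤ ∑ v ∈ t, degIn G (s \ t) v := by
    refine card_nsmul_le_sum _ _ _ fun v hv => ?_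
    obtain ⟨u, hu, hvu, hut⟩ := hcon v hv
    exact card_pos.2 ⟨u, mem_filter.2 ⟨mem_sdiff.2 ⟨hu, hut⟩, hvu⟩⟩
  have h2 := degSum_add_two_mul_le (G := G) hts
  have h3 := degSum_of_clique ht
  rw [smul_eq_mul] at h1
  rw [hcard] at h1 h3
  nlinarith

lemma exists_neighbors_subset_of_join {s t C : Finset V} {d : ℕ} (hts : t ⊆ s)
    (ht : G.IsClique (t : Set V)) (hcard : #t + 1 = d) (hCs : C ⊆ s) (hC3 : #C = 3)
    (htC : ∀ v ∈ C, ∀ u ∈ t, G.Adj u v)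
    (hcl : ∀ r ⊆ s, G.IsClique (r : Set V) → #r ≠ d + 1)
    (hsum : degSum G s < (d + 2) * (d + 1)) :
    ∃ c ∈ s, (∀ u ∈ t, G.Adj u c) ∧ ∀ u ∈ s, G.Adj c u → u ∈ t := by
  by_contra! hcon
  have hind (a) (ha : a ∈ C) (b) (hb : b ∈ C) : ¬ G.Adj a b := by
    intro hab
    have hbt : b ∉ t := fun h => G.irrefl (htC b hb b h)
    have hat : a ∉ insert b t := by
      rw [mem_insert, not_or]
      exact ⟨hab.ne, fun h => G.irrefl (htC a ha a h)⟩
    refine hcl (insert a (insert b t))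
      (insert_subset (hCs ha) (insert_subset (hCs hb) hts)) ?_ ?_
    · push_cast
      refine (ht.insert fun u hu _ => (htC b hb u hu).symm).insert fun u hu _ => ?_
      rcases hu with rfl | hu
      · exact hab
      · exact (htC a ha u hu).symm
    · rw [card_insert_of_notMem hat, card_insert_of_notMem hbt]
      omega
  have hJ : t ∪ C ⊆ s := union_subset hts hCs
  have h1 : #C • 1 ≤ ∑ v ∈ C, degIn G (s \ (t ∪ C)) v := by
    refine card_nsmul_le_sum _ _ _ fun v hv => ?_
    obtain ⟨u, hu, hvu, hut⟩ := hcon v (hCs hv) (htC v hv)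
    refine card_pos.2 ⟨u, mem_filter.2 ⟨mem_sdiff.2 ⟨hu, ?_⟩, hvu⟩⟩
    rw [mem_union, not_or]
    exact ⟨hut, fun h => hind v hv u h hvu⟩
  have h2 : ∑ v ∈ C, degIn G (s \ (t ∪ C)) v ≤ ∑ v ∈ t ∪ C, degIn G (s \ (t ∪ C)) v :=
    sum_le_sum_of_subset subset_union_right
  have h4 := degSum_add_two_mul_le (G := G) hJ
  have h5 := le_degSum_of_join (s := t ∪ C) subset_union_left ht hcard <| hC3.symm.le.trans <|
    card_le_card fun v hv => mem_filter.2 ⟨mem_union_right _ hv, htC v hv⟩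
  rw [smul_eq_mul, hC3] at h1
  nlinarith

end DegIn

lemma dist_smul_eq_one {E : Type*} [NormedAddCommGroup E] [InnerProductSpace ℝ E] {c : ℝ}
    (hc : c ^ 2 = 2⁻¹) {x y : E} (hx : ‖x‖ = 1) (hy : ‖y‖ = 1) (hxy : inner ℝ x y = 0) :
    dist (c • x) (c • y) = 1 := by
  rw [dist_eq_norm, ← sq_eq_sq₀ (norm_nonneg _) zero_le_one, norm_sub_sq_real, norm_smul,
    norm_smul, mul_pow, mul_pow, hx, hy, real_inner_smul_left, real_inner_smul_right, hxy,
    Real.norm_eq_abs, sq_abs, hc]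
  norm_num

lemma OrthoRep.graphRealizable [Fintype V] {d : ℕ} (h : OrthoRep G univ d) :
    GraphRealizable G d := by
  obtain ⟨f, hinj, hnorm, horth⟩ := h
  have hc : (√2⁻¹ : ℝ) ^ 2 = 2⁻¹ := Real.sq_sqrt (by norm_num)
  have hc0 : (√2⁻¹ : ℝ) ≠ 0 := by positivity
  exact ⟨fun v => √2⁻¹ • f v,
    fun u v huv => hinj (by simp) (by simp) (smul_right_injective _ hc0 huv),
    fun u v huv => dist_smul_eq_one hc (hnorm u (mem_univ u)) (hnorm v (mem_univ v))
      (horth u (mem_univ u) v (mem_univ v) huv)⟩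

lemma exists_roots (b : ℝ) {k : ℝ} (hk : 0 < k) :
    ∃ x y : ℝ, x ≠ y ∧ k * x ^ 2 - 2 * b * x = 2⁻¹ ∧ k * y ^ 2 - 2 * b * y = 2⁻¹ := by
  have hs : 0 < √(b ^ 2 + k / 2) := Real.sqrt_pos.2 (by positivity)
  have hs2 : √(b ^ 2 + k / 2) ^ 2 = b ^ 2 + k / 2 := Real.sq_sqrt (by positivity)
  set r := √(b ^ 2 + k / 2)
  refine ⟨(b + r) / k, (b - r) / k, fun h => ?_, ?_, ?_⟩
  · rw [div_left_inj' hk.ne'] at h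
    linarith
  · field_simp
    linarith
  · field_simp
    linarith

/-- An orthogonal representation of all vertices except `v` and `w` yields a realization if `v` and
`w` have the same neighbors and these form a clique. The case `v = w` is allowed. -/
lemma _root_.GraphRealizable.of_twins [Fintype V] [DecidableEq V] {d : ℕ} {v w : V}
    {N : Finset V} (hN : N.Nonempty) (hcl : G.IsClique (N : Set V)) (hv : ∀ u, G.Adj v u ↔ u ∈ N)
    (hw : ∀ u, G.Adj w u ↔ u ∈ N) (h : OrthoRep G ((univ.erase v).erase w) d) :
    GraphRealizable G d := by
  obtain ⟨f, hinj, hnorm, horth⟩ := h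
  have hmem {u : V} (h1 : u ≠ v) (h2 : u ≠ w) : u ∈ (univ.erase v).erase w := by simp [h1, h2]
  have hNs {u : V} (hu : u ∈ N) : u ≠ v ∧ u ≠ w :=
    ⟨((hv u).2 hu).ne', ((hw u).2 hu).ne'⟩
  have hc : (√2⁻¹ : ℝ) ^ 2 = 2⁻¹ := Real.sq_sqrt (by norm_num)
  have hc0 : (√2⁻¹ : ℝ) ≠ 0 := by positivity
  set c : ℝ := √2⁻¹
  set S := ∑ u ∈ N, f u with hS
  have hSu {u : V} (hu : u ∈ N) : inner ℝ S (f u) = 1 := by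
    rw [hS, sum_inner, sum_eq_single_of_mem u hu, real_inner_self_eq_norm_sq,
      hnorm u (hmem (hNs hu).1 (hNs hu).2), one_pow]
    intro x hx hxu
    exact horth x (hmem (hNs hx).1 (hNs hx).2) u (hmem (hNs hu).1 (hNs hu).2) (hcl hx hu hxu)
  have hSS : ‖S‖ ^ 2 = #N := by
    rw [← real_inner_self_eq_norm_sq]
    nth_rw 2 [hS]
    rw [inner_sum, sum_congr rfl fun u hu => hSu hu]
    simp
  have hk : (0 : ℝ) < #N := by exact_mod_cast hN.card_pos
  obtain ⟨x, y, hxy, hx, hy⟩ := exists_roots c hk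
  have hS0 : S ≠ 0 := by
    rintro h
    rw [h, norm_zero] at hSS
    simp [← hSS] at hk
  have hdist {τ : ℝ} (hτ : #N * τ ^ 2 - 2 * c * τ = 2⁻¹) {u : V} (hu : u ∈ N) :
      dist (τ • S) (c • f u) = 1 := by
    rw [dist_eq_norm, ← sq_eq_sq₀ (norm_nonneg _) zero_le_one, norm_sub_sq_real, norm_smul,
      norm_smul, mul_pow, mul_pow, hnorm u (hmem (hNs hu).1 (hNs hu).2), real_inner_smul_left,
      real_inner_smul_right, hSu hu, hSS, Real.norm_eq_abs, Real.norm_eq_abs, sq_abs, sq_abs, hc]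
    linarith
  have hne {τ : ℝ} (hτ : #N * τ ^ 2 - 2 * c * τ = 2⁻¹) {u : V} (hu : u ≠ v ∧ u ≠ w) :
      τ • S ≠ c • f u := by
    intro h
    have h1 := congrArg (fun z => ‖z‖ ^ 2) h
    simp only [norm_smul, mul_pow, hSS, hnorm u (hmem hu.1 hu.2), Real.norm_eq_abs, sq_abs,
      hc] at h1
    have h2 : c * τ = 0 := by linarith
    rcases mul_eq_zero.1 h2 with h2 | h2
    · exact hc0 h2
    · norm_num [h2] at hτ
  let g (u : V) : EuclideanSpace ℝ (Fin d) :=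
    if u = v then x • S else if u = w then y • S else c • f u
  have hgv : g v = x • S := if_pos rfl
  have hgw (h : w ≠ v) : g w = y • S := by simp [g, h]
  have hg {u : V} (hu : u ≠ v ∧ u ≠ w) : g u = c • f u := by simp [g, hu]
  have hcases (u : V) : u = v ∨ (u = w ∧ w ≠ v) ∨ (u ≠ v ∧ u ≠ w) := by
    by_cases h1 : u = v
    · exact .inl h1
    by_cases h2 : u = w
    · exact .inr (.inl ⟨h2, h2 ▸ h1⟩)
    · exact .inr (.inr ⟨h1, h2⟩)
  have hxy' : x • S ≠ y • S := fun h => hxy (smul_left_injective ℝ hS0 h)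
  refine ⟨g, fun a b hab => ?_, fun a b hab => ?_⟩
  · rcases hcases a with rfl | ⟨rfl, ha⟩ | ha <;> rcases hcases b with rfl | ⟨rfl, hb⟩ | hb
    · rfl
    · rw [hgv, hgw hb] at hab
      exact absurd hab hxy'
    · rw [hgv, hg hb] at hab
      exact absurd hab (hne hx hb)
    · rw [hgv, hgw ha] at hab
      exact absurd hab.symm hxy'
    · rfl
    · rw [hgw ha, hg hb] at hab
      exact absurd hab (hne hy hb)
    · rw [hgv, hg ha] at hab
      exact absurd hab.symm (hne hx ha)
    · rw [hgw hb, hg ha] at hab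
      exact absurd hab.symm (hne hy ha)
    · rw [hg ha, hg hb] at hab
      exact hinj (hmem ha.1 ha.2) (hmem hb.1 hb.2) (smul_right_injective _ hc0 hab)
  · have hv' {u : V} (h : G.Adj v u) : dist (g v) (g u) = 1 := by
      rw [hgv, hg (hNs ((hv u).1 h))]
      exact hdist hx ((hv u).1 h)
    have hw' {u : V} (hwv : w ≠ v) (h : G.Adj w u) : dist (g w) (g u) = 1 := by
      rw [hgw hwv, hg (hNs ((hw u).1 h))]
      exact hdist hy ((hw u).1 h)
    rcases hcases a with rfl | ⟨rfl, ha⟩ | ha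
    · exact hv' hab
    · exact hw' ha hab
    rcases hcases b with rfl | ⟨rfl, hb⟩ | hb
    · rw [dist_comm]; exact hv' hab.symm
    · rw [dist_comm]; exact hw' hb hab.symm
    rw [hg ha, hg hb]
    exact dist_smul_eq_one hc (hnorm a (hmem ha.1 ha.2)) (hnorm b (hmem hb.1 hb.2))
      (horth a (hmem ha.1 ha.2) b (hmem hb.1 hb.2) hab)

variable [Fintype V] [DecidableRel G.Adj]

lemma degSum_univ : degSum G univ = 2 * #G.edgeFinset := by
  rw [← G.sum_degrees_eq_twice_card_edges]
  refine sum_congr rfl fun v _ => ?_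
  rw [degIn, ← G.neighborFinset_eq_filter, G.card_neighborFinset_eq_degree]

variable [DecidableEq V]

lemma graphRealizable_of_clique {d : ℕ} (hd : 4 ≤ d)
    (hsum : degSum G univ + 2 ≤ (d + 2) * (d + 1)) {Q : Finset V} (hQ : G.IsClique (Q : Set V))
    (hcard : #Q = d + 1) : GraphRealizable G d := by
  obtain ⟨v, hv, hvQ⟩ :=
    exists_neighbors_subset_of_clique (subset_univ Q) hQ hcard (by omega)
  have hNcl : G.IsClique (Q.erase v : Finset V) := hQ.subset (by exact_mod_cast erase_subset _ _)
  have hNcard : #(Q.erase v) = d := by rw [card_erase_of_mem hv, hcard]; rfl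
  have hN : (Q.erase v).Nonempty := card_pos.1 (by omega)
  have hNv (u) : G.Adj v u ↔ u ∈ Q.erase v := by
    rw [mem_erase]
    exact ⟨fun h => ⟨h.ne', hvQ u (mem_univ u) h⟩, fun h => hQ hv h.2 h.1.symm⟩
  have hdegv : degIn G univ v = d := by
    rw [← hNcard, degIn]
    congr 1
    ext u
    simp [hNv]
  have h1 := degSum_erase (G := G) (mem_univ v)
  by_cases hQ' : ∃ R ⊆ univ.erase v, G.IsClique (R : Set V) ∧ #R = d + 1
  · obtain ⟨R, hR, hRcl, hRcard⟩ := hQ'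
    have hRsum := degSum_of_clique hRcl
    have hout {u} (hu : u ∈ univ.erase v) (huR : u ∉ R) : degIn G (univ.erase v) u = 0 := by
      have h2 := degSum_add_le_of_notMem (G := G) hR hu huR
      rw [hRcard] at hRsum
      nlinarith
    have hsub : Q.erase v ⊆ R := by
      intro u hu
      by_contra huR
      have h2 := degIn_of_clique hNcl hu
      have h3 := degIn_mono (G := G) (erase_subset_erase v (subset_univ Q)) u
      have h4 := hout (by simpa using ne_of_mem_erase hu) huR
      omega
    obtain ⟨w, hwR, hwN⟩ := exists_mem_notMem_of_card_lt_card
      (show #(Q.erase v) < #R by omega)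
    have hReq : insert w (Q.erase v) = R := by
      refine eq_of_subset_of_card_le (insert_subset hwR hsub) ?_
      rw [card_insert_of_notMem hwN]
      omega
    have hNw (u) : G.Adj w u ↔ u ∈ Q.erase v := by
      refine ⟨fun h => ?_, fun h => hRcl hwR (hsub h) fun hwu => hwN (hwu ▸ h)⟩
      have huv : u ∈ univ.erase v := by
        rw [mem_erase]
        exact ⟨fun huv => hwN ((hNv w).1 (huv ▸ h).symm), mem_univ u⟩
      have huR : u ∈ R := by
        by_contra huR
        have h2 := hout huv huR
        exact (card_pos.2 ⟨w, mem_filter.2 ⟨hR hwR, h.symm⟩⟩).ne' h2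
      rw [← hReq] at huR
      exact (mem_insert.1 huR).resolve_left h.ne'
    refine .of_twins hN hNcl hNv hNw (Admissible.orthoRep hd ?_)
    have h2 := degSum_erase (G := G) (hR hwR)
    have h3 := degIn_of_clique hRcl hwR
    have h4 := degIn_mono (G := G) hR w
    refine admissible_of_degSum_lt (by nlinarith) fun t ht htcl htcard => ?_
    have h5 := le_degSum_of_clique ht htcl htcard.ge
    nlinarith
  · push Not at hQ'
    refine .of_twins hN hNcl hNv hNv (Admissible.orthoRep hd ?_)
    rw [erase_idem]
    exact admissible_of_degSum_lt (by nlinarith) hQ'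

lemma graphRealizable_of_join {d : ℕ} (hd : 4 ≤ d)
    (hsum : degSum G univ + 2 ≤ (d + 2) * (d + 1))
    (hcl : ∀ r : Finset V, G.IsClique (r : Set V) → #r ≠ d + 1) {t C : Finset V}
    (ht : G.IsClique (t : Set V)) (hcard : #t + 1 = d) (hC : #C = 3)
    (htC : ∀ v ∈ C, ∀ u ∈ t, G.Adj u v) : GraphRealizable G d := by
  obtain ⟨c, -, htc, hct⟩ := exists_neighbors_subset_of_join (subset_univ t) ht hcard
    (subset_univ C) hC htC (fun r _ => hcl r) (by omega)
  have hNc (u) : G.Adj c u ↔ u ∈ t := ⟨hct u (mem_univ u), fun h => (htc u h).symm⟩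
  have hdegc : degIn G univ c = #t := by
    rw [degIn]
    congr 1
    ext u
    simp [hNc]
  have h1 := degSum_erase (G := G) (mem_univ c)
  refine .of_twins (card_pos.1 (by omega)) ht hNc hNc (Admissible.orthoRep hd ?_)
  rw [erase_idem]
  exact admissible_of_degSum_lt (by nlinarith) fun r _ => hcl r

end UnitDistance

theorem stmt_2 {V : Type*} [Fintype V] (d : ℕ) (hd : 3 < d)
    (G : SimpleGraph V) [DecidableRel G.Adj]
    (hedges : G.edgeFinset.card < (d + 2).choose 2) :
    GraphRealizable G d := by
  classical
  have hsum : UnitDistance.degSum G Finset.univ + 2 ≤ (d + 2) * (d + 1) := by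
    have h1 : (d + 2) * (d + 1) = (d + 2).choose 2 * 2 := by
      simpa using Nat.add_one_mul_choose_eq (d + 1) 1
    rw [UnitDistance.degSum_univ]
    omega
  by_contra hG
  have hQ (Q : Finset V) (hQ : G.IsClique (Q : Set V)) : Q.card ≠ d + 1 := fun hcard =>
    hG (UnitDistance.graphRealizable_of_clique hd hsum hQ hcard)
  have hadm : UnitDistance.Admissible G Finset.univ d := by
    refine ⟨by omega, fun t _ ht => ?_, fun t _ ht hcard => ?_⟩
    · by_contra! h
      obtain ⟨r, hr, hcard⟩ := Finset.exists_subset_card_eq (show d + 1 ≤ t.card from h)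
      exact hQ r (ht.subset (by exact_mod_cast hr)) hcard
    · by_contra! h
      obtain ⟨C, hC, hC3⟩ := Finset.exists_subset_card_eq h
      exact hG (UnitDistance.graphRealizable_of_join hd hsum hQ ht hcard hC3
        fun v hv => by simpa using hC hv)
  exact hG (hadm.orthoRep hd).graphRealizable
end
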